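/- Let G and H be finite metacyclic groups. If ℚG and ℚH are isomorphic as ℚ-algebras, then s^G = s^H. -/

import Mathlib

open scoped Classical

noncomputable section

namespace ArXiv230800432

/-- The `σ`-part of a natural number: product of `p ^ vₚ(n)` over primes `p ∈ σ` dividing `n`. -/
def natPart (n : ℕ) (σ : Set ℕ) : ℕ :=
  ∏ p ∈ n.primeFactors, if p ∈ σ then p ^ (n.factorization p) else 1

/-- A metacyclic factorization `G = A·B` with `A` cyclic normal and `B` cyclic. -/
structure MetacyclicFact (G : Type*) [Group G] where
  A : Subgroup G
  B : Subgroup G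
  normalA : A.Normal
  cyclicA : IsCyclic A
  cyclicB : IsCyclic B
  mul_cover : ∀ g : G, ∃ x ∈ A, ∃ y ∈ B, g = x * y

/-- A group is metacyclic if it admits a metacyclic factorization. -/
def IsMetacyclic (G : Type*) [Group G] : Prop :=
  Nonempty (MetacyclicFact G)

variable {G : Type*} [Group G]

/-- `π_G`: primes `p` dividing `|G|` such that `G` has a normal Hall `p'`-subgroup. -/
def piSet (G : Type*) [Group G] : Set ℕ :=
  {p | p.Prime ∧ p ∣ Nat.card G ∧
    ∃ N : Subgroup G, N.Normal ∧ Nat.card N = ordCompl[p] (Nat.card G)}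

/-- `π'_G = π(G) \ π_G`. -/
def piSet' (G : Type*) [Group G] : Set ℕ :=
  {p | p.Prime ∧ p ∣ Nat.card G} \ piSet G

/-- The image mod `d` of `T_G(A)`: classes `[t]_d` such that some `g ∈ G` acts on `A` by
conjugation as `x ↦ x ^ t`.  For `d = |A|` this is exactly `T_G(A)`. -/
def TGmod (A : Subgroup G) (d : ℕ) : Subgroup (ZMod d)ˣ :=
  Subgroup.closure
    {u : (ZMod d)ˣ | ∃ g : G, ∃ t : ℕ, ((t : ZMod d) = (u : ZMod d)) ∧
      ∀ x ∈ A, g⁻¹ * x * g = x ^ t}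

/-- `T_G(A)` as subgroup of `(ℤ/|A|ℤ)ˣ`. -/
def TG (A : Subgroup G) : Subgroup (ZMod (Nat.card A))ˣ :=
  TGmod A (Nat.card A)

/-- The image of `T` under `Res_q : (ℤ/dℤ)ˣ → (ℤ/qℤ)ˣ` is trivial. -/
def resTriv (d q : ℕ) (T : Subgroup (ZMod d)ˣ) : Prop :=
  ∀ u ∈ T, ∀ t : ℕ, ((t : ZMod d) = (u : ZMod d)) → (t : ZMod q) = 1

/-- The image of `T` under `Res_q` is contained in `⟨-1⟩`. -/
def resInPMOne (d q : ℕ) (T : Subgroup (ZMod d)ˣ) : Prop :=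
  ∀ u ∈ T, ∀ t : ℕ, ((t : ZMod d) = (u : ZMod d)) →
    ((t : ZMod q) = 1 ∨ (t : ZMod q) = -1)

/-- The image of `T` under `Res_q` as a set of units mod `q`. -/
def resSet (d q : ℕ) (T : Subgroup (ZMod d)ˣ) : Set (ZMod q)ˣ :=
  {v | ∃ u ∈ T, ∃ t : ℕ, ((t : ZMod d) = (u : ZMod d)) ∧ ((t : ZMod q) = (v : ZMod q))}

/-- The set of natural numbers representing elements of `T ≤ (ℤ/dℤ)ˣ`. -/
def liftSet {d : ℕ} (T : Subgroup (ZMod d)ˣ) : Set ℕ :=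
  {t | ∃ u ∈ T, (t : ZMod d) = (u : ZMod d)}

/-- `r^G(A)`: the greatest divisor `r` of `|A|` such that `Res_{r_{2'}}(T_G(A)) = 1` and
`Res_{r_2}(T_G(A)) ⊆ ⟨-1⟩`. -/
def rOfA (A : Subgroup G) : ℕ :=
  sSup {r : ℕ | r ∣ Nat.card A ∧ resTriv (Nat.card A) (ordCompl[2] r) (TG A) ∧
    resInPMOne (Nat.card A) (ordProj[2] r) (TG A)}

/-- `ε^G(A)`: `-1` if `Res_{r_2}(T_G(A)) ≠ 1`, and `1` otherwise. -/
def epsOfA (A : Subgroup G) : ℤ :=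
  if resTriv (Nat.card A) (ordProj[2] (rOfA A)) (TG A) then 1 else -1

/-- `k^G(A)`: order of the image of `T_G(A)` in `(ℤ/m_ν ℤ)ˣ`, `ν` the primes dividing `|A|`
but not `r^G(A)`. -/
def kOfA (A : Subgroup G) : ℕ :=
  (resSet (Nat.card A) (natPart (Nat.card A) {p | ¬ p ∣ rOfA A}) (TG A)).ncard

/-- The triple `(|A|, r^G(A), [G:B])` attached to a metacyclic factorization. -/
def factTriple (f : MetacyclicFact G) : ℕ × ℕ × ℕ :=
  (Nat.card f.A, rOfA f.A, f.B.index)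

/-- Lexicographic order on triples. -/
def lex3 (x y : ℕ × ℕ × ℕ) : Prop :=
  x.1 < y.1 ∨ (x.1 = y.1 ∧ (x.2.1 < y.2.1 ∨ (x.2.1 = y.2.1 ∧ x.2.2 ≤ y.2.2)))

/-- A metacyclic factorization is minimal when its triple is lexicographically minimal. -/
def IsMinimalFact (f : MetacyclicFact G) : Prop :=
  ∀ f' : MetacyclicFact G, lex3 (factTriple f) (factTriple f')

def mOf (f : MetacyclicFact G) : ℕ := Nat.card f.A
def nOf (f : MetacyclicFact G) : ℕ := f.A.index
def sOf (f : MetacyclicFact G) : ℕ := f.B.index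
def rOf (f : MetacyclicFact G) : ℕ := rOfA f.A
def epsOf (f : MetacyclicFact G) : ℤ := epsOfA f.A
def kOf (f : MetacyclicFact G) : ℕ := kOfA f.A

/-- The `σ`-part of an element of a finite group. -/
def elemPart (σ : Set ℕ) (g : G) : G :=
  g ^ ((orderOf g / natPart (orderOf g) σ) *
    (((orderOf g / natPart (orderOf g) σ : ℕ) : ZMod (natPart (orderOf g) σ))⁻¹.val))

/-- The (unique, for `N` cyclic) Hall `σ`-subgroup of a subgroup `N`. -/
def hallOf (N : Subgroup G) (σ : Set ℕ) : Subgroup G :=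
  Subgroup.closure {x : G | x ∈ N ∧ orderOf x ∣ natPart (Nat.card N) σ}

/-- `R^G = T_G(G'_{π'})`, realized as a subgroup of `(ℤ/dℤ)ˣ`. -/
def ROf (G : Type*) [Group G] (d : ℕ) : Subgroup (ZMod d)ˣ :=
  TGmod (hallOf (commutator G) (piSet' G)) d

set_option linter.unusedSectionVars false

/-- The number of solutions of `m * z = 0` in `ZMod (m * n)` is `m`. -/
lemma ncard_mul_eq_zero {N m n : ℕ} (hN : N = m * n) (h0 : N ≠ 0) :
    {z : ZMod N | (m : ZMod N) * z = 0}.ncard = m := by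
  have hn : 0 < n := Nat.pos_of_ne_zero (by rintro rfl; simp_all)
  have hm : 0 < m := Nat.pos_of_ne_zero (by rintro rfl; simp_all)
  have : NeZero N := ⟨h0⟩
  have : {z : ZMod N | (m : ZMod N) * z = 0} =
      (fun k : ℕ => ((n * k : ℕ) : ZMod N)) '' (Finset.range m : Set ℕ) := by
    ext z
    constructor
    · intro hz
      have hz' : (m : ZMod N) * z = 0 := hz
      rw [← ZMod.natCast_zmod_val z, ← Nat.cast_mul, ZMod.natCast_eq_zero_iff] at hz'
      obtain ⟨k, hk⟩ := (Nat.mul_dvd_mul_iff_left hm).1 ((dvd_of_eq hN.symm).trans hz')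
      refine ⟨k, ?_, ?_⟩
      · simp only [Finset.coe_range, Set.mem_Iio]
        have h2 : n * k < n * m := by
          calc n * k = ZMod.val z := by rw [hk]
            _ < N := ZMod.val_lt z
            _ = n * m := by rw [hN, mul_comm]
        exact lt_of_mul_lt_mul_left h2 (Nat.zero_le _)
      · simp only
        rw [← hk, ZMod.natCast_zmod_val]
    · rintro ⟨k, -, rfl⟩
      simp only [Set.mem_ofPred_eq]
      rw [← Nat.cast_mul, ZMod.natCast_eq_zero_iff, hN, ← mul_assoc]
      exact dvd_mul_right _ _
  rw [this, Set.InjOn.ncard_image, Set.ncard_coe_finset, Finset.card_range]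
  intro a ha b hb hab
  simp only [Finset.coe_range, Set.mem_Iio] at ha hb
  simp only [ZMod.natCast_eq_natCast_iff'] at hab
  have h1 : n * a < N := by rw [hN, mul_comm m]; exact Nat.mul_lt_mul_of_pos_left ha hn
  have h2 : n * b < N := by rw [hN, mul_comm m]; exact Nat.mul_lt_mul_of_pos_left hb hn
  rw [Nat.mod_eq_of_lt h1, Nat.mod_eq_of_lt h2] at hab
  exact Nat.eq_of_mul_eq_mul_left hn hab

section PrimePower

variable {p e : ℕ} [Fact p.Prime]

lemma ncard_pow_mul_eq_zero {a : ℕ} (ha : a ≤ e) :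
    {z : ZMod (p ^ e) | (p : ZMod (p ^ e)) ^ a * z = 0}.ncard = p ^ a := by
  have := ncard_mul_eq_zero (N := p ^ e) (m := p ^ a) (n := p ^ (e - a))
    (by rw [← pow_add]; congr 1; omega) (pow_ne_zero _ (Fact.out : p.Prime).ne_zero)
  simpa using this

lemma pow_mul_eq_zero_mono {z : ZMod (p ^ e)} {a b : ℕ} (hab : a ≤ b)
    (h : (p : ZMod (p ^ e)) ^ a * z = 0) : (p : ZMod (p ^ e)) ^ b * z = 0 := by
  obtain ⟨c, rfl⟩ := Nat.exists_eq_add_of_le hab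
  rw [pow_add, mul_comm (_ ^ a), mul_assoc, h, mul_zero]

lemma pow_eq_zero_iff_le {a : ℕ} : (p : ZMod (p ^ e)) ^ a = 0 ↔ e ≤ a := by
  rw [← Nat.cast_pow, ZMod.natCast_eq_zero_iff,
    Nat.pow_dvd_pow_iff_le_right (Fact.out : p.Prime).one_lt]

lemma pow_mul_eq_zero_min {z : ZMod (p ^ e)} {a b : ℕ}
    (ha : (p : ZMod (p ^ e)) ^ a * z = 0) (hb : (p : ZMod (p ^ e)) ^ b * z = 0) :
    (p : ZMod (p ^ e)) ^ (min a b) * z = 0 := by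
  rcases min_choice a b with h | h <;> rw [h] <;> assumption

lemma isUnit_natCast_of_not_dvd {u : ℕ} (hu : ¬ p ∣ u) : IsUnit (u : ZMod (p ^ e)) := by
  rw [ZMod.isUnit_iff_coprime]
  exact (Nat.Coprime.pow_right _ (((Fact.out : p.Prime).coprime_iff_not_dvd.2 hu).symm))

/-- Elements congruent to a unit modulo `p` are units. -/
lemma isUnit_add_p_mul {u : ℕ} (hu : ¬ p ∣ u) (y : ZMod (p ^ e)) :
    IsUnit ((u : ZMod (p ^ e)) + p * y) := by
  have : NeZero (p ^ e) := ⟨pow_ne_zero _ (Fact.out : p.Prime).ne_zero⟩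
  rw [← ZMod.natCast_zmod_val y, ← Nat.cast_mul, ← Nat.cast_add]
  apply isUnit_natCast_of_not_dvd
  rwa [Nat.dvd_add_left (dvd_mul_right _ _)]

lemma isUnit_one_add_p_mul (y : ZMod (p ^ e)) : IsUnit (1 + p * y) := by
  simpa using isUnit_add_p_mul (u := 1) (Fact.out : p.Prime).not_dvd_one y

/-- Lifting the exponent: the shape of `τ ^ (p ^ i)` when `τ = 1 + p ^ r * u`. -/
lemma exists_pow_pow_eq {τ r u : ℕ} (hτ : τ = 1 + p ^ r * u) (hu : ¬ p ∣ u) (hr : 1 ≤ r)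
    (hr2 : p = 2 → 2 ≤ r) (i : ℕ) : ∃ v, ¬ p ∣ v ∧ τ ^ (p ^ i) = 1 + p ^ (r + i) * v := by
  have hp : p.Prime := Fact.out
  induction i with
  | zero => exact ⟨u, hu, by simpa using hτ⟩
  | succ i ih =>
    obtain ⟨v, hv, h⟩ := ih
    obtain ⟨k, hk⟩ : ∃ k, (1 + p ^ (r + i) * v) ^ p = 1 + p ^ (r + i + 1) * (v + p * k) := by
      rcases hp.eq_two_or_odd' with h2 | ho
      · subst h2
        obtain ⟨q, hq⟩ := Nat.exists_eq_add_of_le (show 2 ≤ r + i by have := hr2 rfl; omega)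
        refine ⟨2 ^ q * v ^ 2, ?_⟩
        rw [hq]; ring
      · obtain ⟨q, hq⟩ := Nat.exists_eq_add_of_le (show 1 ≤ r + i by omega)
        have h3 : 3 ≤ p := by
          have := hp.two_le
          rcases ho with ⟨c, hc⟩; omega
        set x := p ^ (r + i) * v with hx
        have hdvd : p ^ (r + i + 2) ∣ ∑ j ∈ Finset.Ico 2 (p + 1), x ^ j * p.choose j := by
          apply Finset.dvd_sum
          intro j hj
          rw [Finset.mem_Ico] at hj
          rcases Nat.lt_or_ge j p with hjp | hjp
          · have h1 : p ∣ p.choose j := hp.dvd_choose_self (by omega) hjp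
            have h2 : p ^ (r + i + 1) ∣ x ^ j := by
              have : p ^ (r + i) ∣ x := dvd_mul_right _ _
              refine dvd_trans ?_ (pow_dvd_pow_of_dvd this j)
              rw [← pow_mul]
              apply pow_dvd_pow
              nlinarith
            have := Nat.mul_dvd_mul h2 h1
            rwa [← pow_succ] at this
          · have hjp' : j = p := by omega
            subst hjp'
            refine Dvd.dvd.mul_right ?_ _
            have : j ^ (r + i) ∣ x := dvd_mul_right _ _
            refine dvd_trans ?_ (pow_dvd_pow_of_dvd this j)
            rw [← pow_mul]
            apply pow_dvd_pow
            nlinarith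
        obtain ⟨k, hk⟩ := hdvd
        refine ⟨k, ?_⟩
        rw [add_comm 1 x, add_pow, Finset.range_eq_Ico,
          ← Finset.sum_Ico_consecutive _ (show 0 ≤ 2 by omega) (show 2 ≤ p + 1 by omega)]
        simp only [one_pow, mul_one, Nat.cast_id]
        rw [hk]
        simp [Finset.sum_range_succ]
        rw [hx]; ring
    refine ⟨v + p * k, ?_, ?_⟩
    · rwa [Nat.dvd_add_left (dvd_mul_right _ _)]
    · rw [pow_succ, pow_mul, h, hk, add_assoc]

/-- The powers of `1 + p ^ r * u` exhaust `1 + p ^ r ℤ` modulo `p ^ e`. -/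
lemma exists_pow_eq_one_add {τ r u : ℕ} (hτ : τ = 1 + p ^ r * u) (hu : ¬ p ∣ u) (hr : 1 ≤ r)
    (hr2 : p = 2 → 2 ≤ r) (c : ℕ) (E : ℕ) :
    ∃ k : ℕ, ((p : ℤ) ^ E) ∣ (τ : ℤ) ^ k - (1 + p ^ r * c) := by
  have hp : p.Prime := Fact.out
  induction E with
  | zero => exact ⟨0, by simp⟩
  | succ E ih =>
    rcases Nat.lt_or_ge E r with hE | hE
    · refine ⟨0, ?_⟩
      have : (p : ℤ) ^ (E + 1) ∣ (p : ℤ) ^ r := pow_dvd_pow _ hE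
      simpa using this.mul_right (c : ℤ)
    obtain ⟨k, x, hx⟩ := ih
    obtain ⟨v, hv, h⟩ := exists_pow_pow_eq hτ hu hr hr2 (E - r)
    have hrE : r + (E - r) = E := by omega
    rw [hrE] at h
    have hcop : IsCoprime ((p : ℤ)) ((τ : ℤ) ^ k * v) := by
      rw [show ((τ : ℤ) ^ k * v) = ((τ ^ k * v : ℕ) : ℤ) by push_cast; ring]
      rw [Nat.isCoprime_iff_coprime]
      refine Nat.Coprime.mul_right (Nat.Coprime.pow_right _ ?_) (hp.coprime_iff_not_dvd.2 hv)
      rw [hp.coprime_iff_not_dvd, hτ]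
      intro h1
      have : p ∣ p ^ r * u := (dvd_pow_self p (by omega)).mul_right _
      exact hp.not_dvd_one ((Nat.dvd_add_left this).1 h1)
    obtain ⟨a, b, hab⟩ := hcop
    -- choose `l ≡ - b * x` modulo `p`
    obtain ⟨l, hl⟩ : ∃ l : ℕ, (p : ℤ) ∣ (l : ℤ) + b * x := by
      refine ⟨((-(b * x)) % p).toNat, ?_⟩
      have hp0 : (p : ℤ) ≠ 0 := by exact_mod_cast hp.ne_zero
      rw [Int.toNat_of_nonneg (Int.emod_nonneg _ hp0)]
      have := Int.emod_add_mul_ediv (-(b * x)) p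
      exact ⟨-(-(b * x) / p), by linarith⟩
    obtain ⟨q, hq⟩ := hl
    have hpow : ∃ y : ℤ, ((1 : ℤ) + p ^ E * v) ^ l = 1 + p ^ E * v * l + p ^ (E + 1) * y := by
      obtain ⟨E', rfl⟩ := Nat.exists_eq_add_of_le (show 1 ≤ E by omega)
      clear hq
      induction l with
      | zero => exact ⟨0, by simp⟩
      | succ l ihl =>
        obtain ⟨y, hy⟩ := ihl
        refine ⟨y * (1 + p ^ (1 + E') * v) + p ^ E' * v * v * l, ?_⟩
        rw [pow_succ, hy]; push_cast; ring
    obtain ⟨y, hy⟩ := hpow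
    refine ⟨k + p ^ (E - r) * l, ?_⟩
    have h' : (τ : ℤ) ^ (p ^ (E - r)) = 1 + p ^ E * v := by exact_mod_cast h
    rw [pow_add (τ : ℤ) k, pow_mul (τ : ℤ), h', hy]
    have e1 : (τ : ℤ) ^ k = (1 + p ^ r * c) + p ^ E * x := by linarith
    refine ⟨τ ^ k * y + x * a + τ ^ k * v * q, ?_⟩
    have : x = x * (a * p + b * (τ ^ k * v)) := by rw [hab, mul_one]
    have e2 : (l : ℤ) = p * q - b * x := by linarith
    rw [e2]
    linear_combination hx + p ^ E * this
  
end PrimePower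

section PrimePower

variable {p e : ℕ} [Fact p.Prime]

/-- The local solution set attached to the linear characters. -/
def linSet (p e μ ν γ τ t : ℕ) : Set (ZMod (p ^ e) × ZMod (p ^ e)) :=
  {q | (p : ZMod (p ^ e)) ^ μ * q.1 = 0 ∧ (τ : ZMod (p ^ e)) * q.1 = q.1 ∧
    (p : ZMod (p ^ e)) ^ ν * q.2 = (p : ZMod (p ^ e)) ^ γ * q.1 ∧
    (t : ZMod (p ^ e)) * q.2 = q.2 ∧ (t : ZMod (p ^ e)) * q.1 = q.1}

/-- The local solution set attached to characters of level `f` over a part of level `i`. -/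
def locSet (p e μ ν γ τ i f t : ℕ) : Set (ZMod (p ^ e) × ZMod (p ^ e)) :=
  {q | f ≤ ν ∧ i ≤ f ∧ (p : ZMod (p ^ e)) ^ μ * q.1 = 0 ∧
    (τ : ZMod (p ^ e)) ^ (p ^ f) * q.1 = q.1 ∧
    (i = f ∨ (τ : ZMod (p ^ e)) ^ (p ^ (f - 1)) * q.1 ≠ q.1) ∧
    (p : ZMod (p ^ e)) ^ (ν - f) * q.2 = (p : ZMod (p ^ e)) ^ γ * q.1 ∧
    (t : ZMod (p ^ e)) * q.2 = q.2 ∧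
    ∃ k : ℕ, (t : ZMod (p ^ e)) * q.1 = (τ : ZMod (p ^ e)) ^ (p ^ i * k) * q.1}

/-- An explicit form of `locSet` when `τ` is `1` modulo `p` and `t = 1 + p ^ j`. -/
def expSet (p e μ ν γ ρ i f j : ℕ) : Set (ZMod (p ^ e) × ZMod (p ^ e)) :=
  {q | f ≤ ν ∧ i ≤ f ∧ (p : ZMod (p ^ e)) ^ μ * q.1 = 0 ∧
    (p : ZMod (p ^ e)) ^ (ρ + f) * q.1 = 0 ∧
    (i = f ∨ (p : ZMod (p ^ e)) ^ (ρ + f - 1) * q.1 ≠ 0) ∧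
    (p : ZMod (p ^ e)) ^ (ν - f) * q.2 = (p : ZMod (p ^ e)) ^ γ * q.1 ∧
    (p : ZMod (p ^ e)) ^ j * q.2 = 0 ∧
    ((p : ZMod (p ^ e)) ^ j * q.1 = 0 ∨ ρ + i ≤ j)}

lemma one_add_mul_eq_self_iff {R : Type*} [Ring R] (x z : R) : (1 + x) * z = z ↔ x * z = 0 := by
  rw [add_mul, one_mul, add_eq_left]

lemma cast_one_add_pow_mul_eq (j : ℕ) (z : ZMod (p ^ e)) :
    ((1 + p ^ j : ℕ) : ZMod (p ^ e)) * z = z ↔ (p : ZMod (p ^ e)) ^ j * z = 0 := by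
  push_cast
  exact one_add_mul_eq_self_iff _ _

lemma unit_mul_pow_mul_eq_zero {v : ℕ} (hv : ¬ p ∣ v) (a : ℕ) (z : ZMod (p ^ e)) :
    (p : ZMod (p ^ e)) ^ a * v * z = 0 ↔ (p : ZMod (p ^ e)) ^ a * z = 0 := by
  rw [mul_comm (_ ^ a), mul_assoc]
  exact (isUnit_natCast_of_not_dvd (e := e) hv).mul_right_eq_zero

lemma pow_pow_mul_eq_self_iff {τ r u : ℕ} (hτ : τ = 1 + p ^ r * u) (hu : ¬ p ∣ u) (hr : 1 ≤ r)
    (hr2 : p = 2 → 2 ≤ r) (i : ℕ) (z : ZMod (p ^ e)) :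
    (τ : ZMod (p ^ e)) ^ (p ^ i) * z = z ↔ (p : ZMod (p ^ e)) ^ (r + i) * z = 0 := by
  obtain ⟨v, hv, h⟩ := exists_pow_pow_eq hτ hu hr hr2 i
  rw [← Nat.cast_pow, h]
  push_cast
  rw [one_add_mul_eq_self_iff, unit_mul_pow_mul_eq_zero hv]

lemma exists_pow_mul_eq_iff {τ r u : ℕ} (hτ : τ = 1 + p ^ r * u) (hu : ¬ p ∣ u) (hr : 1 ≤ r)
    (hr2 : p = 2 → 2 ≤ r) (i j : ℕ) (z : ZMod (p ^ e)) :
    (∃ k : ℕ, ((1 + p ^ j : ℕ) : ZMod (p ^ e)) * z = (τ : ZMod (p ^ e)) ^ (p ^ i * k) * z) ↔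
      ((p : ZMod (p ^ e)) ^ j * z = 0 ∨ r + i ≤ j) := by
  have hp : p.Prime := Fact.out
  obtain ⟨v, hv, h⟩ := exists_pow_pow_eq hτ hu hr hr2 i
  constructor
  · rintro ⟨k, hk⟩
    by_contra! hcon
    obtain ⟨hz, hj⟩ := hcon
    apply hz
    obtain ⟨y, hy⟩ : ∃ y : ℕ, (1 + p ^ (r + i) * v) ^ k = 1 + p ^ (r + i) * y := by
      clear hk
      induction k with
      | zero => exact ⟨0, by simp⟩
      | succ k ih =>
        obtain ⟨y, hy⟩ := ih
        exact ⟨y + v + p ^ (r + i) * y * v, by rw [pow_succ, hy]; ring⟩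
    rw [pow_mul, ← Nat.cast_pow, h, ← Nat.cast_pow, hy] at hk
    obtain ⟨c, hc⟩ := Nat.exists_eq_add_of_le (show j + 1 ≤ r + i by omega)
    rw [hc] at hk
    have h0 : (1 + (p : ZMod (p ^ e)) * (-(p ^ c * y))) * (p ^ j * z) = 0 := by
      push_cast at hk
      linear_combination hk
    exact (isUnit_one_add_p_mul _).mul_right_eq_zero.1 h0
  · rintro (h0 | h0)
    · exact ⟨0, by rw [cast_one_add_pow_mul_eq j z |>.2 h0]; simp⟩
    · obtain ⟨c, hc⟩ := Nat.exists_eq_add_of_le h0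
      obtain ⟨k, hk⟩ := exists_pow_eq_one_add h hv (by omega) (fun h2 => by have := hr2 h2; omega)
        (p ^ c) e
      refine ⟨k, ?_⟩
      congr 1
      rw [← sub_eq_zero, pow_mul, ← neg_eq_zero]
      have := (ZMod.intCast_zmod_eq_zero_iff_dvd _ (p ^ e)).2 (by exact_mod_cast hk)
      push_cast at this ⊢
      rw [hc, ← this]
      ring

variable {τ r u : ℕ}

lemma locSet_eq_expSet (hτ : τ = 1 + p ^ r * u) (hu : ¬ p ∣ u) (hr : 1 ≤ r)
    (hr2 : p = 2 → 2 ≤ r) (μ ν γ i f j : ℕ) :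
    locSet p e μ ν γ τ i f (1 + p ^ j) = expSet p e μ ν γ (min r μ) i f j := by
  ext ⟨z, w⟩
  simp only [locSet, expSet, Set.mem_ofPred_eq, pow_pow_mul_eq_self_iff hτ hu hr hr2,
    exists_pow_mul_eq_iff hτ hu hr hr2, cast_one_add_pow_mul_eq, ne_eq]
  rcases le_total r μ with h | h
  · rw [min_eq_left h]
    refine and_congr_right fun h1 => and_congr_right fun h2 => and_congr_right fun h3 =>
      and_congr_right fun h4 => and_congr_left fun h5 => ?_
    refine or_congr_right' fun hif => ?_
    rw [Nat.add_sub_assoc (by omega)]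
  · rw [min_eq_right h]
    refine and_congr_right fun h1 => and_congr_right fun h2 => and_congr_right fun h3 => ?_
    have a1 : ∀ b, (p : ZMod (p ^ e)) ^ (μ + b) * z = 0 := fun b =>
      pow_mul_eq_zero_mono (by omega) h3
    have a2 : ∀ b, (p : ZMod (p ^ e)) ^ (r + b) * z = 0 := fun b =>
      pow_mul_eq_zero_mono (by omega) h3
    simp only [a1, a2, true_and, not_true, or_false]
    refine and_congr ?_ (and_congr_right fun h4 => and_congr_right fun h5 => ?_)
    · refine ⟨Or.inl, fun hh => hh.elim id fun hh => ?_⟩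
      by_contra hif
      rw [Nat.add_sub_assoc (by omega)] at hh
      exact hh (a1 _)
    · constructor
      · rintro (h6 | h6)
        · exact Or.inl h6
        · exact Or.inr (by omega)
      · rintro (h6 | h6)
        · exact Or.inl h6
        · exact Or.inl (pow_mul_eq_zero_mono (by omega) h3)

lemma ncard_prod_pow {a b : ℕ} (ha : a ≤ e) (hb : b ≤ e) :
    {q : ZMod (p ^ e) × ZMod (p ^ e) | (p : ZMod (p ^ e)) ^ a * q.1 = 0 ∧
      (p : ZMod (p ^ e)) ^ b * q.2 = 0}.ncard = p ^ (a + b) := by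
  have : {q : ZMod (p ^ e) × ZMod (p ^ e) | (p : ZMod (p ^ e)) ^ a * q.1 = 0 ∧
      (p : ZMod (p ^ e)) ^ b * q.2 = 0} = {z | (p : ZMod (p ^ e)) ^ a * z = 0} ×ˢ
      {z | (p : ZMod (p ^ e)) ^ b * z = 0} := by
    ext q; simp [Set.mem_prod]
  rw [this, Set.ncard_prod, ncard_pow_mul_eq_zero ha, ncard_pow_mul_eq_zero hb, pow_add]

lemma ncard_linSet_of_one {μ ν γ j : ℕ} (hτ : τ = 1 + p ^ r * u) (hu : ¬ p ∣ u) (hr : 1 ≤ r)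
    (hr2 : p = 2 → 2 ≤ r) (he : e = μ + ν) (hγμ : γ ≤ μ) (hγ : γ ≤ ν) :
    (linSet p e μ ν γ τ (1 + p ^ j)).ncard = p ^ (min (min (min r μ) γ) j +
      min (min r μ + ν - (min (min r μ) γ)) j) := by
  set ρ := min r μ with hρ
  have h0 : linSet p e μ ν γ τ (1 + p ^ j) = {q : ZMod (p ^ e) × ZMod (p ^ e) |
      (p : ZMod (p ^ e)) ^ ρ * q.1 = 0 ∧
      (p : ZMod (p ^ e)) ^ ν * q.2 = (p : ZMod (p ^ e)) ^ γ * q.1 ∧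
      (p : ZMod (p ^ e)) ^ j * q.2 = 0 ∧ (p : ZMod (p ^ e)) ^ j * q.1 = 0} := by
    ext ⟨z, w⟩
    have := pow_pow_mul_eq_self_iff (e := e) hτ hu hr hr2 0 z
    rw [pow_zero, pow_one, add_zero] at this
    simp only [linSet, Set.mem_ofPred_eq, cast_one_add_pow_mul_eq, this]
    rw [← and_assoc]
    refine and_congr_left fun _ => ⟨fun h => ?_, fun h => ?_⟩
    · exact pow_mul_eq_zero_min h.2 h.1
    · exact ⟨pow_mul_eq_zero_mono (by omega) h, pow_mul_eq_zero_mono (by omega) h⟩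
  rw [h0]
  rcases le_or_gt ρ γ with h | h
  · rw [min_eq_left h, Nat.add_sub_cancel_left, ← ncard_prod_pow (e := e) (by omega) (by omega)]
    congr 1
    ext ⟨z, w⟩
    simp only [Set.mem_ofPred_eq]
    constructor
    · rintro ⟨h1, h2, h3, h4⟩
      rw [pow_mul_eq_zero_mono h h1] at h2
      exact ⟨pow_mul_eq_zero_min h1 h4, pow_mul_eq_zero_min h2 h3⟩
    · rintro ⟨h1, h2⟩
      have h1' := pow_mul_eq_zero_mono (min_le_left _ _) h1
      refine ⟨h1', ?_, pow_mul_eq_zero_mono (min_le_right _ _) h2,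
        pow_mul_eq_zero_mono (min_le_right _ _) h1⟩
      rw [pow_mul_eq_zero_mono h h1', pow_mul_eq_zero_mono (min_le_left _ _) h2]
  · rw [min_eq_right h.le, ← ncard_prod_pow (e := e) (by omega) (by omega)]
    obtain ⟨c, rfl⟩ := Nat.exists_eq_add_of_le hγ
    refine Set.ncard_congr (fun q _ => (q.1 - p ^ c * q.2, q.2)) ?_ ?_ ?_
    · rintro ⟨z, w⟩ ⟨h1, h2, h3, h4⟩
      simp only at h1 h2 h3 h4
      simp only [Set.mem_ofPred_eq]
      have e1 : (p : ZMod (p ^ e)) ^ γ * (z - p ^ c * w) = 0 := by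
        rw [mul_sub, ← mul_assoc, ← pow_add, h2, sub_self]
      refine ⟨pow_mul_eq_zero_min e1 ?_, pow_mul_eq_zero_min ?_ h3⟩
      · rw [mul_sub, h4, mul_left_comm, h3]; simp
      · obtain ⟨x, hx⟩ := Nat.exists_eq_add_of_le h.le
        rw [show ρ + (γ + c) - γ = x + (γ + c) by omega, pow_add, mul_assoc, h2, ← mul_assoc,
          ← pow_add, add_comm x, ← hx, h1]
    · rintro ⟨z, w⟩ ⟨z', w'⟩ - - h
      simp only [Prod.mk.injEq] at h ⊢
      obtain ⟨h1, rfl⟩ := h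
      exact ⟨sub_left_injective h1, rfl⟩
    · rintro ⟨z, w⟩ ⟨h1, h2⟩
      simp only at h1 h2
      refine ⟨(z + p ^ c * w, w), ⟨?_, ?_, ?_, ?_⟩, by simp⟩ <;> simp only
      · rw [mul_add, pow_mul_eq_zero_mono (by omega) h1, ← mul_assoc, ← pow_add,
          pow_mul_eq_zero_mono (by omega) h2, add_zero]
      · rw [mul_add, pow_mul_eq_zero_mono (min_le_left _ _) h1, ← mul_assoc, ← pow_add, zero_add]
      · exact pow_mul_eq_zero_mono (min_le_right _ _) h2
      · rw [mul_add, pow_mul_eq_zero_mono (min_le_right _ _) h1, mul_left_comm,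
          pow_mul_eq_zero_mono (min_le_right _ _) h2]
        simp

lemma ncard_linSet_of_not {μ ν γ j : ℕ} (h : μ = 0 ∨ (1 ≤ τ ∧ ¬ p ∣ τ - 1)) (he : e = μ + ν) :
    (linSet p e μ ν γ τ (1 + p ^ j)).ncard = p ^ (min ν j) := by
  rw [← zero_add (min ν j), ← ncard_prod_pow (e := e) (by omega) (by omega)]
  congr 1
  ext ⟨z, w⟩
  simp only [linSet, Set.mem_ofPred_eq, cast_one_add_pow_mul_eq, pow_zero, one_mul]
  constructor
  · rintro ⟨h1, h2, h3, h4, h5⟩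
    have hz : z = 0 := by
      rcases h with rfl | ⟨h, h'⟩
      · simpa using h1
      · have : ((τ - 1 : ℕ) : ZMod (p ^ e)) * z = 0 := by
          push_cast [Nat.cast_sub h]
          rw [sub_mul, h2, one_mul, sub_self]
        exact (isUnit_natCast_of_not_dvd h').mul_right_eq_zero.1 this
    subst hz
    rw [mul_zero] at h3
    exact ⟨rfl, pow_mul_eq_zero_min h3 h4⟩
  · rintro ⟨rfl, h2⟩
    refine ⟨by simp, by simp, ?_, pow_mul_eq_zero_mono (min_le_right _ _) h2, by simp⟩
    rw [pow_mul_eq_zero_mono (min_le_left _ _) h2, mul_zero]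

lemma two_mul_eq_zero_of_three {x : ℕ} (hx : x % 4 = 2) {e : ℕ} {z : ZMod (2 ^ e)} :
    (x : ZMod (2 ^ e)) * z = 0 ↔ 2 * z = 0 := by
  have h2 : ¬ 2 ∣ x / 2 := by omega
  have : x = 2 * (x / 2) := by omega
  rw [this, mul_comm 2, Nat.cast_mul, mul_assoc]
  exact (isUnit_natCast_of_not_dvd h2).mul_right_eq_zero

lemma ncard_linSet_of_three {e μ ν γ j τ : ℕ} (h : τ % 4 = 3) (he : e = μ + ν) (hμ : 1 ≤ μ)
    (hγ : 1 ≤ γ) (hj : 1 ≤ j) :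
    (linSet 2 e μ ν γ τ (1 + 2 ^ j)).ncard = 2 ^ (1 + min ν j) := by
  rw [← ncard_prod_pow (e := e) (by omega) (by omega)]
  congr 1
  ext ⟨z, w⟩
  simp only [linSet, Set.mem_ofPred_eq, cast_one_add_pow_mul_eq, pow_one]
  have key : (τ : ZMod (2 ^ e)) * z = z ↔ (2 : ZMod (2 ^ e)) * z = 0 := by
    rw [← two_mul_eq_zero_of_three (x := τ - 1) (by omega), Nat.cast_sub (by omega), sub_mul,
      Nat.cast_one, one_mul, sub_eq_zero]
  constructor
  · rintro ⟨h1, h2, h3, h4, h5⟩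
    have hz := key.1 h2
    refine ⟨by exact_mod_cast hz, ?_⟩
    rw [pow_mul_eq_zero_mono hγ (by simpa using hz)] at h3
    exact pow_mul_eq_zero_min h3 h4
  · rintro ⟨h1, h2⟩
    have h1' : ((2 : ℕ) : ZMod (2 ^ e)) ^ 1 * z = 0 := by rwa [pow_one]
    refine ⟨pow_mul_eq_zero_mono hμ h1', key.2 (by exact_mod_cast h1), ?_,
      pow_mul_eq_zero_mono (min_le_right _ _) h2, pow_mul_eq_zero_mono hj h1'⟩
    rw [pow_mul_eq_zero_mono hγ h1', pow_mul_eq_zero_mono (min_le_left _ _) h2]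

/-- The exponents `u ≤ v` are determined by the counting function. -/
lemma exponents_unique {u v u' v' : ℕ} (h1 : u ≤ v) (h2 : u' ≤ v')
    (h : ∀ j, 1 ≤ j → p ^ (min u j + min v j) = p ^ (min u' j + min v' j)) :
    u = u' ∧ v = v' := by
  have h' : ∀ j, 1 ≤ j → min u j + min v j = min u' j + min v' j := fun j hj =>
    Nat.pow_right_injective (Fact.out : p.Prime).two_le (h j hj)
  have a := h' (u + v + u' + v' + 1) (by omega)
  have b := h' (u + 1) (by omega)
  have c := h' (u' + 1) (by omega)
  omega

end PrimePower

/-- The numerical data at a prime `p` of a metacyclic factorization. -/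
structure LocalData (p : ℕ) where
  mu : ℕ
  nu : ℕ
  gam : ℕ
  kap : ℕ
  tau : ℕ
  W : ℕ → ℕ → ℕ
  gam_le : gam ≤ mu
  one_lt_tau : 1 < tau
  stable : p ^ mu ∣ p ^ gam * (tau - 1)
  tau_pow : p ∣ tau - 1 → p ^ mu ∣ tau ^ (p ^ nu) - 1
  mod_four : p = 2 → mu = 1 → 4 ∣ tau - 1
  not_dvd : 0 < mu → ¬ p ∣ tau
  kap_le : kap ≤ nu
  W_zero : 0 < W 1 0
  W_kap : ∃ d, p.Coprime d ∧ 0 < W d kap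
  W_le : ∀ d i, W d i ≠ 0 → i ≤ kap
  gam_le_nu : 0 < mu → p ∣ tau - 1 → (p = 2 → 4 ∣ tau - 1) → gam ≤ nu
  rho_or : 0 < mu → p ∣ tau - 1 → (p = 2 → 4 ∣ tau - 1) →
    min (padicValNat p (tau - 1)) mu ≤ gam ∨ nu < gam + kap
  mu_lt : p = 2 → 4 ∣ tau + 1 → gam = mu → mu + 1 ≤ nu + padicValNat 2 (tau + 1)

namespace LocalData

variable {p : ℕ} [hp : Fact p.Prime]

/-- The prime acts unipotently, with the usual power structure. -/
def Reg (D : LocalData p) : Prop := 0 < D.mu ∧ p ∣ D.tau - 1 ∧ (p = 2 → 4 ∣ D.tau - 1)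

/-- The dihedral-like case at the prime `2`. -/
def Dih (D : LocalData p) : Prop := p = 2 ∧ 2 ≤ D.mu ∧ D.tau % 4 = 3

/-- The case without fixed points. -/
def Free (D : LocalData p) : Prop := D.mu = 0 ∨ ¬ p ∣ D.tau - 1

/-- The exponent of the part of the `p`-part of `A` fixed by the action. -/
def rho (D : LocalData p) : ℕ := min (padicValNat p (D.tau - 1)) D.mu

/-- The local solution set. -/
def X (D : LocalData p) (e i f t : ℕ) : Set (ZMod (p ^ e) × ZMod (p ^ e)) :=
  locSet p e D.mu D.nu D.gam D.tau i f t

/-- The local solution set for linear characters. -/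
def lin (D : LocalData p) (e t : ℕ) : Set (ZMod (p ^ e) × ZMod (p ^ e)) :=
  linSet p e D.mu D.nu D.gam D.tau t

lemma trichotomy (D : LocalData p) : D.Free ∨ D.Reg ∨ D.Dih := by
  have hp' := hp.out
  have h1 := D.one_lt_tau
  by_cases hF : D.Free
  · exact Or.inl hF
  rw [Free, not_or, not_not] at hF
  obtain ⟨h2, h3⟩ := hF
  right
  by_cases hp2 : p = 2
  · subst hp2
    by_cases h4 : 4 ∣ D.tau - 1
    · exact Or.inl ⟨by omega, h3, fun _ => h4⟩
    · refine Or.inr ⟨rfl, ?_, by omega⟩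
      by_contra h5
      exact h4 (D.mod_four rfl (by omega))
  · exact Or.inl ⟨by omega, h3, fun h => absurd h hp2⟩

lemma Reg.exists_eq {D : LocalData p} (h : D.Reg) : ∃ r u, D.tau = 1 + p ^ r * u ∧ ¬ p ∣ u ∧
    1 ≤ r ∧ (p = 2 → 2 ≤ r) ∧ D.rho = min r D.mu := by
  have hp' := hp.out
  have h1 := D.one_lt_tau
  have h0 : D.tau - 1 ≠ 0 := by omega
  obtain ⟨u, hu⟩ := (pow_padicValNat_dvd : p ^ padicValNat p (D.tau - 1) ∣ D.tau - 1)
  refine ⟨_, u, by omega, ?_, ?_, ?_, rfl⟩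
  · rintro ⟨v, rfl⟩
    apply pow_succ_padicValNat_not_dvd (p := p) h0
    exact ⟨v, by rw [pow_succ, mul_assoc]; exact hu⟩
  · have := (padicValNat_dvd_iff_le (p := p) h0 (n := 1)).1 (by simpa using h.2.1)
    omega
  · intro h2
    have := (padicValNat_dvd_iff_le (p := p) h0 (n := 2)).1 (by
      subst h2
      exact h.2.2 rfl)
    omega

lemma Reg.mu_le_gam_add {D : LocalData p} (h : D.Reg) : D.mu ≤ D.gam + D.rho := by
  obtain ⟨r, u, h1, h2, h3, h4, h5⟩ := h.exists_eq
  have := D.stable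
  rw [h1, Nat.add_sub_cancel_left, ← mul_assoc, ← pow_add] at this
  have := (((hp.out.coprime_iff_not_dvd.2 h2).pow_left D.mu).dvd_of_dvd_mul_right this)
  rw [Nat.pow_dvd_pow_iff_le_right hp.out.one_lt] at this
  omega

lemma Reg.mu_le_nu_add {D : LocalData p} (h : D.Reg) : D.mu ≤ D.nu + D.rho := by
  obtain ⟨r, u, h1, h2, h3, h4, h5⟩ := h.exists_eq
  have := D.tau_pow h.2.1
  obtain ⟨v, hv, h'⟩ := exists_pow_pow_eq h1 h2 h3 h4 D.nu
  rw [h', Nat.add_sub_cancel_left] at this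
  have := (((hp.out.coprime_iff_not_dvd.2 hv).pow_left D.mu).dvd_of_dvd_mul_right this)
  rw [Nat.pow_dvd_pow_iff_le_right hp.out.one_lt] at this
  omega

lemma Reg.rho_pos {D : LocalData p} (h : D.Reg) : 1 ≤ D.rho := by
  obtain ⟨r, u, h1, h2, h3, h4, h5⟩ := h.exists_eq
  have := h.1
  omega

lemma Reg.gam_pos {D : LocalData p} (h : D.Reg) : 1 ≤ D.gam := by
  have := h.rho_pos
  have := D.kap_le
  have := D.rho_or h.1 h.2.1 h.2.2
  rw [← rho] at this
  omega

lemma Reg.gam_le_nu' {D : LocalData p} (h : D.Reg) : D.gam ≤ D.nu :=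
  D.gam_le_nu h.1 h.2.1 h.2.2

lemma Reg.rho_or' {D : LocalData p} (h : D.Reg) : D.rho ≤ D.gam ∨ D.nu < D.gam + D.kap :=
  D.rho_or h.1 h.2.1 h.2.2

lemma rho_le (D : LocalData p) : D.rho ≤ D.mu := min_le_right _ _

lemma Dih.gam_ge {D : LocalData p} (h : D.Dih) : D.mu ≤ D.gam + 1 := by
  obtain ⟨rfl, h1, h2⟩ := h
  have h3 := D.stable
  have h4 : D.tau - 1 = 2 * ((D.tau - 1) / 2) := by omega
  rw [h4, ← mul_assoc, ← pow_succ] at h3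
  have h5 : ¬ 2 ∣ (D.tau - 1) / 2 := by omega
  have := ((Nat.prime_two.coprime_iff_not_dvd.2 h5).pow_left D.mu).dvd_of_dvd_mul_right h3
  rwa [Nat.pow_dvd_pow_iff_le_right (by norm_num)] at this

lemma Dih.nu_pos {D : LocalData p} (h : D.Dih) : 1 ≤ D.nu := by
  obtain ⟨rfl, h1, h2⟩ := h
  by_contra h0
  have h3 := D.tau_pow (by omega)
  rw [show D.nu = 0 by omega, pow_zero, pow_one] at h3
  have : 4 ∣ D.tau - 1 := dvd_trans (show 2 ^ 2 ∣ 2 ^ D.mu from pow_dvd_pow 2 h1) h3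
  omega

/-- The invariants of the counting function of linear characters. -/
lemma exists_exponents (D : LocalData p) {e : ℕ} (he : e = D.mu + D.nu) : ∃ u v, u ≤ v ∧
    (∀ j, 1 ≤ j → (D.lin e (1 + p ^ j)).ncard = p ^ (min u j + min v j)) ∧
    (D.Free → u = 0 ∧ v = D.nu) ∧
    (D.Reg → u = min D.rho D.gam ∧ v = D.rho + D.nu - min D.rho D.gam ∧ 1 ≤ u) ∧
    (D.Dih → u = 1 ∧ v = D.nu) := by
  have h1 := D.one_lt_tau
  rcases D.trichotomy with h | h | h
  · refine ⟨0, D.nu, by omega, fun j hj => ?_, fun _ => ⟨rfl, rfl⟩, fun h' => ?_, fun h' => ?_⟩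
    · rw [lin, ncard_linSet_of_not (h.imp_right fun h => ⟨by omega, h⟩) he]
      simp
    · rcases h with h | h
      · exact absurd h h'.1.ne'
      · exact absurd h'.2.1 h
    · obtain ⟨rfl, h2, h3⟩ := h'
      rcases h with h | h <;> omega
  · obtain ⟨r, u, a1, a2, a3, a4, a5⟩ := h.exists_eq
    have h2 := h.gam_le_nu'
    have h3 := h.gam_pos
    have h4 := h.rho_pos
    refine ⟨min D.rho D.gam, D.rho + D.nu - min D.rho D.gam, by omega, fun j hj => ?_,
      fun h' => ?_, fun _ => ⟨rfl, rfl, by omega⟩, fun h' => ?_⟩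
    · rw [lin, ncard_linSet_of_one a1 a2 a3 a4 he D.gam_le h2, ← a5]
    · rcases h' with h' | h'
      · exact absurd h' h.1.ne'
      · exact absurd h.2.1 h'
    · obtain ⟨rfl, b2, b3⟩ := h'
      have := h.2.2 rfl
      omega
  · have h2 := h.gam_ge
    have h3 := h.nu_pos
    refine ⟨1, D.nu, by omega, fun j hj => ?_, fun h' => ?_, fun h' => ?_, fun _ => ⟨rfl, rfl⟩⟩
    · obtain ⟨rfl, b2, b3⟩ := h
      rw [lin, ncard_linSet_of_three b3 he (by omega) (by omega) hj]
      congr 1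
      omega
    · obtain ⟨rfl, b2, b3⟩ := h
      rcases h' with h | h <;> omega
    · obtain ⟨rfl, b2, b3⟩ := h
      have := h'.2.2 rfl
      omega

/-- If two weighted sums of termwise comparable numbers agree, the terms agree. -/
lemma eq_of_sum_eq {n : ℕ} {W x y : ℕ → ℕ} (hle : ∀ i < n, W i ≠ 0 → x i ≤ y i)
    (h : ∑ i ∈ Finset.range n, W i * x i = ∑ i ∈ Finset.range n, W i * y i) {j : ℕ} (hj : j < n)
    (hW : W j ≠ 0) : x j = y j := by
  have := (Finset.sum_eq_sum_iff_of_le (fun i hi => ?_)).1 h j (Finset.mem_range.2 hj)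
  · exact Nat.eq_of_mul_eq_mul_left (Nat.pos_of_ne_zero hW) this
  · by_cases h0 : W i = 0
    · simp [h0]
    · exact Nat.mul_le_mul_left _ (hle i (Finset.mem_range.1 hi) h0)

lemma natCast_pow_mul_eq_zero {e : ℕ} (z : ZMod (p ^ e)) : (p : ZMod (p ^ e)) ^ e * z = 0 := by
  rw [pow_eq_zero_iff_le.2 le_rfl, zero_mul]

lemma X_subset (D : LocalData p) (e i f j : ℕ) :
    D.X e i f (1 + p ^ j) ⊆ D.X e i f (1 + p ^ e) := by
  rintro ⟨z, w⟩ ⟨h1, h2, h3, h4, h5, h6, h7, h8⟩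
  refine ⟨h1, h2, h3, h4, h5, h6, ?_, 0, ?_⟩
  · exact (cast_one_add_pow_mul_eq _ _).2 (natCast_pow_mul_eq_zero _)
  · rw [mul_zero, pow_zero, one_mul]
    exact (cast_one_add_pow_mul_eq _ _).2 (natCast_pow_mul_eq_zero _)

lemma Reg.X_eq {D : LocalData p} (h : D.Reg) (e i f j : ℕ) :
    D.X e i f (1 + p ^ j) = expSet p e D.mu D.nu D.gam D.rho i f j := by
  obtain ⟨r, u, a1, a2, a3, a4, a5⟩ := h.exists_eq
  rw [a5]
  exact locSet_eq_expSet a1 a2 a3 a4 _ _ _ _ _ _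

/-- Equality of all local counting functions. -/
def Same (D D' : LocalData p) (e : ℕ) : Prop :=
  ∀ d, p.Coprime d → ∀ f t, ¬ p ∣ t →
    ∑ i ∈ Finset.range (f + 1), D.W d i * (D.X e i f t).ncard =
    ∑ i ∈ Finset.range (f + 1), D'.W d i * (D'.X e i f t).ncard

lemma Same.symm {D D' : LocalData p} {e : ℕ} (h : Same D D' e) : Same D' D e :=
  fun d hd f t ht => (h d hd f t ht).symm

lemma not_dvd_one_add_pow {j : ℕ} (hj : 1 ≤ j) : ¬ p ∣ 1 + p ^ j := by
  intro h
  exact hp.out.not_dvd_one ((Nat.dvd_add_left (dvd_pow_self p (by omega))).1 h)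

lemma Same.rigid {D D' : LocalData p} {e : ℕ} (he : 1 ≤ e) (h : Same D D' e) {d : ℕ}
    (hd : p.Coprime d) {f j : ℕ}
    (hj : 1 ≤ j) (hD : ∀ i ≤ f, D.W d i ≠ 0 → D.X e i f (1 + p ^ e) ⊆ D.X e i f (1 + p ^ j))
    {i : ℕ} (hi : i ≤ f) (hW : D'.W d i ≠ 0) :
    D'.X e i f (1 + p ^ e) ⊆ D'.X e i f (1 + p ^ j) := by
  have : NeZero (p ^ e) := ⟨pow_ne_zero _ hp.out.ne_zero⟩
  have h1 := h d hd f _ (not_dvd_one_add_pow hj)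
  have h2 := h d hd f _ (not_dvd_one_add_pow he)
  have h3 : ∑ i ∈ Finset.range (f + 1), D.W d i * (D.X e i f (1 + p ^ j)).ncard =
      ∑ i ∈ Finset.range (f + 1), D.W d i * (D.X e i f (1 + p ^ e)).ncard := by
    refine Finset.sum_congr rfl fun i hi => ?_
    by_cases h0 : D.W d i = 0
    · simp [h0]
    · rw [(D.X_subset e i f j).antisymm (hD i (by simpa [Nat.lt_succ_iff] using hi) h0)]
  have h4 := eq_of_sum_eq (W := D'.W d) (x := fun i => (D'.X e i f (1 + p ^ j)).ncard)
    (y := fun i => (D'.X e i f (1 + p ^ e)).ncard)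
    (fun i _ _ => Set.ncard_le_ncard (D'.X_subset e i f j) (Set.toFinite _))
    (by rw [← h1, h3, h2]) (j := i) (by omega) hW
  exact (Set.eq_of_subset_of_ncard_le (D'.X_subset e i f j) h4.ge (Set.toFinite _)).ge

/-- The fibre over the negation, depending only on `nu`. -/
def negSet (p e ν f : ℕ) : Set (ZMod (p ^ e) × ZMod (p ^ e)) :=
  {q | f ≤ ν ∧ 2 * q.1 = 0 ∧ 2 * q.2 = 0 ∧ (p : ZMod (p ^ e)) ^ (ν - f) * q.2 = 0}

lemma negSet_nonempty {e ν f : ℕ} (h : f ≤ ν) : (negSet p e ν f).Nonempty :=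
  ⟨0, h, by simp, by simp, by simp⟩

lemma pow_mul_eq_zero_of_two {e : ℕ} {z : ZMod (p ^ e)} (hz : 2 * z = 0) {a : ℕ} (ha : 1 ≤ a) :
    (p : ZMod (p ^ e)) ^ a * z = 0 := by
  refine pow_mul_eq_zero_mono ha ?_
  by_cases h2 : p = 2
  · subst h2; rw [pow_one]; exact_mod_cast hz
  · have : ¬ p ∣ 2 := fun h => h2 ((Nat.prime_dvd_prime_iff_eq hp.out Nat.prime_two).1 h)
    have := (isUnit_natCast_of_not_dvd (e := e) this).mul_right_eq_zero.1 (by exact_mod_cast hz)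
    simp [this]

lemma two_mul_eq_zero_of_add {e r : ℕ} (hr : 1 ≤ r) (hr2 : p = 2 → 2 ≤ r) (y : ZMod (p ^ e))
    {z : ZMod (p ^ e)} (hz : (2 + p ^ r * y) * z = 0) : 2 * z = 0 := by
  by_cases h2 : p = 2
  · subst h2
    obtain ⟨c, rfl⟩ := Nat.exists_eq_add_of_le (hr2 rfl)
    have : (1 + ((2 : ℕ) : ZMod (2 ^ e)) * (2 ^ c * y)) * (2 * z) = 0 := by
      push_cast at hz ⊢
      linear_combination hz
    exact (isUnit_one_add_p_mul _).mul_right_eq_zero.1 this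
  · have h3 : ¬ p ∣ 2 := fun h => h2 ((Nat.prime_dvd_prime_iff_eq hp.out Nat.prime_two).1 h)
    obtain ⟨c, rfl⟩ := Nat.exists_eq_add_of_le hr
    have := (isUnit_add_p_mul h3 ((p : ZMod (p ^ e)) ^ c * y)).mul_right_eq_zero.1
      (show (((2 : ℕ) : ZMod (p ^ e)) + p * (p ^ c * y)) * z = 0 by
        push_cast; linear_combination hz)
    simp [this]

lemma Reg.X_neg {D : LocalData p} (h : D.Reg) {e t : ℕ} (ht : (t : ZMod (p ^ e)) = -1)
    (i f : ℕ) : D.X e i f t = if i = f then negSet p e D.nu f else ∅ := by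
  obtain ⟨r, u, a1, a2, a3, a4, a5⟩ := h.exists_eq
  have h3 := h.gam_pos
  have key : ∀ (z : ZMod (p ^ e)) (k : ℕ), (t : ZMod (p ^ e)) * z = (D.tau : ZMod (p ^ e)) ^ k * z →
      2 * z = 0 := by
    intro z k hk
    obtain ⟨y, hy⟩ : ∃ y : ℕ, (1 + p ^ r * u) ^ k = 1 + p ^ r * y := by
      clear hk
      induction k with
      | zero => exact ⟨0, by simp⟩
      | succ k ih =>
        obtain ⟨y, hy⟩ := ih
        exact ⟨y + u + p ^ r * y * u, by rw [pow_succ, hy]; ring⟩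
    rw [a1, ← Nat.cast_pow, hy, ht] at hk
    push_cast at hk
    refine two_mul_eq_zero_of_add a3 a4 y ?_
    linear_combination -hk
  have fix : ∀ (z : ZMod (p ^ e)) (k : ℕ), 2 * z = 0 → (D.tau : ZMod (p ^ e)) ^ (p ^ k) * z = z :=
    fun z k hz => (pow_pow_mul_eq_self_iff a1 a2 a3 a4 k z).2
      (pow_mul_eq_zero_of_two hz (by omega))
  ext ⟨z, w⟩
  split_ifs with hif
  · subst hif
    simp only [X, locSet, negSet, Set.mem_ofPred_eq]
    constructor
    · rintro ⟨h1, h2, h3', h4, h5, h6, h7, k, h8⟩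
      have hz := key _ _ h8
      rw [pow_mul_eq_zero_of_two hz h3] at h6
      exact ⟨h1, hz, by rw [ht] at h7; linear_combination -h7, h6⟩
    · rintro ⟨h1, h2, h3', h4⟩
      refine ⟨h1, le_rfl, pow_mul_eq_zero_of_two h2 h.1, fix _ _ h2, Or.inl trivial, ?_, ?_, 0, ?_⟩
      · rw [h4, pow_mul_eq_zero_of_two h2 h3]
      · rw [ht]; linear_combination -h3'
      · rw [ht]; simp; linear_combination -h2
  · simp only [X, locSet, Set.mem_ofPred_eq, Set.mem_empty_iff_false, iff_false]
    rintro ⟨h1, h2, h3', h4, h5, h6, h7, k, h8⟩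
    exact (h5.resolve_left hif) (fix _ _ (key _ _ h8))

lemma exists_neg_one {e : ℕ} (he : 1 ≤ e) : ∃ t : ℕ, ¬ p ∣ t ∧ (t : ZMod (p ^ e)) = -1 := by
  have h1 : 1 ≤ p ^ e := Nat.one_le_pow _ _ hp.out.pos
  refine ⟨p ^ e - 1, fun h => ?_, ?_⟩
  · have h2 : p ∣ p ^ e := dvd_pow_self p (by omega)
    have := (Nat.dvd_sub h2 h)
    rw [Nat.sub_sub_self h1] at this
    exact hp.out.not_dvd_one this
  · rw [Nat.cast_sub h1]; simp

lemma Same.W_mul_eq {D D' : LocalData p} {e : ℕ} (he : 1 ≤ e) (h : Same D D' e)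
    (hD : D.Reg) (hD' : D'.Reg) {d : ℕ} (hd : p.Coprime d) (f : ℕ) :
    D.W d f * (negSet p e D.nu f).ncard = D'.W d f * (negSet p e D'.nu f).ncard := by
  obtain ⟨t, ht, ht'⟩ := exists_neg_one (p := p) he
  have := h d hd f t ht
  simp only [hD.X_neg ht', hD'.X_neg ht'] at this
  simpa [Finset.sum_range_succ, apply_ite Set.ncard, Finset.sum_ite_eq] using this

lemma Same.W_ne {D D' : LocalData p} {e : ℕ} (he : 1 ≤ e) (h : Same D D' e)
    (hD : D.Reg) (hD' : D'.Reg) {d : ℕ} (hd : p.Coprime d) {f : ℕ} (hf : D.W d f ≠ 0) :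
    D'.W d f ≠ 0 := by
  have : NeZero (p ^ e) := ⟨pow_ne_zero _ hp.out.ne_zero⟩
  intro h0
  have h1 := h.W_mul_eq he hD hD' hd f
  rw [h0, zero_mul, mul_eq_zero] at h1
  refine h1.elim hf fun h2 => ?_
  rw [Set.ncard_eq_zero (Set.toFinite _)] at h2
  exact (negSet_nonempty ((D.W_le _ _ hf).trans D.kap_le)).ne_empty h2

lemma Same.kap_eq {D D' : LocalData p} {e : ℕ} (he : 1 ≤ e) (h : Same D D' e)
    (hD : D.Reg) (hD' : D'.Reg) : D.kap = D'.kap := by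
  apply le_antisymm
  · obtain ⟨d, hd, hW⟩ := D.W_kap
    exact D'.W_le _ _ (h.W_ne he hD hD' hd hW.ne')
  · obtain ⟨d, hd, hW⟩ := D'.W_kap
    exact D.W_le _ _ (h.symm.W_ne he hD' hD hd hW.ne')

lemma Same.W_eq {D D' : LocalData p} {e : ℕ} (he : 1 ≤ e) (h : Same D D' e)
    (hD : D.Reg) (hD' : D'.Reg) (hnu : D.nu = D'.nu) {d : ℕ} (hd : p.Coprime d) (f : ℕ) :
    D.W d f = D'.W d f := by
  have : NeZero (p ^ e) := ⟨pow_ne_zero _ hp.out.ne_zero⟩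
  by_cases h0 : D.W d f = 0
  · by_contra h1
    exact h.symm.W_ne he hD' hD hd (fun h2 => h1 (by rw [h0, h2])) h0
  · have h1 := h.W_mul_eq he hD hD' hd f
    rw [← hnu] at h1
    refine Nat.eq_of_mul_eq_mul_right ?_ h1
    rw [Set.ncard_pos (Set.toFinite _)]
    exact negSet_nonempty ((D.W_le _ _ h0).trans D.kap_le)

end LocalData

namespace LocalData

variable {p : ℕ} [hp : Fact p.Prime]

/-- Increasing `γ` only enlarges the explicit solution set, fibrewise. -/
lemma exists_injOn_expSet {e μ ν γ γ' ρ i f j : ℕ} (hγ : γ ≤ γ') :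
    ∃ F : ZMod (p ^ e) × ZMod (p ^ e) → ZMod (p ^ e) × ZMod (p ^ e),
      Set.MapsTo F (expSet p e μ ν γ ρ i f j) (expSet p e μ ν γ' ρ i f j) ∧
      Function.Injective F ∧ ∀ q, (F q).1 = q.1 := by
  obtain ⟨c, rfl⟩ := Nat.exists_eq_add_of_le hγ
  have hch : ∀ z : ZMod (p ^ e), ∃ y : ZMod (p ^ e),
      (∃ w, (z, w) ∈ expSet p e μ ν γ ρ i f j) → (z, y) ∈ expSet p e μ ν γ ρ i f j := by
    intro z
    by_cases h : ∃ w, (z, w) ∈ expSet p e μ ν γ ρ i f j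
    · exact ⟨h.choose, fun _ => h.choose_spec⟩
    · exact ⟨0, fun h' => absurd h' h⟩
  choose y hy using hch
  refine ⟨fun q => (q.1, q.2 + (p ^ c - 1) * y q.1), ?_, ?_, fun _ => rfl⟩
  · rintro ⟨z, w⟩ h
    have h' := hy z ⟨w, h⟩
    obtain ⟨h1, h2, h3, h4, h5, h6, h7, h8⟩ := h
    obtain ⟨-, -, -, -, -, k6, k7, -⟩ := h'
    refine ⟨h1, h2, h3, h4, h5, ?_, ?_, h8⟩
    · simp only at h6 k6 ⊢
      linear_combination h6 + (p ^ c - 1) * k6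
    · simp only at h7 k7 ⊢
      linear_combination h7 + (p ^ c - 1) * k7
  · rintro ⟨z, w⟩ ⟨z', w'⟩ h
    simp only [Prod.mk.injEq] at h
    obtain ⟨rfl, h⟩ := h
    rw [add_left_inj] at h
    rw [h]

lemma ncard_expSet_le {e μ ν γ γ' ρ i f j : ℕ} (hγ : γ ≤ γ') :
    (expSet p e μ ν γ ρ i f j).ncard ≤ (expSet p e μ ν γ' ρ i f j).ncard := by
  have : NeZero (p ^ e) := ⟨pow_ne_zero _ hp.out.ne_zero⟩
  obtain ⟨F, h1, h2, h3⟩ := exists_injOn_expSet (p := p) (e := e) (μ := μ) (ν := ν) (ρ := ρ)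
    (i := i) (f := f) (j := j) hγ
  exact Set.ncard_le_ncard_of_injOn F h1 h2.injOn (Set.toFinite _)

lemma ncard_expSet_lt {e μ ν γ γ' ρ i f j : ℕ} (hγ : γ ≤ γ') {q : ZMod (p ^ e) × ZMod (p ^ e)}
    (hq : q ∈ expSet p e μ ν γ' ρ i f j) (hq' : ∀ w, (q.1, w) ∉ expSet p e μ ν γ ρ i f j) :
    (expSet p e μ ν γ ρ i f j).ncard < (expSet p e μ ν γ' ρ i f j).ncard := by
  have : NeZero (p ^ e) := ⟨pow_ne_zero _ hp.out.ne_zero⟩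
  obtain ⟨F, h1, h2, h3⟩ := exists_injOn_expSet (p := p) (e := e) (μ := μ) (ν := ν) (ρ := ρ)
    (i := i) (f := f) (j := j) hγ
  rw [← Set.ncard_image_of_injective _ h2]
  refine Set.ncard_lt_ncard ⟨h1.image_subset, fun h => ?_⟩ (Set.toFinite _)
  obtain ⟨⟨z, w⟩, hx, hxq⟩ := h hq
  have := h3 (z, w)
  rw [hxq] at this
  exact hq' w (by rw [this]; exact hx)

lemma gam_not_lt_of_reg {D D' : LocalData p} {e : ℕ} (h : Same D D' e) (hD : D.Reg) (hD' : D'.Reg)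
    (he : e = D.mu + D.nu) (hmu : D.mu = D'.mu) (hnu : D.nu = D'.nu) (hrho : D.rho = D'.rho) : ¬ D.gam < D'.gam := by
  intro hlt
  have : NeZero (p ^ e) := ⟨pow_ne_zero _ hp.out.ne_zero⟩
  have b1 := hD.1
  have b2 := hD'.gam_le_nu'
  have b3 := D'.gam_le
  have b4 := hD.mu_le_nu_add
  have b5 := hD.rho_pos
  have b6 := D.rho_le
  set f := D.mu - D.rho with hf
  set j := D.nu + D.rho - D'.gam with hj
  have key := h 1 (Nat.coprime_one_right p) f _ (not_dvd_one_add_pow (j := j) (by omega))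
  simp only [hD.X_eq, hD'.X_eq, ← hmu, ← hnu, ← hrho] at key
  have key2 := eq_of_sum_eq (W := D.W 1)
    (x := fun i => (expSet p e D.mu D.nu D.gam D.rho i f j).ncard)
    (y := fun i => (expSet p e D.mu D.nu D'.gam D.rho i f j).ncard)
    (fun i _ _ => ncard_expSet_le hlt.le)
    (by rw [key]; exact Finset.sum_congr rfl fun i _ => by
          rw [h.W_eq (by omega) hD hD' hnu (Nat.coprime_one_right p)])
    (j := 0) (by omega) D.W_zero.ne'
  refine absurd key2 (ncard_expSet_lt hlt.le
    (q := ((p : ZMod (p ^ e)) ^ D.nu, (p : ZMod (p ^ e)) ^ (D'.gam + f))) ?_ ?_).ne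
  · refine ⟨by omega, by omega, ?_, ?_, ?_, ?_, ?_, ?_⟩ <;> simp only [← pow_add]
    · rw [pow_eq_zero_iff_le]; omega
    · rw [pow_eq_zero_iff_le]; omega
    · right; rw [ne_eq, pow_eq_zero_iff_le]; omega
    · congr 1; omega
    · rw [pow_eq_zero_iff_le]; omega
    · right; omega
  · rintro w ⟨-, -, -, -, -, h6, h7, -⟩
    simp only at h6 h7
    have h8 : (p : ZMod (p ^ e)) ^ (j - (D.nu - f)) * (p ^ D.gam * p ^ D.nu) = 0 := by
      rw [← h6, ← mul_assoc, ← pow_add, Nat.sub_add_cancel (by omega), h7]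
    rw [← pow_add, ← pow_add, pow_eq_zero_iff_le] at h8
    omega

lemma gam_not_mixed_of_reg {D D' : LocalData p} {e : ℕ} (h : Same D D' e) (hD : D.Reg)
    (hD' : D'.Reg) (he : e = D.mu + D.nu) (he' : e = D'.mu + D'.nu)
    (hg : D.rho < D.gam) (hg' : D'.gam < D'.rho) (hu : D'.gam = D.rho)
    (hv : D'.nu + D'.rho = D.nu + D.rho) : False := by
  have : NeZero (p ^ e) := ⟨pow_ne_zero _ hp.out.ne_zero⟩
  have b1 := hD.1
  have b2 := hD.gam_le_nu'
  have b3 := D.gam_le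
  have b4 := hD.mu_le_nu_add
  have b5 := hD.rho_pos
  have b6 := D.rho_le
  have c2 := hD'.gam_le_nu'
  have c4 := hD'.mu_le_nu_add
  have c5 := hD'.rho_pos
  have c6 := D'.rho_le
  have c7 := hD'.rho_or'
  have c8 := D'.kap_le
  have kap := h.kap_eq (by omega) hD hD'
  set f := max D.kap (D.mu - D.rho) with hf
  set j := min D'.mu (D'.rho + D.kap) - 1 with hj
  have f1 : D.kap ≤ f := le_max_left _ _
  have f2 : D.mu - D.rho ≤ f := le_max_right _ _
  have f3 : f = D.kap ∨ f = D.mu - D.rho := max_choice _ _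
  have f4 : f ≤ D'.nu := by omega
  clear_value f
  obtain ⟨d, hd, hW⟩ := D'.W_kap
  have key := h.rigid (by omega) hd (f := f) (j := j) (by omega) (fun i hi hWi => ?_)
    (i := D'.kap) (by omega) hW.ne'
  · have := key (a := ((p : ZMod (p ^ e)) ^ D'.nu, (p : ZMod (p ^ e)) ^ (D'.gam + f))) (by
      rw [hD'.X_eq]
      refine ⟨by omega, by omega, ?_, ?_, ?_, ?_, ?_, ?_⟩ <;> simp only [← pow_add]
      · rw [pow_eq_zero_iff_le]; omega
      · rw [pow_eq_zero_iff_le]; omega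
      · rw [ne_eq, pow_eq_zero_iff_le]; omega
      · congr 1; omega
      · rw [pow_eq_zero_iff_le]; omega
      · left; rw [pow_eq_zero_iff_le]; omega)
    rw [hD'.X_eq] at this
    obtain ⟨-, -, -, -, -, -, -, h8⟩ := this
    simp only [← pow_add] at h8
    rw [pow_eq_zero_iff_le] at h8
    omega
  · have hik := D.W_le _ _ hWi
    rw [hD.X_eq, hD.X_eq]
    rintro ⟨z, w⟩ ⟨h1, h2, h3, h4, h5, h6, -, -⟩
    refine ⟨h1, h2, h3, h4, h5, h6, ?_, ?_⟩
    · simp only at h6 h3 ⊢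
      have h7 : (p : ZMod (p ^ e)) ^ ((D.mu - D.gam) + (D.nu - f)) * w = 0 := by
        rw [pow_add, mul_assoc, h6, ← mul_assoc, ← pow_add]
        exact pow_mul_eq_zero_mono (by omega) h3
      exact pow_mul_eq_zero_mono (by omega) h7
    · by_cases hx : D.rho + i ≤ j
      · exact Or.inr hx
      · left
        exact pow_mul_eq_zero_mono (by omega) h3

lemma gam_eq_of_reg {D D' : LocalData p} {e : ℕ} (h : Same D D' e) (hD : D.Reg)
    (hD' : D'.Reg) (he : e = D.mu + D.nu) (he' : e = D'.mu + D'.nu)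
    (hu : min D.rho D.gam = min D'.rho D'.gam)
    (hv : D.rho + D.nu - min D.rho D.gam = D'.rho + D'.nu - min D'.rho D'.gam) :
    D.gam = D'.gam := by
  have b2 := hD.gam_le_nu'
  have c2 := hD'.gam_le_nu'
  have m1 := gam_not_mixed_of_reg h hD hD' he he'
  have m2 := gam_not_mixed_of_reg h.symm hD' hD he' he
  rcases lt_or_ge D.gam D.rho with h1 | h1 <;> rcases lt_or_ge D'.gam D'.rho with h2 | h2
  · omega
  · rcases h2.lt_or_eq with h3 | h3
    · exact (m2 h3 h1 (by omega) (by omega)).elim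
    · omega
  · rcases h1.lt_or_eq with h3 | h3
    · exact (m1 h3 h2 (by omega) (by omega)).elim
    · omega
  · have := gam_not_lt_of_reg h hD hD' he (by omega) (by omega) (by omega)
    have := gam_not_lt_of_reg h.symm hD' hD he' (by omega) (by omega) (by omega)
    omega

lemma gam_eq_of_reg_dih {D D' : LocalData p} {e : ℕ} (h : Same D D' e) (hD : D.Reg)
    (hD' : D'.Dih) (he : e = D.mu + D.nu) (he' : e = D'.mu + D'.nu)
    (hu : min D.rho D.gam = 1) (hv : D.rho + D.nu - min D.rho D.gam = D'.nu) :
    D.gam = D'.gam := by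
  obtain ⟨rfl, d1, d2⟩ := id hD'
  have b1 := hD.1
  have b2 := hD.gam_le_nu'
  have b3 := D.gam_le
  have b4 := hD.mu_le_gam_add
  have b5 := hD.rho_pos
  have b6 := D.rho_le
  have b7 := hD.rho_or'
  have b8 := D.kap_le
  have b9 : 2 ≤ D.rho ∨ D.rho = D.mu := by
    obtain ⟨r, u, -, -, -, a4, a5⟩ := hD.exists_eq
    have := a4 rfl
    omega
  have c1 := hD'.gam_ge
  have c2 := hD'.nu_pos
  have c3 := D'.gam_le
  by_contra hne
  have hg' : D'.gam = 2 := by omega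
  obtain ⟨d, hd, hW⟩ := D.W_kap
  have key := h.symm.rigid (by omega) hd (f := D.nu) (j := D.rho) (by omega) (fun i hi hWi => ?_)
    (i := D.kap) (by omega) hW.ne'
  · have := key (a := (((2 : ℕ) : ZMod (2 ^ e)) ^ D.nu,
        ((2 : ℕ) : ZMod (2 ^ e)) ^ (D.gam + D.nu))) (by
      rw [hD.X_eq]
      refine ⟨by omega, by omega, ?_, ?_, ?_, ?_, ?_, ?_⟩ <;> simp only [← pow_add]
      · rw [pow_eq_zero_iff_le]; omega
      · rw [pow_eq_zero_iff_le]; omega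
      · left; omega
      · congr 1; omega
      · rw [pow_eq_zero_iff_le]; omega
      · left; rw [pow_eq_zero_iff_le]; omega)
    rw [hD.X_eq] at this
    obtain ⟨-, -, -, -, -, -, -, h8⟩ := this
    simp only [← pow_add] at h8
    rw [pow_eq_zero_iff_le] at h8
    omega
  · rintro ⟨z, w⟩ ⟨h1, h2, h3, h4, h5, h6, -, -⟩
    simp only at h3 h6
    refine ⟨h1, h2, h3, h4, h5, h6, (cast_one_add_pow_mul_eq _ _).2 ?_, 0, ?_⟩
    · simp only
      have h7 : ((2 : ℕ) : ZMod (2 ^ e)) ^ (D'.nu - D.nu) * w = 0 := by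
        rw [h6]
        exact pow_mul_eq_zero_mono (by omega) h3
      exact pow_mul_eq_zero_mono (by omega) h7
    · rw [mul_zero, pow_zero, one_mul]
      exact (cast_one_add_pow_mul_eq _ _).2 (pow_mul_eq_zero_mono (by omega) h3)

end LocalData

lemma sum_ncard_eq {α : Type*} [Finite α] (S : ℕ → Set α)
    (hS : ∀ i j, i < j → ∀ x ∈ S i, x ∉ S j) (n : ℕ) :
    ∑ f ∈ Finset.range n, (S f).ncard = {x | ∃ f < n, x ∈ S f}.ncard := by
  induction n with
  | zero => simp
  | succ n ih =>
    rw [Finset.sum_range_succ, ih, ← Set.ncard_union_eq _ (Set.toFinite _) (Set.toFinite _)]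
    · congr 1
      ext x
      simp only [Set.mem_union, Set.mem_ofPred_eq, Nat.lt_succ_iff_lt_or_eq]
      constructor
      · rintro (⟨f, hf, hx⟩ | hx)
        · exact ⟨f, Or.inl hf, hx⟩
        · exact ⟨n, Or.inr rfl, hx⟩
      · rintro ⟨f, hf | rfl, hx⟩
        · exact Or.inl ⟨f, hf, hx⟩
        · exact Or.inr hx
    · rw [Set.disjoint_left]
      rintro x ⟨f, hf, hx⟩
      exact hS f n hf x hx

namespace LocalData

lemma two_dvd_odd_pow {τ : ℕ} (h : τ % 4 = 3) (k : ℕ) : ∃ c, τ ^ (2 * k) = 1 + 8 * c := by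
  have h2 : ∃ c, τ ^ 2 = 1 + 8 * c := by
    obtain ⟨a, rfl⟩ : ∃ a, τ = 4 * a + 3 := ⟨τ / 4, by omega⟩
    exact ⟨2 * a * a + 3 * a + 1, by ring⟩
  obtain ⟨c, hc⟩ := h2
  induction k with
  | zero => exact ⟨0, by simp⟩
  | succ k ih =>
    obtain ⟨d, hd⟩ := ih
    exact ⟨d + c + 8 * d * c, by rw [mul_add, pow_add, hd, mul_one, hc]; ring⟩

variable {e : ℕ}

lemma two_mul_eq_zero_iff_of_three {t : ℕ} (h : t % 4 = 3) {z : ZMod (2 ^ e)} :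
    (t : ZMod (2 ^ e)) * z = z ↔ 2 * z = 0 := by
  rw [← two_mul_eq_zero_of_three (x := t - 1) (by omega), Nat.cast_sub (by omega), sub_mul,
    Nat.cast_one, one_mul, sub_eq_zero]

lemma two_pow_mul_eq_zero {z : ZMod (2 ^ e)} (hz : 2 * z = 0) {a : ℕ} (ha : 1 ≤ a) :
    ((2 : ℕ) : ZMod (2 ^ e)) ^ a * z = 0 :=
  pow_mul_eq_zero_of_two hz ha

lemma pow_mul_eq_of_two_mul {τ : ℕ} (h : τ % 4 = 3) {z : ZMod (2 ^ e)} (hz : 2 * z = 0) (k : ℕ) :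
    (τ : ZMod (2 ^ e)) ^ k * z = z := by
  induction k with
  | zero => simp
  | succ k ih => rw [pow_succ, mul_assoc, (two_mul_eq_zero_iff_of_three h).2 hz, ih]

lemma two_mul_eq_zero_of_even {t τ : ℕ} (ht : t % 4 = 3) (hτ : τ % 4 = 3) {k : ℕ}
    {z : ZMod (2 ^ e)} (h : (t : ZMod (2 ^ e)) * z = (τ : ZMod (2 ^ e)) ^ (2 * k) * z) :
    2 * z = 0 := by
  obtain ⟨c, hc⟩ := two_dvd_odd_pow hτ k
  rw [← Nat.cast_pow, hc] at h
  obtain ⟨a, rfl⟩ : ∃ a, t = 4 * a + 3 := ⟨t / 4, by omega⟩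
  have : (1 + ((2 : ℕ) : ZMod (2 ^ e)) * (a - 2 * c)) * (2 * z) = 0 := by
    push_cast at h ⊢
    linear_combination h
  exact (isUnit_one_add_p_mul _).mul_right_eq_zero.1 this

lemma Dih.X_neg {D : LocalData 2} (h : D.Dih) {t : ℕ} (ht : t % 4 = 3)
    {i f : ℕ} (hi : 1 ≤ i) : D.X e i f t = if i = f then negSet 2 e D.nu f else ∅ := by
  obtain ⟨-, h1, h2⟩ := id h
  have h3 := h.gam_ge
  obtain ⟨i', rfl⟩ := Nat.exists_eq_add_of_le hi
  ext ⟨z, w⟩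
  split_ifs with hif
  · simp only [X, locSet, negSet, Set.mem_ofPred_eq]
    constructor
    · rintro ⟨k1, k2, k3, k4, k5, k6, k7, k, k8⟩
      rw [pow_add, pow_one, mul_assoc] at k8
      have hz := two_mul_eq_zero_of_even ht h2 k8
      rw [two_pow_mul_eq_zero hz (by omega)] at k6
      exact ⟨k1, hz, (two_mul_eq_zero_iff_of_three ht).1 k7, k6⟩
    · rintro ⟨k1, k2, k3, k4⟩
      refine ⟨k1, by omega, two_pow_mul_eq_zero k2 (by omega), pow_mul_eq_of_two_mul h2 k2 _,
        Or.inl hif, ?_, (two_mul_eq_zero_iff_of_three ht).2 k3, 0, ?_⟩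
      · rw [k4, two_pow_mul_eq_zero k2 (by omega)]
      · rw [(two_mul_eq_zero_iff_of_three ht).2 k2]; simp
  · simp only [X, locSet, Set.mem_ofPred_eq, Set.mem_empty_iff_false, iff_false]
    rintro ⟨k1, k2, k3, k4, k5, k6, k7, k, k8⟩
    rw [pow_add, pow_one, mul_assoc] at k8
    exact (k5.resolve_left hif)
      (pow_mul_eq_of_two_mul h2 (two_mul_eq_zero_of_even ht h2 k8) _)

lemma X_zero_eq_lin {p : ℕ} [hp : Fact p.Prime] (D : LocalData p) (e : ℕ) :
    D.X e 0 0 (1 + p ^ e) = D.lin e (1 + p ^ e) := by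
  ext ⟨z, w⟩
  simp only [X, lin, locSet, linSet, Set.mem_ofPred_eq, cast_one_add_pow_mul_eq,
    natCast_pow_mul_eq_zero, pow_zero, pow_one, Nat.sub_zero, Nat.zero_le, true_and, true_or,
    and_true]
  refine and_congr_right fun _ => and_congr_right fun _ => and_iff_left ⟨0, ?_⟩
  rw [mul_zero, pow_zero, one_mul]
  exact (cast_one_add_pow_mul_eq _ _).2 (natCast_pow_mul_eq_zero _)

lemma W_zero_eq_of_dih {D D' : LocalData 2} (h : Same D D' e) (hD : D.Dih) (hD' : D'.Dih)
    (he : e = D.mu + D.nu) (he' : e = D'.mu + D'.nu) (hnu : D.nu = D'.nu) :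
    D.W 1 0 = D'.W 1 0 := by
  obtain ⟨u, v, -, h1, -, -, h2⟩ := D.exists_exponents he
  obtain ⟨u', v', -, h1', -, -, h2'⟩ := D'.exists_exponents he'
  obtain ⟨rfl, rfl⟩ := h2 hD
  obtain ⟨rfl, rfl⟩ := h2' hD'
  have h4 := hD.nu_pos
  have h3 := h 1 (Nat.coprime_one_right 2) 0 (1 + 2 ^ e) (not_dvd_one_add_pow (by omega))
  simp only [zero_add, Finset.sum_range_one, X_zero_eq_lin] at h3
  rw [h1 e (by omega), h1' e (by omega), hnu] at h3
  exact Nat.eq_of_mul_eq_mul_right (by positivity) h3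

/-- All the solutions over the trivial part. -/
def U (D : LocalData 2) (e t : ℕ) : Set (ZMod (2 ^ e) × ZMod (2 ^ e)) :=
  {q | ∃ f < D.nu + 1, q ∈ D.X e 0 f t}

lemma mem_U {D : LocalData 2} {t F : ℕ} {z w : ZMod (2 ^ e)} (hF : F ≤ D.nu)
    (hz : ((2 : ℕ) : ZMod (2 ^ e)) ^ D.mu * z = 0)
    (hzF : (D.tau : ZMod (2 ^ e)) ^ (2 ^ F) * z = z)
    (hw : ∀ f ≤ F, ((2 : ℕ) : ZMod (2 ^ e)) ^ (D.nu - f) * w = ((2 : ℕ) : ZMod (2 ^ e)) ^ D.gam * z)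
    (htw : (t : ZMod (2 ^ e)) * w = w)
    (hk : ∃ k : ℕ, (t : ZMod (2 ^ e)) * z = (D.tau : ZMod (2 ^ e)) ^ k * z) : (z, w) ∈ D.U e t := by
  have hex : ∃ f, (D.tau : ZMod (2 ^ e)) ^ (2 ^ f) * z = z := ⟨F, hzF⟩
  have h1 := Nat.find_spec hex
  have h2 : Nat.find hex ≤ F := Nat.find_min' hex hzF
  refine ⟨Nat.find hex, by omega, by omega, Nat.zero_le _, hz, h1, ?_, hw _ h2, htw, ?_⟩
  · by_cases h0 : 0 = Nat.find hex
    · exact Or.inl h0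
    · exact Or.inr (Nat.find_min hex (by omega))
  · simpa using hk

lemma sum_X_eq (D : LocalData 2) (t : ℕ) :
    ∑ f ∈ Finset.range (D.nu + 1), (D.X e 0 f t).ncard = (D.U e t).ncard := by
  have : NeZero (2 ^ e) := ⟨by positivity⟩
  rw [sum_ncard_eq, U]
  rintro f f' hf ⟨z, w⟩ ⟨-, -, -, h4, -⟩ ⟨-, -, -, -, h5, -⟩
  refine (h5.resolve_left (by omega)) ?_
  simp only at h4 ⊢
  obtain ⟨c, hc⟩ := Nat.exists_eq_add_of_le (show f ≤ f' - 1 by omega)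
  rw [hc, pow_add, pow_mul]
  generalize 2 ^ c = n
  induction n with
  | zero => simp
  | succ n ih => rw [pow_succ, mul_assoc, h4, ih]

lemma Dih.pow_mul_eq {D : LocalData 2} (h : D.Dih) {a f : ℕ} {z : ZMod (2 ^ e)}
    (ha : a ≤ padicValNat 2 (D.tau + 1) + f) (hf : 1 ≤ f)
    (hz : ((2 : ℕ) : ZMod (2 ^ e)) ^ a * z = 0) :
    (D.tau : ZMod (2 ^ e)) ^ (2 ^ f) * z = z := by
  obtain ⟨-, h1, h2⟩ := h
  suffices h3 : ∃ c, D.tau ^ (2 ^ f) = 1 + 2 ^ a * c by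
    obtain ⟨c, hc⟩ := h3
    rw [← Nat.cast_pow, hc]
    push_cast at hz ⊢
    linear_combination (c : ZMod (2 ^ e)) * hz
  suffices h3 : ∃ c, D.tau ^ (2 ^ f) = 1 + 2 ^ (padicValNat 2 (D.tau + 1) + f) * c by
    obtain ⟨c, hc⟩ := h3
    obtain ⟨b, hb⟩ := Nat.exists_eq_add_of_le ha
    exact ⟨2 ^ b * c, by rw [hc, hb]; ring⟩
  clear hz ha
  induction f, hf using Nat.le_induction with
  | base =>
    obtain ⟨u, hu⟩ := (pow_padicValNat_dvd : 2 ^ padicValNat 2 (D.tau + 1) ∣ D.tau + 1)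
    set r := padicValNat 2 (D.tau + 1)
    obtain ⟨b, hb⟩ : ∃ b, D.tau = 1 + 2 * b := ⟨(D.tau - 1) / 2, by omega⟩
    refine ⟨u * b, ?_⟩
    have : D.tau ^ 2 + D.tau = 1 + D.tau + (D.tau + 1) * (2 * b) := by
      rw [hb]; ring
    have h5 : D.tau ^ 2 = 1 + (D.tau + 1) * (2 * b) := by omega
    rw [pow_one, h5, hu]; ring
  | succ f hf ih =>
    obtain ⟨c, hc⟩ := ih
    obtain ⟨q, hq⟩ := Nat.exists_eq_add_of_le (show 1 ≤ padicValNat 2 (D.tau + 1) + f by omega)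
    refine ⟨c + 2 ^ q * c * c, ?_⟩
    rw [pow_succ 2 f, pow_mul, hc, ← add_assoc, hq]; ring

lemma Dih.not_big {D D' : LocalData 2} (h : Same D D' e) (hD : D.Dih)
    (hD' : D'.Dih) (he : e = D.mu + D.nu) (hmu : D.mu = D'.mu) (hnu : D.nu = D'.nu)
    (hg : D.gam = D.mu) (hg' : D'.gam + 1 = D.mu) (hn2 : 2 ≤ D.nu) (hm3 : 3 ≤ D.mu) : False := by
  have : NeZero (2 ^ e) := ⟨by positivity⟩
  have hW := W_zero_eq_of_dih h hD hD' he (by omega) hnu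
  have hW0 := D.W_zero
  obtain ⟨-, d1, d2⟩ := id hD
  obtain ⟨-, d1', d2'⟩ := id hD'
  have d3 := D.mu_lt rfl (by omega) hg
  have tt : (D.tau + 4) % 4 = 3 := by omega
  -- the difference of the counts at `τ` and `τ + 4`
  have key : ∀ f, (D.X e 0 f D.tau).ncard + (D'.X e 0 f (D.tau + 4)).ncard =
      (D.X e 0 f (D.tau + 4)).ncard + (D'.X e 0 f D.tau).ncard := by
    intro f
    have k1 := h 1 (Nat.coprime_one_right 2) f D.tau (by omega)
    have k2 := h 1 (Nat.coprime_one_right 2) f (D.tau + 4) (by omega)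
    simp only [Finset.sum_range_succ' _ f, hD.X_neg (e := e) d2 (Nat.succ_pos _),
      hD.X_neg (e := e) tt (Nat.succ_pos _), hD'.X_neg (e := e) d2 (Nat.succ_pos _),
      hD'.X_neg (e := e) tt (Nat.succ_pos _), ← hW] at k1 k2
    apply Nat.eq_of_mul_eq_mul_left hW0
    rw [mul_add, mul_add]
    omega
  have key2 : (D.U e D.tau).ncard + (D'.U e (D.tau + 4)).ncard =
      (D.U e (D.tau + 4)).ncard + (D'.U e D.tau).ncard := by
    simp only [← sum_X_eq, ← hnu, ← Finset.sum_add_distrib, key]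
  have a1 : 2 ^ (D.mu + 1) ≤ (D.U e D.tau).ncard := by
    rw [← ncard_prod_pow (p := 2) (e := e) (by omega) (by omega)]
    refine Set.ncard_le_ncard ?_ (Set.toFinite _)
    rintro ⟨z, w⟩ ⟨hz, hw⟩
    simp only at hz hw
    refine mem_U (F := D.nu - 1) (by omega) hz
      (hD.pow_mul_eq (a := D.mu) (by omega) (by omega) hz) ?_ ?_ ⟨1, by simp⟩
    · intro f hf
      rw [hg, hz, pow_mul_eq_zero_mono (by omega) hw]
    · rw [two_mul_eq_zero_iff_of_three d2]
      simpa using hw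
  have a2 : (D.U e (D.tau + 4)).ncard ≤ 2 ^ (2 + 1) := by
    rw [← ncard_prod_pow (p := 2) (e := e) (by omega) (by omega)]
    refine Set.ncard_le_ncard ?_ (Set.toFinite _)
    rintro ⟨z, w⟩ ⟨f, hf, -, -, -, -, -, -, h7, k, h8⟩
    simp only [pow_zero, one_mul] at h7 h8
    refine ⟨?_, by simpa using (two_mul_eq_zero_iff_of_three tt).1 h7⟩
    simp only
    rcases Nat.even_or_odd' k with ⟨l, rfl | rfl⟩
    · exact pow_mul_eq_zero_of_two (two_mul_eq_zero_of_even tt d2 h8) (by omega)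
    · obtain ⟨c, hc⟩ := two_dvd_odd_pow d2 l
      rw [pow_succ, ← Nat.cast_pow, hc] at h8
      have : (1 + ((2 : ℕ) : ZMod (2 ^ e)) * (-(c * D.tau))) *
          (((2 : ℕ) : ZMod (2 ^ e)) ^ 2 * z) = 0 := by
        push_cast at h8 ⊢
        linear_combination h8
      exact (isUnit_one_add_p_mul _).mul_right_eq_zero.1 this
  have a3 : 2 ^ (2 + 1) ≤ (D'.U e (D.tau + 4)).ncard := by
    rw [← ncard_prod_pow (p := 2) (e := e) (by omega) (by omega)]
    refine Set.ncard_le_ncard ?_ (Set.toFinite _)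
    rintro ⟨z, w⟩ ⟨hz, hw⟩
    simp only at hz hw
    refine mem_U (F := 1) (by omega) (pow_mul_eq_zero_mono (by omega) hz)
      (hD'.pow_mul_eq (a := 2) ?_ le_rfl hz) ?_ ?_ ⟨1, ?_⟩
    · have : D'.tau + 1 ≠ 0 := by omega
      have := (padicValNat_dvd_iff_le (p := 2) this (n := 1)).1 (by omega)
      omega
    · intro f hf
      rw [pow_mul_eq_zero_mono (by omega) hz, pow_mul_eq_zero_mono (by omega) hw]
    · rw [two_mul_eq_zero_iff_of_three tt]
      simpa using hw
    · obtain ⟨a, ha⟩ : ∃ a, D.tau = 4 * a + 3 := ⟨D.tau / 4, by omega⟩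
      obtain ⟨b, hb⟩ : ∃ b, D'.tau = 4 * b + 3 := ⟨D'.tau / 4, by omega⟩
      rw [ha, hb]
      push_cast at hz ⊢
      linear_combination (a - b + 1 : ZMod (2 ^ e)) * hz
  have a4 : (D'.U e D.tau).ncard ≤ 2 ^ (D'.gam + 1) + (2 ^ D.mu - 2 ^ D'.gam) := by
    set S := {z : ZMod (2 ^ e) | ((2 : ℕ) : ZMod (2 ^ e)) ^ D.mu * z = 0}
    set S' := {z : ZMod (2 ^ e) | ((2 : ℕ) : ZMod (2 ^ e)) ^ D'.gam * z = 0}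
    have hSS : S' ⊆ S := fun z hz => pow_mul_eq_zero_mono (by omega) hz
    have e1 : (S \ S').ncard = 2 ^ D.mu - 2 ^ D'.gam := by
      rw [Set.ncard_sdiff hSS (Set.toFinite _), ncard_pow_mul_eq_zero (by omega),
        ncard_pow_mul_eq_zero (by omega)]
    rw [← ncard_prod_pow (p := 2) (e := e) (by omega) (by omega), ← e1]
    refine le_trans (Set.ncard_le_ncard (t := _ ∪ (fun z => (z, ((2 : ℕ) : ZMod (2 ^ e)) ^ D'.gam * z))
      '' (S \ S')) ?_ (Set.toFinite _)) ((Set.ncard_union_le _ _).trans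
        (Nat.add_le_add_left (Set.ncard_image_le (Set.toFinite _)) _))
    rintro ⟨z, w⟩ ⟨f, hf, -, -, h3, -, -, h6, h7, -⟩
    simp only at h3 h6 h7
    have hw : 2 * w = 0 := (two_mul_eq_zero_iff_of_three d2).1 h7
    by_cases hz : z ∈ S'
    · exact Or.inl ⟨hz, by simpa using hw⟩
    · right
      rw [← hmu] at h3
      refine ⟨z, ⟨h3, hz⟩, ?_⟩
      simp only
      rw [← h6]
      by_cases hfn : D'.nu - f = 0
      · rw [hfn, pow_zero, one_mul]
      · exfalso
        rw [two_pow_mul_eq_zero hw (by omega)] at h6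
        exact hz h6.symm
  have a5 : 2 ^ D.mu = 2 * 2 ^ D'.gam := by rw [← hg', pow_succ, mul_comm]
  have a6 : 0 < 2 ^ D'.gam := by positivity
  simp only [pow_succ] at a1 a4
  omega

lemma Dih.not_small {D D' : LocalData 2} (h : Same D D' e) (hD : D.Dih)
    (hD' : D'.Dih) (he : e = D.mu + D.nu) (hmu : D.mu = D'.mu) (hnu : D.nu = D'.nu)
    (hg : D.gam = D.mu) (hg' : D'.gam + 1 = D.mu) (hn2 : 2 ≤ D.nu) (hm3 : D.mu = 2) : False := by
  have : NeZero (2 ^ e) := ⟨by positivity⟩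
  have hW := W_zero_eq_of_dih h hD hD' he (by omega) hnu
  have hW0 := D.W_zero
  obtain ⟨-, d1, d2⟩ := id hD
  obtain ⟨-, d1', d2'⟩ := id hD'
  have k1 := h 1 (Nat.coprime_one_right 2) 1 (1 + 2 ^ e) (not_dvd_one_add_pow (by omega))
  have k2 := h 1 (Nat.coprime_one_right 2) 1 3 (by omega)
  simp only [Finset.sum_range_succ, Finset.sum_range_zero, zero_add,
    hD.X_neg (e := e) (t := 3) rfl le_rfl, hD'.X_neg (e := e) (t := 3) rfl le_rfl, if_true,
    ← hnu, ← hW] at k1 k2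
  have hch : ∀ z : ZMod (2 ^ e), ∃ y : ZMod (2 ^ e),
      ((2 : ℕ) : ZMod (2 ^ e)) ^ 2 * z = 0 → z = ((2 : ℕ) : ZMod (2 ^ e)) ^ D.nu * y := by
    intro z
    by_cases hz : ((2 : ℕ) : ZMod (2 ^ e)) ^ 2 * z = 0
    · rw [← ZMod.natCast_zmod_val z, ← Nat.cast_pow, ← Nat.cast_mul, ZMod.natCast_eq_zero_iff] at hz
      have hee : 2 ^ 2 * 2 ^ D.nu = 2 ^ e := by rw [← pow_add]; congr 1; omega
      obtain ⟨y, hy⟩ := (Nat.mul_dvd_mul_iff_left (by norm_num)).1 ((dvd_of_eq hee).trans hz)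
      refine ⟨y, fun _ => ?_⟩
      conv_lhs => rw [← ZMod.natCast_zmod_val z, hy]
      push_cast; rfl
    · exact ⟨0, fun h => absurd h hz⟩
  choose y hy using hch
  have hfix : ∀ (τ : ℕ) (z : ZMod (2 ^ e)), τ % 4 = 3 → ((2 : ℕ) : ZMod (2 ^ e)) ^ 2 * z = 0 →
      (τ : ZMod (2 ^ e)) * z = 3 * z := by
    intro τ z hτ hz
    obtain ⟨a, ha⟩ : ∃ a, τ = 4 * a + 3 := ⟨τ / 4, by omega⟩
    rw [ha]
    push_cast at hz ⊢
    linear_combination (a : ZMod (2 ^ e)) * hz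
  obtain ⟨c, hc⟩ : ∃ c, D.nu = c + 1 := ⟨D.nu - 1, by omega⟩
  have tr : ∀ i, (D.X e i 1 (1 + 2 ^ e)).ncard = (D'.X e i 1 (1 + 2 ^ e)).ncard := by
    intro i
    have hmem : ∀ z w, (z, w) ∈ D.X e i 1 (1 + 2 ^ e) ↔ (z, w + 4 * y z) ∈ D'.X e i 1 (1 + 2 ^ e) := by
      intro z w
      simp only [X, locSet, Set.mem_ofPred_eq, ← hmu, ← hnu, hm3]
      refine and_congr_right fun _ => and_congr_right fun _ => and_congr_right fun hz => ?_
      have e1 := hfix _ z d2 hz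
      have e2 := hfix _ z d2' hz
      have hyz := hy z hz
      simp only [pow_one, Nat.sub_self, pow_zero, e1, e2]
      have e3 : (D.tau : ZMod (2 ^ e)) ^ 2 * z = z := by
        rw [pow_two, mul_assoc, e1, mul_left_comm, e1]
        push_cast at hz
        linear_combination 2 * hz
      have e4 : (D'.tau : ZMod (2 ^ e)) ^ 2 * z = z := by
        rw [pow_two, mul_assoc, e2, mul_left_comm, e2]
        push_cast at hz
        linear_combination 2 * hz
      simp only [e3, e4, cast_one_add_pow_mul_eq, natCast_pow_mul_eq_zero, true_and]
      refine and_congr_right fun _ => and_congr ?_ ?_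
      · rw [hg, hm3, show D'.gam = 1 by omega, hz, hc, Nat.add_sub_cancel, mul_add, pow_one]
        have : ((2 : ℕ) : ZMod (2 ^ e)) ^ c * (4 * y z) = ((2 : ℕ) : ZMod (2 ^ e)) * z := by
          conv_rhs => rw [hyz, hc]
          push_cast; ring
        rw [this, add_eq_right]
      · exact iff_of_true ⟨0, by simp⟩ ⟨0, by simp⟩
    refine Set.ncard_congr (fun q _ => (q.1, q.2 + 4 * y q.1)) ?_ ?_ ?_
    · rintro ⟨z, w⟩ hq
      exact (hmem z w).1 hq
    · rintro ⟨z, w⟩ ⟨z', w'⟩ - - hq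
      simp only [Prod.mk.injEq] at hq
      obtain ⟨rfl, hq⟩ := hq
      rw [add_left_inj] at hq
      rw [hq]
    · rintro ⟨z, w⟩ hq
      exact ⟨(z, w - 4 * y z), (hmem _ _).2 (by simpa using hq), by simp⟩
  have k3 : D.W 1 1 = D'.W 1 1 := by
    rw [tr 0, tr 1] at k1
    have : 0 < (D'.X e 1 1 (1 + 2 ^ e)).ncard := by
      rw [Set.ncard_pos (Set.toFinite _)]
      exact ⟨0, by omega, le_rfl, by simp, by simp, Or.inl rfl, by simp, by simp, 0, by simp⟩
    exact Nat.eq_of_mul_eq_mul_right this (by omega)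
  rw [k3] at k2
  have k4 : 0 < (D.X e 0 1 3).ncard := by
    rw [Set.ncard_pos (Set.toFinite _)]
    have e0 : ((2 : ℕ) : ZMod (2 ^ e)) ^ 2 * ((2 : ℕ) : ZMod (2 ^ e)) ^ D.nu = 0 := by
      rw [← pow_add, pow_eq_zero_iff_le]; omega
    have e1 := hfix _ _ d2 e0
    refine ⟨(((2 : ℕ) : ZMod (2 ^ e)) ^ D.nu, 0), by omega, by omega, ?_, ?_, Or.inr ?_, ?_, ?_, 1, ?_⟩
    · rw [hm3]; exact e0
    · simp only [pow_one]
      rw [pow_two, mul_assoc, e1, mul_left_comm, e1]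
      push_cast at e0 ⊢
      linear_combination 2 * e0
    · simp only [Nat.sub_self, pow_zero, pow_one, e1, ne_eq]
      intro h0
      have : ((2 : ℕ) : ZMod (2 ^ e)) ^ (D.nu + 1) = 0 := by
        push_cast at h0 ⊢
        linear_combination h0
      rw [pow_eq_zero_iff_le] at this
      omega
    · simp only
      rw [hg, hm3, e0, mul_zero]
    · simp
    · simp only [pow_zero, pow_one, one_mul, e1]
      push_cast; rfl
  have k5 : D'.X e 0 1 3 = ∅ := by
    rw [Set.eq_empty_iff_forall_notMem]
    rintro ⟨z, w⟩ ⟨-, -, h3, -, h5, h6, h7, -⟩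
    simp only at h3 h5 h6 h7
    rw [two_pow_mul_eq_zero ((two_mul_eq_zero_iff_of_three (by rfl)).1 h7) (by omega),
      show D'.gam = 1 by omega] at h6
    refine h5.resolve_left (by omega) ?_
    rw [pow_mul_eq_of_two_mul d2']
    simpa using h6.symm
  rw [k5, Set.ncard_empty] at k2
  have : D.W 1 0 * (D.X e 0 1 3).ncard = 0 := by omega
  rcases mul_eq_zero.1 this with h0 | h0 <;> omega

/-- The local invariants `γ` agree when all counting functions do. -/
theorem gam_eq {p : ℕ} [hp : Fact p.Prime] {D D' : LocalData p} {e : ℕ}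
    (he : e = D.mu + D.nu) (he' : e = D'.mu + D'.nu)
    (hlin : ∀ t, ¬ p ∣ t → (D.lin e t).ncard = (D'.lin e t).ncard)
    (hsame : ¬ D.Free → ¬ D'.Free → Same D D' e)
    (hinv : D.Dih → D'.Dih → D.nu = 1 → D'.nu = 1 → D.mu = D'.mu → D.gam = D'.gam)
    (hF : D.Free → D.gam = D.mu) (hF' : D'.Free → D'.gam = D'.mu) :
    D.gam = D'.gam := by
  obtain ⟨u, v, b1, b2, b3, b4, b5⟩ := D.exists_exponents he
  obtain ⟨u', v', b1', b2', b3', b4', b5'⟩ := D'.exists_exponents he'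
  obtain ⟨rfl, rfl⟩ := exponents_unique (p := p) b1 b1' (fun j hj => by
    rw [← b2 j hj, ← b2' j hj]; exact hlin _ (not_dvd_one_add_pow hj))
  have nf : D.Reg ∨ D.Dih → ¬ D.Free := by
    rintro (h | h) hh
    · have := b4 h; have := b3 hh; omega
    · have := b5 h; have := b3 hh; omega
  have nf' : D'.Reg ∨ D'.Dih → ¬ D'.Free := by
    rintro (h | h) hh
    · have := b4' h; have := b3' hh; omega
    · have := b5' h; have := b3' hh; omega
  rcases D.trichotomy with h | h | h <;> rcases D'.trichotomy with h' | h' | h'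
  · have := b3 h; have := b3' h'; have := hF h; have := hF' h'; omega
  · have := b3 h; have := b4' h'; omega
  · have := b3 h; have := b5' h'; omega
  · have := b4 h; have := b3' h'; omega
  · have c := b4 h; have c' := b4' h'
    exact gam_eq_of_reg (hsame (nf (Or.inl h)) (nf' (Or.inl h'))) h h' he he'
      (by omega) (by omega)
  · have c := b4 h; have c' := b5' h'
    exact gam_eq_of_reg_dih (hsame (nf (Or.inl h)) (nf' (Or.inr h'))) h h' he he'
      (by omega) (by omega)
  · have := b5 h; have := b3' h'; omega
  · have c := b5 h; have c' := b4' h'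
    exact (gam_eq_of_reg_dih (hsame (nf (Or.inr h)) (nf' (Or.inl h'))).symm h' h he' he
      (by omega) (by omega)).symm
  · have c := b5 h; have c' := b5' h'
    have hs := hsame (nf (Or.inr h)) (nf' (Or.inr h'))
    have g1 := h.gam_ge
    have g1' := h'.gam_ge
    have g2 := D.gam_le
    have g2' := D'.gam_le
    have g3 := h.nu_pos
    by_contra hne
    by_cases hn : D.nu = 1
    · exact hne (hinv h h' hn (by omega) (by omega))
    · obtain ⟨rfl, m2, -⟩ := id h
      by_cases hg : D.gam = D.mu
      · rcases Nat.lt_or_ge 2 D.mu with hm | hm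
        · exact Dih.not_big hs h h' he (by omega) (by omega) hg (by omega) (by omega) hm
        · exact Dih.not_small hs h h' he (by omega) (by omega) hg (by omega) (by omega) (by omega)
      · rcases Nat.lt_or_ge 2 D.mu with hm | hm
        · exact Dih.not_big hs.symm h' h he' (by omega) (by omega) (by omega) (by omega)
            (by omega) (by omega)
        · exact Dih.not_small hs.symm h' h he' (by omega) (by omega) (by omega) (by omega)
            (by omega) (by omega)

end LocalData

/-- A presentation-like description of a finite metacyclic group. -/
structure Pres (G : Type*) [Group G] where
  a : G
  b : G
  m : ℕ
  n : ℕ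
  s : ℕ
  tau : ℕ
  m_pos : 0 < m
  n_pos : 0 < n
  order_a : orderOf a = m
  conj : b * a = a ^ tau * b
  pow_n : b ^ n = a ^ s
  dvd_of_mem : ∀ y : ℕ, b ^ y ∈ Subgroup.zpowers a → n ∣ y
  cover : ∀ g : G, ∃ x y : ℕ, g = a ^ x * b ^ y
  card_eq : Nat.card G = m * n

namespace Pres

variable {G : Type*} [Group G] (D : Pres G)

lemma pow_conj (x y : ℕ) : D.b ^ y * D.a ^ x = D.a ^ (D.tau ^ y * x) * D.b ^ y := by
  have h1 : ∀ x, D.b * D.a ^ x = D.a ^ (D.tau * x) * D.b := by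
    intro x
    induction x with
    | zero => simp
    | succ k ih =>
      rw [pow_succ, ← mul_assoc, ih, mul_assoc, D.conj, ← mul_assoc, ← pow_add, mul_add, mul_one]
  induction y generalizing x with
  | zero => simp
  | succ k ih =>
    rw [pow_succ, mul_assoc, h1, ← mul_assoc, ih, mul_assoc, pow_succ, mul_assoc]

lemma mul_eq (x y x' y' : ℕ) : D.a ^ x * D.b ^ y * (D.a ^ x' * D.b ^ y') =
    D.a ^ (x + D.tau ^ y * x') * D.b ^ (y + y') := by
  rw [mul_assoc, ← mul_assoc (D.b ^ y), D.pow_conj, pow_add, pow_add]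
  simp only [mul_assoc]

lemma pow_a_eq_iff {x x' : ℕ} : D.a ^ x = D.a ^ x' ↔ x ≡ x' [MOD D.m] := by
  rw [pow_eq_pow_iff_modEq, D.order_a]

lemma tau_pow_n : D.tau ^ D.n ≡ 1 [MOD D.m] := by
  rw [← D.pow_a_eq_iff]
  have := D.pow_conj 1 D.n
  rw [D.pow_n, mul_one, pow_one, ← pow_succ, pow_succ'] at this
  rw [pow_one]
  exact (mul_right_cancel this).symm

lemma s_tau : D.tau * D.s ≡ D.s [MOD D.m] := by
  rw [← D.pow_a_eq_iff]
  have := D.pow_conj D.s 1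
  rw [← D.pow_n, pow_one, ← pow_succ', pow_succ, pow_one] at this
  rw [← D.pow_n]
  exact (mul_right_cancel this).symm

lemma rep_eq {x y x' y' : ℕ} (h : D.a ^ x * D.b ^ y = D.a ^ x' * D.b ^ y') (hy : y ≤ y') :
    ∃ k, y' = y + D.n * k ∧ x ≡ x' + D.s * k [MOD D.m] := by
  obtain ⟨c, rfl⟩ := Nat.exists_eq_add_of_le hy
  have h1 : D.a ^ x = D.a ^ x' * D.b ^ c := by
    rw [add_comm, pow_add, ← mul_assoc] at h
    exact mul_right_cancel h
  have h2 : D.b ^ c ∈ Subgroup.zpowers D.a := by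
    have : D.b ^ c = (D.a ^ x')⁻¹ * D.a ^ x := by rw [h1]; group
    rw [this]
    exact mul_mem (inv_mem (pow_mem (Subgroup.mem_zpowers _) _))
      (pow_mem (Subgroup.mem_zpowers _) _)
  obtain ⟨k, rfl⟩ := D.dvd_of_mem c h2
  refine ⟨k, rfl, ?_⟩
  rw [← D.pow_a_eq_iff, h1, pow_mul, D.pow_n, pow_add, pow_mul]

/-- The exponent of `a` in a chosen expression of an element. -/
def expA (g : G) : ℕ := (D.cover g).choose

/-- The exponent of `b` in a chosen expression of an element. -/
def expB (g : G) : ℕ := (D.cover g).choose_spec.choose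

lemma exp_spec (g : G) : D.a ^ D.expA g * D.b ^ D.expB g = g :=
  (D.cover g).choose_spec.choose_spec.symm

section Pairs

variable (N : ℕ)

/-- The length of the orbit of a character of `A`. -/
def per (z : ZMod N) : ℕ := Function.minimalPeriod (fun x => (D.tau : ZMod N) * x) z

/-- The set of pairs describing linear characters of inertia subgroups. -/
def pairs : Set (ZMod N × ZMod N) :=
  {q | (D.m : ZMod N) * q.1 = 0 ∧ ((D.n / D.per N q.1 : ℕ) : ZMod N) * q.2 = (D.s : ZMod N) * q.1}

variable {N}

lemma per_dvd_iff {z : ZMod N} {k : ℕ} : D.per N z ∣ k ↔ (D.tau : ZMod N) ^ k * z = z := by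
  rw [per, ← Function.isPeriodicPt_iff_minimalPeriod_dvd, Function.IsPeriodicPt,
    Function.IsFixedPt, mul_left_iterate]

lemma cast_mul_eq_of_modEq {z : ZMod N} (hz : (D.m : ZMod N) * z = 0) {x y : ℕ}
    (h : x ≡ y [MOD D.m]) : (x : ZMod N) * z = y * z := by
  obtain ⟨k, hk⟩ := h.dvd
  have h2 : (y : ZMod N) = x + D.m * k := by
    have : (y : ℤ) = x + D.m * k := by linarith
    exact_mod_cast congrArg (Int.cast : ℤ → ZMod N) this
  rw [h2]
  linear_combination -(k : ZMod N) * hz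

lemma per_dvd_n {z : ZMod N} (hz : (D.m : ZMod N) * z = 0) : D.per N z ∣ D.n := by
  rw [per_dvd_iff]
  have := D.cast_mul_eq_of_modEq hz D.tau_pow_n
  push_cast at this
  rw [this, one_mul]

lemma per_pos {z : ZMod N} (hz : (D.m : ZMod N) * z = 0) : 0 < D.per N z :=
  Nat.pos_of_dvd_of_pos (D.per_dvd_n hz) D.n_pos

variable {L : Type*} [Field L] (e : AddChar (ZMod N) L)

/-- The extension by zero of a linear character of an inertia subgroup. -/
def theta (q : ZMod N × ZMod N) (g : G) : L :=
  if D.per N q.1 ∣ D.expB g then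
    e (D.expA g * q.1 + ((D.expB g / D.per N q.1 : ℕ) : ZMod N) * q.2) else 0

variable {q : ZMod N × ZMod N} (hq : q ∈ D.pairs N)

include hq

lemma theta_apply (x y : ℕ) : D.theta e q (D.a ^ x * D.b ^ y) =
    if D.per N q.1 ∣ y then e (x * q.1 + ((y / D.per N q.1 : ℕ) : ZMod N) * q.2) else 0 := by
  have key : ∀ x y x' y' : ℕ, D.a ^ x * D.b ^ y = D.a ^ x' * D.b ^ y' → y ≤ y' →
      (D.per N q.1 ∣ y ↔ D.per N q.1 ∣ y') ∧
      (x * q.1 + ((y / D.per N q.1 : ℕ) : ZMod N) * q.2 =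
        x' * q.1 + ((y' / D.per N q.1 : ℕ) : ZMod N) * q.2) := by
    intro x y x' y' h hy
    obtain ⟨k, rfl, hx⟩ := D.rep_eq h hy
    have hd := D.per_dvd_n hq.1
    refine ⟨(Nat.dvd_add_left (hd.mul_right k)).symm, ?_⟩
    rw [D.cast_mul_eq_of_modEq hq.1 hx, Nat.add_div_of_dvd_left (hd.mul_right k),
      Nat.mul_div_right_comm hd]
    have := hq.2
    push_cast at this ⊢
    linear_combination -(k : ZMod N) * this
  have h := D.exp_spec (D.a ^ x * D.b ^ y)
  rw [theta]
  rcases le_total (D.expB (D.a ^ x * D.b ^ y)) y with h' | h'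
  · obtain ⟨h1, h2⟩ := key _ _ _ _ h h'
    rw [h2]; simp only [h1]
  · obtain ⟨h1, h2⟩ := key _ _ _ _ h.symm h'
    rw [← h2]; simp only [h1]

lemma theta_a (x : ℕ) : D.theta e q (D.a ^ x) = e (x * q.1) := by
  have := D.theta_apply e hq x 0
  simpa using this

lemma theta_b_per : D.theta e q (D.b ^ D.per N q.1) = e q.2 := by
  have := D.theta_apply e hq 0 (D.per N q.1)
  simpa [Nat.div_self (D.per_pos hq.1)] using this

lemma theta_one : D.theta e q 1 = 1 := by
  have := D.theta_a e hq 0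
  simpa using this

lemma theta_mul_of_left {g : G} (h : G) (hg : D.theta e q g ≠ 0) :
    D.theta e q (g * h) = D.theta e q g * D.theta e q h := by
  obtain ⟨x, y, rfl⟩ := D.cover g
  obtain ⟨x', y', rfl⟩ := D.cover h
  rw [D.theta_apply e hq] at hg
  have hd : D.per N q.1 ∣ y := by by_contra hd; simp [hd] at hg
  rw [D.mul_eq, D.theta_apply e hq, D.theta_apply e hq, D.theta_apply e hq, if_pos hd]
  simp only [Nat.dvd_add_right hd]
  split_ifs with h1
  · rw [← AddChar.map_add_eq_mul, Nat.add_div_of_dvd_right hd]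
    congr 1
    have := D.per_dvd_iff.1 hd
    push_cast
    linear_combination (x' : ZMod N) * this
  · simp

lemma theta_mul_of_right (g : G) {h : G} (hh : D.theta e q h ≠ 0) :
    D.theta e q (g * h) = D.theta e q g * D.theta e q h := by
  by_cases hg : D.theta e q g = 0
  · obtain ⟨x, y, rfl⟩ := D.cover g
    obtain ⟨x', y', rfl⟩ := D.cover h
    rw [D.theta_apply e hq] at hh
    have hd : D.per N q.1 ∣ y' := by by_contra hd; simp [hd] at hh
    rw [D.theta_apply e hq] at hg
    have hd' : ¬ D.per N q.1 ∣ y := by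
      intro hd'
      rw [if_pos hd'] at hg
      exact (AddChar.val_isUnit e _).ne_zero hg
    rw [D.mul_eq, D.theta_apply e hq, D.theta_apply e hq, if_neg hd', zero_mul,
      if_neg (by rwa [Nat.dvd_add_left hd])]
  · exact D.theta_mul_of_left e hq h hg

lemma theta_ne_zero_iff (x y : ℕ) : D.theta e q (D.a ^ x * D.b ^ y) ≠ 0 ↔ D.per N q.1 ∣ y := by
  rw [D.theta_apply e hq]
  split_ifs with h
  · simp [h, (AddChar.val_isUnit e _).ne_zero]
  · simp [h]

lemma theta_pow_ne_zero (x : ℕ) : D.theta e q (D.a ^ x) ≠ 0 := by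
  rw [D.theta_a e hq]; exact (AddChar.val_isUnit e _).ne_zero

lemma theta_inv {g : G} (hg : D.theta e q g ≠ 0) : D.theta e q g⁻¹ = (D.theta e q g)⁻¹ := by
  have := D.theta_mul_of_left e hq g⁻¹ hg
  rw [mul_inv_cancel, D.theta_one e hq] at this
  exact eq_inv_of_mul_eq_one_right this.symm

lemma theta_conj_ne_zero_iff (k g : G) : D.theta e q (k * g * k⁻¹) ≠ 0 ↔ D.theta e q g ≠ 0 := by
  have key : ∀ k g : G, D.theta e q g ≠ 0 → D.theta e q (k * g * k⁻¹) ≠ 0 := by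
    intro k g hg
    obtain ⟨x, y, rfl⟩ := D.cover g
    obtain ⟨x', y', rfl⟩ := D.cover k
    have hy := (D.theta_ne_zero_iff e hq _ _).1 hg
    obtain ⟨x'', y'', h⟩ := D.cover (D.a ^ x' * D.b ^ y' * (D.a ^ x * D.b ^ y) *
      (D.a ^ x' * D.b ^ y')⁻¹)
    rw [h, D.theta_ne_zero_iff e hq]
    rw [eq_comm, ← mul_inv_eq_iff_eq_mul, inv_inv, D.mul_eq, D.mul_eq] at h
    have hn := D.per_dvd_n hq.1
    rcases le_total (y'' + y') (y' + y) with h' | h'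
    · obtain ⟨c, hc, -⟩ := D.rep_eq h h'
      have : y = y'' + D.n * c := by omega
      rw [this] at hy
      exact (Nat.dvd_add_left (hn.mul_right c)).1 hy
    · obtain ⟨c, hc, -⟩ := D.rep_eq h.symm h'
      have : y'' = y + D.n * c := by omega
      rw [this]
      exact (Nat.dvd_add_left (hn.mul_right c)).2 hy
  refine ⟨fun h => ?_, key k g⟩
  have := key k⁻¹ _ h
  simpa [mul_assoc] using this

end Pairs

end Pres

section GroupAlgebra

variable {G : Type*} [Group G] [Fintype G] {L : Type*} [Field L] [CharZero L]

lemma coeff_conj_of_mem_center {c : MonoidAlgebra ℚ G}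
    (hc : c ∈ Subalgebra.center ℚ (MonoidAlgebra ℚ G)) (k g : G) :
    c.coeff (k * g * k⁻¹) = c.coeff g := by
  have h := congrArg (fun x : MonoidAlgebra ℚ G => x.coeff (k * g))
    (Subalgebra.mem_center_iff.1 hc (MonoidAlgebra.single k 1))
  simp only [MonoidAlgebra.coeff_single_mul_apply, MonoidAlgebra.coeff_mul_single_apply] at h
  rw [one_mul, mul_one, inv_mul_cancel_left] at h
  exact h.symm

/-- The pairing of an element of the group algebra with a function on the group. -/
def pairing (f : G → L) : MonoidAlgebra ℚ G →+ L where
  toFun c := ∑ g, ((c.coeff g : ℚ) : L) * f g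
  map_zero' := by simp
  map_add' x y := by simp [add_mul, Finset.sum_add_distrib]

lemma pairing_apply (f : G → L) (c : MonoidAlgebra ℚ G) :
    pairing f c = ∑ g, ((c.coeff g : ℚ) : L) * f g := rfl

lemma pairing_single (f : G → L) (g : G) (r : ℚ) :
    pairing f (MonoidAlgebra.single g r) = r * f g := by
  rw [pairing_apply, Finset.sum_eq_single g]
  · simp
  · intro h _ hh
    simp [hh.symm]
  · simp

lemma pairing_mul (f : G → L) (c c' : MonoidAlgebra ℚ G) :
    pairing f (c * c') =
      ∑ h, ((c.coeff h : ℚ) : L) * ∑ g, ((c'.coeff g : ℚ) : L) * f (h * g) := by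
  rw [pairing_apply]
  have h1 : ∀ k, (c * c').coeff k = ∑ h, c.coeff h * c'.coeff (h⁻¹ * k) := by
    intro k
    rw [MonoidAlgebra.coeff_mul_apply_left, Finsupp.sum_fintype]
    simp
  simp only [h1, Rat.cast_sum, Finset.sum_mul]
  rw [Finset.sum_comm]
  refine Finset.sum_congr rfl fun h _ => ?_
  rw [Finset.mul_sum]
  refine Fintype.sum_equiv (Equiv.mulLeft h⁻¹) _ _ fun k => ?_
  simp [mul_assoc]

/-- The sum of all conjugates of an element. -/
def conjSum (h : G) : MonoidAlgebra ℚ G := ∑ k : G, MonoidAlgebra.single (k * h * k⁻¹) 1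

lemma conjSum_mem_center (h : G) : conjSum h ∈ Subalgebra.center ℚ (MonoidAlgebra ℚ G) := by
  rw [Subalgebra.mem_center_iff]
  intro b
  induction b using MonoidAlgebra.induction_linear with
  | zero => simp
  | add x y hx hy => rw [add_mul, mul_add, hx, hy]
  | single g r =>
    rw [conjSum, Finset.mul_sum, Finset.sum_mul]
    refine Fintype.sum_equiv (Equiv.mulLeft g) _ _ fun k => ?_
    simp [MonoidAlgebra.single_mul_single, mul_assoc]

lemma pairing_conjSum (f : G → L) (h : G) :
    pairing f (conjSum h) = ∑ k : G, f (k * h * k⁻¹) := by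
  rw [conjSum, map_sum]
  simp [pairing_single]

end GroupAlgebra

namespace Pres

variable {G : Type*} [Group G] [Fintype G] (D : Pres G) {N : ℕ}
  {L : Type*} [Field L] [CharZero L] (e : AddChar (ZMod N) L) {q : ZMod N × ZMod N}

lemma conj_a (x y : ℕ) :
    D.a ^ x * D.b ^ y * D.a * (D.a ^ x * D.b ^ y)⁻¹ = D.a ^ (D.tau ^ y) := by
  rw [mul_inv_eq_iff_eq_mul, mul_assoc]
  conv_lhs => rw [← pow_one D.a, ← pow_mul, one_mul, D.pow_conj, mul_one]
  rw [← mul_assoc, ← mul_assoc, ← pow_add, ← pow_add, add_comm]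

lemma per_tau_pow_mul {z : ZMod N} (hz : (D.m : ZMod N) * z = 0) (j : ℕ) :
    D.per N ((D.tau : ZMod N) ^ j * z) = D.per N z := by
  have hn := D.per_dvd_n hz
  apply Nat.dvd_antisymm
  · rw [D.per_dvd_iff, mul_left_comm, D.per_dvd_iff.1 dvd_rfl]
  · rw [D.per_dvd_iff]
    have h3 := (D.per_dvd_iff (z := (D.tau : ZMod N) ^ j * z)).1 dvd_rfl
    have h5 : (D.tau : ZMod N) ^ (j * (D.n - 1)) * ((D.tau : ZMod N) ^ j * z) = z := by
      rw [← mul_assoc, ← pow_add]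
      obtain ⟨c, hc⟩ : ∃ c, D.n = c + 1 := ⟨D.n - 1, by have := D.n_pos; omega⟩
      rw [hc, Nat.add_sub_cancel, show j * c + j = D.n * j by rw [hc]; ring]
      exact D.per_dvd_iff.1 (hn.mul_right j)
    generalize D.per N ((D.tau : ZMod N) ^ j * z) = k at h3 ⊢
    conv_lhs => rw [← h5]
    rw [mul_left_comm, h3, h5]

lemma sum_mul_theta (he : ∀ u, e u = 1 → u = 0) (hq : q ∈ D.pairs N) {c : MonoidAlgebra ℚ G}
    (hc : c ∈ Subalgebra.center ℚ (MonoidAlgebra ℚ G)) (h : G) :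
    ∑ g, ((c.coeff g : ℚ) : L) * D.theta e q (h * g) =
      D.theta e q h * pairing (D.theta e q) c := by
  by_cases hh : D.theta e q h = 0
  · rw [hh, zero_mul]
    obtain ⟨x, y, rfl⟩ := D.cover h
    set h := D.a ^ x * D.b ^ y with hdef
    have hy : ¬ D.per N q.1 ∣ y := by
      rw [← D.theta_ne_zero_iff e hq x y, not_not]; exact hh
    have hz : e ((D.tau ^ y : ℕ) * q.1 - q.1) ≠ 1 := by
      intro h1
      apply hy
      rw [D.per_dvd_iff]
      have := he _ h1
      push_cast at this
      exact sub_eq_zero.1 this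
    have key : ∀ g, D.theta e q (h * (D.a * g * D.a⁻¹)) =
        e ((D.tau ^ y : ℕ) * q.1 - q.1) * D.theta e q (h * g) := by
      intro g
      have h1 : h * (D.a * g * D.a⁻¹) = D.a ^ (D.tau ^ y) * (h * g) * D.a⁻¹ := by
        have : h * D.a = D.a ^ (D.tau ^ y) * h := by
          rw [hdef, mul_assoc]
          conv_lhs => rw [← pow_one D.a, ← pow_mul, one_mul, D.pow_conj, mul_one]
          rw [← mul_assoc, ← mul_assoc, ← pow_add, ← pow_add, add_comm]
        rw [← mul_assoc, ← mul_assoc, this]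
        simp only [mul_assoc]
      have ha := D.theta_pow_ne_zero e hq 1
      rw [pow_one] at ha
      have ha' : D.theta e q D.a⁻¹ ≠ 0 := by
        rw [D.theta_inv e hq ha]; exact inv_ne_zero ha
      rw [h1, D.theta_mul_of_right e hq _ ha', D.theta_mul_of_left e hq _
        (D.theta_pow_ne_zero e hq _), D.theta_inv e hq ha, D.theta_a e hq]
      have := D.theta_a e hq 1
      rw [pow_one, Nat.cast_one, one_mul] at this
      rw [this, AddChar.map_sub_eq_div, div_eq_mul_inv]
      ring
    have h2 : ∑ g, ((c.coeff g : ℚ) : L) * D.theta e q (h * g) =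
        e ((D.tau ^ y : ℕ) * q.1 - q.1) * ∑ g, ((c.coeff g : ℚ) : L) * D.theta e q (h * g) := by
      rw [Finset.mul_sum]
      refine Fintype.sum_equiv (MulAut.conj D.a⁻¹).toEquiv _ _ fun g => ?_
      have h3 := key (D.a⁻¹ * g * D.a)
      have h4 := coeff_conj_of_mem_center hc D.a⁻¹ g
      simp only [inv_inv] at h4
      simp only [MulEquiv.toEquiv_eq_coe, EquivLike.coe_coe, MulAut.conj_apply, inv_inv, h4]
      rw [mul_left_comm, ← h3]
      congr 2
      group
    by_contra h3
    exact hz (mul_right_cancel₀ h3 (by rw [one_mul]; exact h2.symm))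
  · rw [pairing_apply, Finset.mul_sum]
    refine Finset.sum_congr rfl fun g _ => ?_
    rw [D.theta_mul_of_left e hq g hh]
    ring

/-- The central character attached to a pair. -/
def omega (he : ∀ u, e u = 1 → u = 0) (hq : q ∈ D.pairs N) :
    Subalgebra.center ℚ (MonoidAlgebra ℚ G) →* L where
  toFun c := pairing (D.theta e q) c
  map_one' := by
    simp [MonoidAlgebra.one_def, pairing_single, D.theta_one e hq]
  map_mul' c c' := by
    rw [Subalgebra.coe_mul, pairing_mul]
    simp only [D.sum_mul_theta e he hq c'.2]
    rw [pairing_apply _ (c : MonoidAlgebra ℚ G), Finset.sum_mul]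
    simp only [mul_assoc]

lemma omega_apply (he : ∀ u, e u = 1 → u = 0) (hq : q ∈ D.pairs N)
    (c : Subalgebra.center ℚ (MonoidAlgebra ℚ G)) :
    D.omega e he hq c = pairing (D.theta e q) c := rfl

/-- A conjugation followed by a translation multiplies the character sum by a scalar. -/
lemma sum_theta_eq_zero {q' : ZMod N × ZMod N} (hq : q ∈ D.pairs N) (hq' : q' ∈ D.pairs N)
    (k u : G) (hu : D.theta e q (k * u * k⁻¹) ≠ 0) (hu' : D.theta e q' u ≠ 0)
    (h : D.theta e q (k * u * k⁻¹) ≠ D.theta e q' u) :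
    ∑ g, D.theta e q (k * g * k⁻¹) * D.theta e q' g⁻¹ = 0 := by
  have hu'' : D.theta e q' u⁻¹ ≠ 0 := by
    rw [D.theta_inv e hq' hu']; exact inv_ne_zero hu'
  have key : ∑ g, D.theta e q (k * g * k⁻¹) * D.theta e q' g⁻¹ =
      (D.theta e q (k * u * k⁻¹) * (D.theta e q' u)⁻¹) *
      ∑ g, D.theta e q (k * g * k⁻¹) * D.theta e q' g⁻¹ := by
    rw [Finset.mul_sum]
    refine Fintype.sum_equiv (Equiv.mulLeft u⁻¹) _ _ fun g => ?_
    obtain ⟨v, rfl⟩ : ∃ v, g = u * v := ⟨u⁻¹ * g, by group⟩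
    have h1 : k * (u * v) * k⁻¹ = (k * u * k⁻¹) * (k * v * k⁻¹) := by group
    rw [h1, D.theta_mul_of_left e hq _ hu, mul_inv_rev, D.theta_mul_of_right e hq' _ hu'',
      D.theta_inv e hq' hu']
    simp only [Equiv.coe_mulLeft, inv_mul_cancel_left]
    ring
  by_contra h0
  apply h
  have := mul_right_cancel₀ h0 (key.symm.trans (one_mul _).symm)
  field_simp at this
  exact this

lemma theta_conj_eq {q : ZMod N × ZMod N} (hq : q ∈ D.pairs N) (j : ℕ) {q' : ZMod N × ZMod N}
    (hq' : q' ∈ D.pairs N) (h1 : q'.1 = (D.tau : ZMod N) ^ j * q.1) (h2 : q'.2 = q.2) (g : G) :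
    D.theta e q (D.b ^ j * g * (D.b ^ j)⁻¹) = D.theta e q' g := by
  obtain ⟨x, y, rfl⟩ := D.cover g
  have hper : D.per N q'.1 = D.per N q.1 := by rw [h1, D.per_tau_pow_mul hq.1]
  have h3 : D.b ^ j * (D.a ^ x * D.b ^ y) * (D.b ^ j)⁻¹ = D.a ^ (D.tau ^ j * x) * D.b ^ y := by
    rw [mul_inv_eq_iff_eq_mul, ← mul_assoc, D.pow_conj, mul_assoc, mul_assoc, ← pow_add,
      ← pow_add, add_comm]
  rw [h3, D.theta_apply e hq, D.theta_apply e hq', hper, h1, h2]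
  push_cast
  congr 3
  ring

lemma omega_eq_iff (he : ∀ u, e u = 1 → u = 0) {q' : ZMod N × ZMod N}
    (hq : q ∈ D.pairs N) (hq' : q' ∈ D.pairs N) :
    D.omega e he hq = D.omega e he hq' ↔
      q'.2 = q.2 ∧ ∃ j : ℕ, q'.1 = (D.tau : ZMod N) ^ j * q.1 := by
  constructor
  · intro h
    have h1 : ∀ g, ∑ k : G, D.theta e q (k * g * k⁻¹) = ∑ k : G, D.theta e q' (k * g * k⁻¹) := by
      intro g
      have := DFunLike.congr_fun h ⟨conjSum g, conjSum_mem_center g⟩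
      rwa [omega_apply, omega_apply, pairing_conjSum, pairing_conjSum] at this
    have h2 : ∑ k : G, ∑ g, D.theta e q (k * g * k⁻¹) * D.theta e q' g⁻¹ =
        ∑ k : G, ∑ g, D.theta e q' (k * g * k⁻¹) * D.theta e q' g⁻¹ := by
      rw [Finset.sum_comm, Finset.sum_comm (f := fun k g => D.theta e q' (k * g * k⁻¹) * _)]
      refine Finset.sum_congr rfl fun g _ => ?_
      rw [← Finset.sum_mul, ← Finset.sum_mul, h1]
    have h3 : ∀ k : G, ∑ g, D.theta e q' (k * g * k⁻¹) * D.theta e q' g⁻¹ =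
        if D.theta e q' k ≠ 0 then ((Finset.univ.filter fun g => D.theta e q' g ≠ 0).card : L)
        else 0 := by
      intro k
      split_ifs with hk
      · rw [Finset.card_filter, Nat.cast_sum]
        refine Finset.sum_congr rfl fun g _ => ?_
        split_ifs with hg
        · have hk' : D.theta e q' k⁻¹ ≠ 0 := by
            rw [D.theta_inv e hq' hk]; exact inv_ne_zero hk
          rw [D.theta_mul_of_right e hq' _ hk', D.theta_mul_of_left e hq' _ hk,
            D.theta_inv e hq' hk, D.theta_inv e hq' hg]
          field_simp
          simp
        · have := (D.theta_conj_ne_zero_iff e hq' k g).not.2 hg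
          rw [not_not] at this
          rw [this]; simp
      · obtain ⟨x, y, rfl⟩ := D.cover k
        rw [D.theta_ne_zero_iff e hq'] at hk
        have hp := D.conj_a x y
        have ha := D.theta_pow_ne_zero e hq' 1
        rw [pow_one] at ha
        refine D.sum_theta_eq_zero e hq' hq' _ D.a ?_ ha ?_
        · rw [hp]; exact D.theta_pow_ne_zero e hq' _
        · rw [hp, D.theta_a e hq']
          have := D.theta_a e hq' 1
          rw [pow_one, Nat.cast_one, one_mul] at this
          rw [this]
          intro h4
          apply hk
          rw [D.per_dvd_iff]
          have := he ((D.tau ^ y : ℕ) * q'.1 - q'.1) (by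
            rw [AddChar.map_sub_eq_div, h4, div_self (AddChar.val_isUnit e _).ne_zero])
          push_cast at this
          exact sub_eq_zero.1 this
    have h4 : ∑ k : G, ∑ g, D.theta e q' (k * g * k⁻¹) * D.theta e q' g⁻¹ ≠ 0 := by
      simp only [h3]
      rw [← Finset.sum_filter, Finset.sum_const, nsmul_eq_mul]
      have : (Finset.univ.filter fun g => D.theta e q' g ≠ 0).card ≠ 0 := by
        rw [Finset.card_ne_zero]
        exact ⟨1, by simp [D.theta_one e hq']⟩
      exact mul_ne_zero (Nat.cast_ne_zero.2 this) (Nat.cast_ne_zero.2 this)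
    rw [← h2] at h4
    obtain ⟨k, -, hk⟩ := Finset.exists_ne_zero_of_sum_ne_zero h4
    obtain ⟨x, y, rfl⟩ := D.cover k
    have hinj : ∀ u v, e u = e v → u = v := fun u v h =>
      sub_eq_zero.1 (he _ (by
        rw [AddChar.map_sub_eq_div, h, div_self (AddChar.val_isUnit e _).ne_zero]))
    have hz : q'.1 = (D.tau : ZMod N) ^ y * q.1 := by
      by_contra hne
      have hp := D.conj_a x y
      have ha := D.theta_pow_ne_zero e hq' 1
      rw [pow_one] at ha
      refine hk (D.sum_theta_eq_zero e hq hq' _ D.a ?_ ha ?_)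
      · rw [hp]; exact D.theta_pow_ne_zero e hq _
      · rw [hp, D.theta_a e hq]
        have := D.theta_a e hq' 1
        rw [pow_one, Nat.cast_one, one_mul] at this
        rw [this]
        intro h4
        apply hne
        rw [← hinj _ _ h4]
        push_cast; rfl
    refine ⟨?_, y, hz⟩
    have hper : D.per N q'.1 = D.per N q.1 := by rw [hz, D.per_tau_pow_mul hq.1]
    have hp : D.a ^ x * D.b ^ y * D.b ^ D.per N q.1 * (D.a ^ x * D.b ^ y)⁻¹ =
        D.a ^ x * (D.b ^ D.per N q.1 * (D.a ^ x)⁻¹) := by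
      rw [mul_inv_eq_iff_eq_mul]
      simp only [mul_assoc]
      rw [inv_mul_cancel_left, ← pow_add, ← pow_add, add_comm]
    have hx := D.theta_pow_ne_zero e hq x
    have hx' : D.theta e q (D.a ^ x)⁻¹ ≠ 0 := by
      rw [D.theta_inv e hq hx]; exact inv_ne_zero hx
    have hval : D.theta e q (D.a ^ x * D.b ^ y * D.b ^ D.per N q.1 * (D.a ^ x * D.b ^ y)⁻¹) =
        e q.2 := by
      rw [hp, D.theta_mul_of_left e hq _ hx, D.theta_mul_of_right e hq _ hx',
        D.theta_inv e hq hx, D.theta_b_per e hq]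
      field_simp
    have hval' : D.theta e q' (D.b ^ D.per N q.1) = e q'.2 := by
      rw [← hper, D.theta_b_per e hq']
    by_contra hne
    refine hk (D.sum_theta_eq_zero e hq hq' _ (D.b ^ D.per N q.1) ?_ ?_ ?_)
    · rw [hval]; exact (AddChar.val_isUnit e _).ne_zero
    · rw [hval']; exact (AddChar.val_isUnit e _).ne_zero
    · rw [hval, hval']
      exact fun h => hne (hinj _ _ h).symm
  · rintro ⟨h2, j, h1⟩
    ext c
    rw [omega_apply, omega_apply, pairing_apply, pairing_apply]
    refine Fintype.sum_equiv (MulAut.conj (D.b ^ j)⁻¹).toEquiv _ _ fun g => ?_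
    have h4 := coeff_conj_of_mem_center c.2 (D.b ^ j)⁻¹ g
    simp only [MulEquiv.toEquiv_eq_coe, EquivLike.coe_coe, MulAut.conj_apply, h4]
    rw [← D.theta_conj_eq e hq j hq' h1 h2]
    congr 2
    group

end Pres

section Orthogonality

variable {N : ℕ} [NeZero N] {L : Type*} [Field L] [CharZero L] (e : AddChar (ZMod N) L)

lemma sum_addChar_torsion (he : ∀ u, e u = 1 → u = 0) {k : ℕ} (hk : k ∣ N) (j : ℕ) :
    ∑ u ∈ Finset.univ.filter (fun u : ZMod N => (k : ZMod N) * u = 0), e (j * u) =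
      if k ∣ j then (k : L) else 0 := by
  have hN0 : N ≠ 0 := NeZero.ne N
  split_ifs with h
  · obtain ⟨i, rfl⟩ := h
    have h1 : ∀ u ∈ Finset.univ.filter (fun u : ZMod N => (k : ZMod N) * u = 0),
        e ((k * i : ℕ) * u) = 1 := by
      intro u hu
      rw [Finset.mem_filter] at hu
      have : ((k * i : ℕ) : ZMod N) * u = 0 := by
        push_cast
        linear_combination (i : ZMod N) * hu.2
      rw [this, AddChar.map_zero_eq_one]
    rw [Finset.sum_congr rfl h1, Finset.sum_const, nsmul_eq_mul, mul_one]
    obtain ⟨c, hc⟩ := hk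
    have h2 := ncard_mul_eq_zero hc hN0
    rw [← Finset.coe_filter_univ, Set.ncard_coe_finset] at h2
    rw [h2]
  · obtain ⟨c, hc⟩ := hk
    have hk0 : 0 < k := Nat.pos_of_ne_zero fun h0 => hN0 (by rw [hc, h0, zero_mul])
    have hc0 : 0 < c := Nat.pos_of_ne_zero fun h0 => hN0 (by rw [hc, h0, mul_zero])
    have hkc : (k : ZMod N) * (c : ZMod N) = 0 := by
      rw [← Nat.cast_mul, ← hc, ZMod.natCast_self]
    have hne : e (j * c) ≠ 1 := by
      intro h1
      have h2 := he _ h1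
      rw [← Nat.cast_mul, ZMod.natCast_eq_zero_iff] at h2
      exact h ((Nat.mul_dvd_mul_iff_right hc0).1 ((dvd_of_eq hc.symm).trans h2))
    have key : ∑ u ∈ Finset.univ.filter (fun u : ZMod N => (k : ZMod N) * u = 0), e (j * u) =
        e (j * c) * ∑ u ∈ Finset.univ.filter (fun u : ZMod N => (k : ZMod N) * u = 0),
          e (j * u) := by
      rw [Finset.mul_sum]
      refine Finset.sum_bij (fun u _ => u - c) ?_ ?_ ?_ ?_
      · intro u hu
        rw [Finset.mem_filter] at hu ⊢
        exact ⟨Finset.mem_univ _, by rw [mul_sub, hu.2, hkc, sub_zero]⟩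
      · intro u _ v _ h
        exact sub_left_injective h
      · intro u hu
        rw [Finset.mem_filter] at hu
        exact ⟨u + c, by rw [Finset.mem_filter]; exact ⟨Finset.mem_univ _, by
          rw [mul_add, hu.2, hkc, zero_add]⟩, by ring⟩
      · intro u _
        rw [← AddChar.map_add_eq_mul]
        congr 1; ring
    by_contra h0
    exact hne (mul_right_cancel₀ h0 (by rw [one_mul]; exact key.symm))

lemma sum_addChar_coset (he : ∀ u, e u = 1 → u = 0) {k : ℕ} (hk : k ∣ N) (j : ℕ) {v w : ZMod N}
    (hw : (k : ZMod N) * w = v) :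
    ∑ u ∈ Finset.univ.filter (fun u : ZMod N => (k : ZMod N) * u = v), e (j * u) =
      if k ∣ j then e (j * w) * k else 0 := by
  have h1 := sum_addChar_torsion e he hk j
  have : ∑ u ∈ Finset.univ.filter (fun u : ZMod N => (k : ZMod N) * u = v), e (j * u) =
      e (j * w) * ∑ u ∈ Finset.univ.filter (fun u : ZMod N => (k : ZMod N) * u = 0),
        e (j * u) := by
    rw [Finset.mul_sum]
    refine Finset.sum_bij (fun u _ => u - w) ?_ ?_ ?_ ?_
    · intro u hu
      rw [Finset.mem_filter] at hu ⊢
      exact ⟨Finset.mem_univ _, by rw [mul_sub, hu.2, hw, sub_self]⟩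
    · intro u _ v _ h
      exact sub_left_injective h
    · intro u hu
      rw [Finset.mem_filter] at hu
      exact ⟨u + w, by rw [Finset.mem_filter]; exact ⟨Finset.mem_univ _, by
        rw [mul_add, hu.2, hw, zero_add]⟩, by ring⟩
    · intro u _
      rw [← AddChar.map_add_eq_mul]
      congr 1; ring
  rw [this, h1]
  split_ifs <;> simp

end Orthogonality

namespace Pres

variable {G : Type*} [Group G] (D : Pres G) {N : ℕ} [NeZero N]
  {L : Type*} [Field L] [CharZero L] (e : AddChar (ZMod N) L)

lemma exists_pair (hN : N = D.m * D.n) {z : ZMod N} (hz : (D.m : ZMod N) * z = 0) :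
    ∃ w : ZMod N, ((D.n / D.per N z : ℕ) : ZMod N) * w = (D.s : ZMod N) * z := by
  rw [← ZMod.natCast_zmod_val z, ← Nat.cast_mul, ZMod.natCast_eq_zero_iff] at hz
  obtain ⟨c, hc⟩ := (Nat.mul_dvd_mul_iff_left D.m_pos).1 ((dvd_of_eq hN.symm).trans hz)
  have hz' : (D.m : ZMod N) * z = 0 := by
    rw [← ZMod.natCast_zmod_val z, ← Nat.cast_mul, ZMod.natCast_eq_zero_iff]; exact hz
  obtain ⟨l, hl⟩ := D.per_dvd_n hz'
  refine ⟨((D.s * D.per N z * c : ℕ) : ZMod N), ?_⟩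
  have h2 : D.n / D.per N z = l := Nat.div_eq_of_eq_mul_right (D.per_pos hz') hl
  have h3 : z = ((D.n * c : ℕ) : ZMod N) := by rw [← hc, ZMod.natCast_zmod_val]
  rw [h2]
  conv_rhs => rw [h3]
  rw [← Nat.cast_mul, ← Nat.cast_mul]
  congr 1
  conv_rhs => rw [hl]
  ring

lemma sum_per_mul_theta (hN : N = D.m * D.n) (he : ∀ u, e u = 1 → u = 0) (g : G) :
    ∑ q ∈ (D.pairs N).toFinset, (D.per N q.1 : L) * D.theta e q g =
      if g = 1 then (N : L) else 0 := by
  obtain ⟨x, y, rfl⟩ := D.cover g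
  have hsum : ∀ f : ZMod N × ZMod N → L, ∑ q ∈ (D.pairs N).toFinset, f q =
      ∑ z ∈ Finset.univ.filter (fun z : ZMod N => (D.m : ZMod N) * z = 0),
        ∑ w ∈ Finset.univ.filter (fun w : ZMod N =>
          ((D.n / D.per N z : ℕ) : ZMod N) * w = (D.s : ZMod N) * z), f (z, w) := by
    intro f
    rw [Finset.sum_sigma']
    refine Finset.sum_bij' (fun q _ => ⟨q.1, q.2⟩) (fun q _ => (q.1, q.2)) ?_ ?_ ?_ ?_ ?_
    · intro q hq
      rw [Set.mem_toFinset] at hq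
      rw [Finset.mem_sigma, Finset.mem_filter, Finset.mem_filter]
      exact ⟨⟨Finset.mem_univ _, hq.1⟩, Finset.mem_univ _, hq.2⟩
    · intro q hq
      rw [Finset.mem_sigma, Finset.mem_filter, Finset.mem_filter] at hq
      rw [Set.mem_toFinset]
      exact ⟨hq.1.2, hq.2.2⟩
    · intros; rfl
    · intros; rfl
    · intros; rfl
  have hdn : ∀ z : ZMod N, (D.m : ZMod N) * z = 0 → D.n / D.per N z ∣ N := fun z hz =>
    (Nat.div_dvd_of_dvd (D.per_dvd_n hz)).trans ⟨D.m, by rw [hN, mul_comm]⟩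
  by_cases hy : D.n ∣ y
  · obtain ⟨k, rfl⟩ := hy
    rw [pow_mul, D.pow_n, ← pow_mul, ← pow_add]
    generalize x + D.s * k = x
    have h1 : ∀ z ∈ Finset.univ.filter (fun z : ZMod N => (D.m : ZMod N) * z = 0),
        ∑ w ∈ Finset.univ.filter (fun w : ZMod N =>
          ((D.n / D.per N z : ℕ) : ZMod N) * w = (D.s : ZMod N) * z),
          (D.per N (z, w).1 : L) * D.theta e (z, w) (D.a ^ x) = D.n * e (x * z) := by
      intro z hz
      replace hz := (Finset.mem_filter.1 hz).2
      obtain ⟨w, hw⟩ := D.exists_pair hN hz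
      have h2 := sum_addChar_coset e he (hdn z hz) 0 hw
      simp only [Nat.cast_zero, zero_mul, AddChar.map_zero_eq_one, dvd_zero, if_true,
        one_mul] at h2
      have h3 : ∀ w ∈ Finset.univ.filter (fun w : ZMod N =>
          ((D.n / D.per N z : ℕ) : ZMod N) * w = (D.s : ZMod N) * z),
          (D.per N (z, w).1 : L) * D.theta e (z, w) (D.a ^ x) =
            D.per N z * e (x * z) * 1 := by
        intro w hw
        rw [D.theta_a e ⟨hz, (Finset.mem_filter.1 hw).2⟩, mul_one]
      rw [Finset.sum_congr rfl h3, ← Finset.mul_sum, h2, mul_right_comm, ← Nat.cast_mul,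
        Nat.mul_div_cancel' (D.per_dvd_n hz)]
    rw [hsum, Finset.sum_congr rfl h1, ← Finset.mul_sum,
      sum_addChar_torsion e he ⟨D.n, hN⟩]
    have h4 : D.a ^ x = 1 ↔ D.m ∣ x := by rw [← D.order_a, orderOf_dvd_iff_pow_eq_one]
    simp only [h4]
    split_ifs
    · rw [← Nat.cast_mul, hN, mul_comm]
    · simp
  · have hg : D.a ^ x * D.b ^ y ≠ 1 := by
      intro h
      obtain ⟨k, hk, -⟩ := D.rep_eq (x := 0) (y := 0) (x' := x) (y' := y) (by simp [h])
        (Nat.zero_le _)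
      exact hy ⟨k, by omega⟩
    rw [if_neg hg, hsum]
    refine Finset.sum_eq_zero fun z hz => ?_
    replace hz := (Finset.mem_filter.1 hz).2
    obtain ⟨w, hw⟩ := D.exists_pair hN hz
    by_cases hd : D.per N z ∣ y
    · have h2 := sum_addChar_coset e he (hdn z hz) (y / D.per N z) hw
      rw [if_neg] at h2
      · have h3 : ∀ w ∈ Finset.univ.filter (fun w : ZMod N =>
            ((D.n / D.per N z : ℕ) : ZMod N) * w = (D.s : ZMod N) * z),
            (D.per N (z, w).1 : L) * D.theta e (z, w) (D.a ^ x * D.b ^ y) =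
              D.per N z * e (x * z) * e ((y / D.per N z : ℕ) * w) := by
          intro w hw
          rw [D.theta_apply e ⟨hz, (Finset.mem_filter.1 hw).2⟩, if_pos hd,
            AddChar.map_add_eq_mul, mul_assoc]
        rw [Finset.sum_congr rfl h3, ← Finset.mul_sum, h2, mul_zero]
      · intro h
        apply hy
        have := Nat.mul_dvd_mul_left (D.per N z) h
        rwa [Nat.mul_div_cancel' (D.per_dvd_n hz), Nat.mul_div_cancel' hd] at this
    · refine Finset.sum_eq_zero fun w hw => ?_
      rw [D.theta_apply e ⟨hz, (Finset.mem_filter.1 hw).2⟩, if_neg hd, mul_zero]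

variable [Fintype G]

lemma sum_per_mul_omega (hN : N = D.m * D.n) (he : ∀ u, e u = 1 → u = 0)
    (c : Subalgebra.center ℚ (MonoidAlgebra ℚ G)) :
    ∑ q : D.pairs N, (D.per N q.1.1 : L) * D.omega e he q.2 c =
      N * (((c : MonoidAlgebra ℚ G).coeff 1 : ℚ) : L) := by
  have h1 : ∑ q : D.pairs N, (D.per N q.1.1 : L) * D.omega e he q.2 c =
      ∑ q ∈ (D.pairs N).toFinset, (D.per N q.1 : L) * pairing (D.theta e q) c := by
    rw [Finset.sum_subtype (p := fun q => q ∈ D.pairs N) _ fun q => Set.mem_toFinset]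
    rfl
  rw [h1]
  simp only [pairing_apply, Finset.mul_sum]
  rw [Finset.sum_comm]
  have h2 : ∀ g : G, ∑ q ∈ (D.pairs N).toFinset, (D.per N q.1 : L) *
      ((((c : MonoidAlgebra ℚ G).coeff g : ℚ) : L) * D.theta e q g) =
      (((c : MonoidAlgebra ℚ G).coeff g : ℚ) : L) * if g = 1 then (N : L) else 0 := by
    intro g
    rw [← D.sum_per_mul_theta e hN he g, Finset.mul_sum]
    exact Finset.sum_congr rfl fun q _ => by ring
  rw [Finset.sum_congr rfl fun g _ => h2 g]
  simp [mul_comm]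

lemma card_fiber (he : ∀ u, e u = 1 → u = 0) (q : D.pairs N) :
    (Finset.univ.filter fun q' : D.pairs N => D.omega e he q'.2 = D.omega e he q.2).card =
      D.per N q.1.1 := by
  obtain ⟨⟨z, w⟩, hq⟩ := q
  rw [← Finset.card_range (D.per N z)]
  symm
  have hmem : ∀ j : ℕ, ((D.tau : ZMod N) ^ j * z, w) ∈ D.pairs N := by
    intro j
    refine ⟨?_, ?_⟩
    · have := hq.1
      simp only at this ⊢
      linear_combination ((D.tau : ZMod N) ^ j) * this
    · have h1 := hq.2
      have h2 := D.per_tau_pow_mul hq.1 j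
      simp only at h1 h2 ⊢
      rw [h2, h1]
      have h3 : ∀ j : ℕ, (D.tau : ZMod N) ^ j * (D.s * z) = D.s * z := by
        intro j
        induction j with
        | zero => simp
        | succ k ih =>
          have := D.cast_mul_eq_of_modEq hq.1 D.s_tau
          push_cast at this
          rw [pow_succ, mul_assoc, ← mul_assoc (D.tau : ZMod N), this, ih]
      rw [mul_left_comm, h3]
  refine Finset.card_bij (fun j _ => (⟨((D.tau : ZMod N) ^ j * z, w), hmem j⟩ : D.pairs N))
    ?_ ?_ ?_
  · intro j _
    rw [Finset.mem_filter]
    refine ⟨Finset.mem_univ _, ?_⟩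
    rw [eq_comm, D.omega_eq_iff e he]
    exact ⟨rfl, j, rfl⟩
  · intro i hi j hj h
    have h' : (D.tau : ZMod N) ^ i * z = (D.tau : ZMod N) ^ j * z :=
      congrArg (fun q : D.pairs N => q.1.1) h
    rw [Finset.mem_range] at hi hj
    have := Function.iterate_injOn_Iio_minimalPeriod (f := fun x => (D.tau : ZMod N) * x) (x := z)
      (Set.mem_Iio.2 hi) (Set.mem_Iio.2 hj)
    apply this
    simpa only [mul_left_iterate] using h'
  · rintro ⟨⟨z', w'⟩, hq'⟩ h
    rw [Finset.mem_filter, eq_comm, D.omega_eq_iff e he] at h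
    obtain ⟨-, h1, j, h2⟩ := h
    simp only at h1 h2
    refine ⟨j % D.per N z, Finset.mem_range.2 (Nat.mod_lt _ (D.per_pos hq.1)), ?_⟩
    refine Subtype.ext (Prod.ext ?_ h1.symm)
    change (D.tau : ZMod N) ^ _ * z = z'
    rw [h2]
    have := Function.iterate_mod_minimalPeriod_eq (f := fun x => (D.tau : ZMod N) * x) (x := z)
      (n := j)
    simp only [mul_left_iterate] at this
    exact this

end Pres

section Abstract

lemma sum_fiber_eq_sq {α M : Type*} [Fintype α] (Ω : α → M) (d : α → ℕ)
    (hd : ∀ q, (Finset.univ.filter fun r => Ω r = Ω q).card = d q) (ω : M) :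
    ∑ q ∈ Finset.univ.filter (fun r => Ω r = ω), d q =
      (Finset.univ.filter fun r => Ω r = ω).card ^ 2 := by
  rw [pow_two, ← smul_eq_mul, ← Finset.sum_const]
  refine Finset.sum_congr rfl fun q hq => ?_
  rw [← hd q, (Finset.mem_filter.1 hq).2]

lemma card_filter_eq_sum {α M : Type*} [Fintype α] (Ω : α → M) (d : α → ℕ)
    (hd : ∀ q, (Finset.univ.filter fun r => Ω r = Ω q).card = d q) (Q : M → Prop) (k : ℕ)
    (I : Finset M) (hI : ∀ q, Ω q ∈ I) :
    (Finset.univ.filter fun q => d q = k ∧ Q (Ω q)).card =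
      ∑ ω ∈ I, if (Finset.univ.filter fun r => Ω r = ω).card = k ∧ Q ω then
        (Finset.univ.filter fun r => Ω r = ω).card else 0 := by
  rw [Finset.card_eq_sum_card_fiberwise (f := Ω) (t := I) fun q _ => hI q]
  refine Finset.sum_congr rfl fun ω _ => ?_
  rw [Finset.filter_filter]
  split_ifs with h
  · congr 1
    ext q
    simp only [Finset.mem_filter, Finset.mem_univ, true_and, and_iff_right_iff_imp]
    rintro rfl
    exact ⟨by rw [← hd, h.1], h.2⟩
  · rw [Finset.card_eq_zero, Finset.filter_eq_empty_iff]
    rintro q - ⟨⟨h1, h2⟩, rfl⟩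
    exact h ⟨by rw [hd, h1], h2⟩

/-- Two weighted families with the same total, whose weights are the sizes of their fibers, have
the same statistics. -/
lemma card_filter_eq_of_fibers {α β M : Type*} [Fintype α] [Fintype β] (Ω : α → M) (Ω' : β → M)
    (d : α → ℕ) (d' : β → ℕ)
    (hd : ∀ q, (Finset.univ.filter fun r => Ω r = Ω q).card = d q)
    (hd' : ∀ q, (Finset.univ.filter fun r => Ω' r = Ω' q).card = d' q)
    (h : ∀ ω, ∑ q ∈ Finset.univ.filter (fun r => Ω r = ω), d q =
      ∑ q ∈ Finset.univ.filter (fun r => Ω' r = ω), d' q) (Q : M → Prop) (k : ℕ) :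
    (Finset.univ.filter fun q => d q = k ∧ Q (Ω q)).card =
      (Finset.univ.filter fun q => d' q = k ∧ Q (Ω' q)).card := by
  have hc : ∀ ω, (Finset.univ.filter fun r => Ω r = ω).card =
      (Finset.univ.filter fun r => Ω' r = ω).card := by
    intro ω
    have := h ω
    rw [sum_fiber_eq_sq Ω d hd, sum_fiber_eq_sq Ω' d' hd'] at this
    exact Nat.pow_left_injective two_ne_zero this
  rw [card_filter_eq_sum Ω d hd Q k (Finset.univ.image Ω ∪ Finset.univ.image Ω')
    fun q => Finset.mem_union_left _ (Finset.mem_image_of_mem _ (Finset.mem_univ _)),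
    card_filter_eq_sum Ω' d' hd' Q k (Finset.univ.image Ω ∪ Finset.univ.image Ω')
    fun q => Finset.mem_union_right _ (Finset.mem_image_of_mem _ (Finset.mem_univ _))]
  simp only [hc]

end Abstract

section Trace

variable {G H : Type*} [Group G] [Group H] [Fintype G] [Fintype H]

lemma trace_mulLeft (c : MonoidAlgebra ℚ G) :
    LinearMap.trace ℚ _ (LinearMap.mulLeft ℚ c) = Fintype.card G * c.coeff 1 := by
  rw [LinearMap.trace_eq_matrix_trace ℚ (MonoidAlgebra.basis G ℚ), Matrix.trace]
  have : ∀ g : G, (LinearMap.toMatrix (MonoidAlgebra.basis G ℚ) (MonoidAlgebra.basis G ℚ)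
      (LinearMap.mulLeft ℚ c)).diag g = c.coeff 1 := by
    intro g
    rw [Matrix.diag_apply, LinearMap.toMatrix_apply, MonoidAlgebra.basis_apply,
      LinearMap.mulLeft_apply]
    change (c * MonoidAlgebra.single g 1).coeff g = _
    rw [MonoidAlgebra.coeff_mul_single_apply, mul_one, mul_inv_cancel]
  rw [Finset.sum_congr rfl fun g _ => this g]
  simp

lemma card_eq_of_algEquiv (φ : MonoidAlgebra ℚ G ≃ₐ[ℚ] MonoidAlgebra ℚ H) :
    Fintype.card G = Fintype.card H := by
  have := φ.toLinearEquiv.finrank_eq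
  rwa [Module.finrank_eq_card_basis (MonoidAlgebra.basis G ℚ),
    Module.finrank_eq_card_basis (MonoidAlgebra.basis H ℚ)] at this

lemma coeff_one_of_algEquiv (φ : MonoidAlgebra ℚ G ≃ₐ[ℚ] MonoidAlgebra ℚ H)
    (c : MonoidAlgebra ℚ G) : (φ c).coeff 1 = c.coeff 1 := by
  have h1 := LinearMap.trace_conj' (LinearMap.mulLeft ℚ c) φ.toLinearEquiv
  have h2 : φ.toLinearEquiv.conj (LinearMap.mulLeft ℚ c) = LinearMap.mulLeft ℚ (φ c) := by
    ext x
    simp [LinearEquiv.conj_apply]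
  rw [h2, trace_mulLeft, trace_mulLeft, ← card_eq_of_algEquiv φ] at h1
  have : (Fintype.card G : ℚ) ≠ 0 := by simp
  exact mul_left_cancel₀ this h1

end Trace

lemma exists_addChar_of_isCyclotomicExtension (N : ℕ) [NeZero N] (L : Type*) [Field L]
    [Algebra ℚ L] [IsCyclotomicExtension {N} ℚ L] : ∃ e : AddChar (ZMod N) L,
    (∀ u, e u = 1 → u = 0) ∧ ∀ t : ℕ, N.Coprime t →
      ∃ σ : L →+* L, ∀ u, σ (e u) = e (t * u) := by
  have hζ := IsCyclotomicExtension.zeta_spec N ℚ L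
  set ζ := IsCyclotomicExtension.zeta N ℚ L with hζd
  have h2 : ∀ k : ℕ, AddChar.zmodChar N hζ.pow_eq_one (k : ZMod N) = ζ ^ k := by
    intro k
    rw [AddChar.zmodChar_apply, ZMod.val_natCast]
    conv_lhs => rw [hζ.eq_orderOf, pow_mod_orderOf]
  refine ⟨AddChar.zmodChar N hζ.pow_eq_one, ?_, ?_⟩
  · intro u hu
    rw [AddChar.zmodChar_apply, hζ.pow_eq_one_iff_dvd] at hu
    have := Nat.eq_zero_of_dvd_of_lt hu (ZMod.val_lt u)
    exact (ZMod.val_eq_zero u).1 this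
  · intro t ht
    have hμ : IsPrimitiveRoot (ζ ^ t) N := hζ.pow_of_coprime t ht.symm
    refine ⟨(IsCyclotomicExtension.fromZetaAut hμ
      (Polynomial.cyclotomic.irreducible_rat (NeZero.pos N)) : _ ≃ₐ[ℚ] _), ?_⟩
    intro u
    have h1 := IsCyclotomicExtension.fromZetaAut_spec hμ
      (Polynomial.cyclotomic.irreducible_rat (NeZero.pos N))
    rw [← ZMod.natCast_zmod_val u, ← Nat.cast_mul, h2, h2, pow_mul]
    exact (map_pow _ _ _).trans (congrArg (· ^ u.val) h1)

lemma exists_addChar (N : ℕ) [NeZero N] : ∃ e : AddChar (ZMod N) (CyclotomicField N ℚ),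
    (∀ u, e u = 1 → u = 0) ∧ ∀ t : ℕ, N.Coprime t →
      ∃ σ : CyclotomicField N ℚ →+* CyclotomicField N ℚ, ∀ u, σ (e u) = e (t * u) := by
  have : NeZero ((N : ℕ) : ℚ) := ⟨Nat.cast_ne_zero.2 (NeZero.ne N)⟩
  let := CyclotomicField.algebra N ℚ
  have := CyclotomicField.isCyclotomicExtension N ℚ
  exact exists_addChar_of_isCyclotomicExtension N (CyclotomicField N ℚ)

namespace Pres

variable {G : Type*} [Group G] [Fintype G] (D : Pres G) {N : ℕ} [NeZero N]
  {L : Type*} [Field L] [CharZero L] (e : AddChar (ZMod N) L)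

lemma per_mul {t : ℕ} (ht : N.Coprime t) (z : ZMod N) : D.per N (t * z) = D.per N z := by
  have hu : IsUnit (t : ZMod N) := (ZMod.isUnit_iff_coprime t N).2 ht.symm
  apply Nat.dvd_antisymm
  · rw [D.per_dvd_iff, mul_left_comm, D.per_dvd_iff.1 dvd_rfl]
  · rw [D.per_dvd_iff]
    have := (D.per_dvd_iff (z := (t : ZMod N) * z)).1 dvd_rfl
    rw [mul_left_comm] at this
    exact hu.mul_left_cancel this

lemma mul_mem_pairs {t : ℕ} (ht : N.Coprime t) {q : ZMod N × ZMod N} (hq : q ∈ D.pairs N) :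
    (t * q.1, t * q.2) ∈ D.pairs N := by
  have h1 := hq.1
  have h2 := hq.2
  refine ⟨?_, ?_⟩
  · simp only; rw [mul_left_comm, h1, mul_zero]
  · simp only; rw [D.per_mul ht, mul_left_comm, h2]; ring

lemma map_omega (he : ∀ u, e u = 1 → u = 0) {t : ℕ} (ht : N.Coprime t) (σ : L →+* L)
    (hσ : ∀ u, σ (e u) = e (t * u)) {q : ZMod N × ZMod N} (hq : q ∈ D.pairs N)
    (c : Subalgebra.center ℚ (MonoidAlgebra ℚ G)) :
    σ (D.omega e he hq c) = D.omega e he (D.mul_mem_pairs ht hq) c := by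
  rw [omega_apply, omega_apply, pairing_apply, pairing_apply, map_sum]
  refine Finset.sum_congr rfl fun g _ => ?_
  rw [map_mul, map_ratCast]
  congr 1
  obtain ⟨x, y, rfl⟩ := D.cover g
  rw [D.theta_apply e hq, D.theta_apply e (D.mul_mem_pairs ht hq)]
  simp only [D.per_mul ht]
  split_ifs
  · rw [hσ]; congr 1; ring
  · simp

/-- The pairs with a given orbit length whose central characters are fixed by a Galois
automorphism. -/
def fixedPairs (D : Pres G) (N d t : ℕ) : Set (ZMod N × ZMod N) :=
  {q | q ∈ D.pairs N ∧ D.per N q.1 = d ∧ (t : ZMod N) * q.2 = q.2 ∧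
    ∃ j : ℕ, (t : ZMod N) * q.1 = (D.tau : ZMod N) ^ j * q.1}

lemma ncard_fixedPairs (d t : ℕ) : (D.fixedPairs N d t).ncard =
    (Finset.univ.filter fun q : D.pairs N => D.per N q.1.1 = d ∧ ((t : ZMod N) * q.1.2 = q.1.2 ∧
      ∃ j : ℕ, (t : ZMod N) * q.1.1 = (D.tau : ZMod N) ^ j * q.1.1)).card := by
  rw [← Set.ncard_coe_finset, ← Set.ncard_image_of_injective _ Subtype.val_injective]
  congr 1
  ext q
  simp [fixedPairs]
  tauto

lemma ncard_fixedPairs_eq {H : Type*} [Group H] [Fintype H] (D' : Pres H)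
    (φ : MonoidAlgebra ℚ G ≃ₐ[ℚ] MonoidAlgebra ℚ H) (hN : N = D.m * D.n) (hN' : N = D'.m * D'.n)
    (d : ℕ) {t : ℕ} (ht : N.Coprime t) :
    (D.fixedPairs N d t).ncard = (D'.fixedPairs N d t).ncard := by
  obtain ⟨e, he, hσ⟩ := exists_addChar N
  obtain ⟨σ, hσ⟩ := hσ t ht
  have hmem : ∀ c : MonoidAlgebra ℚ G, c ∈ Subalgebra.center ℚ (MonoidAlgebra ℚ G) ↔
      φ c ∈ Subalgebra.center ℚ (MonoidAlgebra ℚ H) := by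
    intro c
    simp only [Subalgebra.mem_center_iff]
    constructor
    · intro h x
      have := congrArg φ (h (φ.symm x))
      simpa using this
    · intro h x
      apply φ.injective
      rw [map_mul, map_mul, h]
  let ψ : Subalgebra.center ℚ (MonoidAlgebra ℚ G) →* Subalgebra.center ℚ (MonoidAlgebra ℚ H) :=
    { toFun := fun c => ⟨φ c, (hmem c).1 c.2⟩
      map_one' := by ext1; simp
      map_mul' := by intro x y; ext1; simp }
  have hψ : Function.Surjective ψ := by
    intro c
    refine ⟨⟨φ.symm c, (hmem _).2 (by simp)⟩, ?_⟩
    ext1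
    simp [ψ]
  let Ω : D.pairs N → (Subalgebra.center ℚ (MonoidAlgebra ℚ G) →* CyclotomicField N ℚ) :=
    fun q => D.omega e he q.2
  let Ω' : D'.pairs N → (Subalgebra.center ℚ (MonoidAlgebra ℚ G) →* CyclotomicField N ℚ) :=
    fun q => (D'.omega e he q.2).comp ψ
  have hΩ' : ∀ q r, Ω' q = Ω' r ↔ D'.omega e he q.2 = D'.omega e he r.2 := fun q r =>
    MonoidHom.cancel_right hψ
  have hsum : ∀ c, ∑ q, (D.per N q.1.1 : CyclotomicField N ℚ) * Ω q c =
      ∑ q, (D'.per N q.1.1 : CyclotomicField N ℚ) * Ω' q c := by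
    intro c
    rw [D.sum_per_mul_omega e hN he c]
    refine Eq.trans ?_ (D'.sum_per_mul_omega e hN' he (ψ c)).symm
    change _ = (N : CyclotomicField N ℚ) * (((φ c).coeff 1 : ℚ) : CyclotomicField N ℚ)
    rw [coeff_one_of_algEquiv]
  have hlin := linearIndependent_monoidHom (Subalgebra.center ℚ (MonoidAlgebra ℚ G))
    (CyclotomicField N ℚ)
  have hf : (∑ q, Finsupp.single (Ω q) (D.per N q.1.1 : CyclotomicField N ℚ)) =
      ∑ q, Finsupp.single (Ω' q) (D'.per N q.1.1 : CyclotomicField N ℚ) := by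
    apply hlin
    rw [map_sum, map_sum]
    ext c
    simpa [Finsupp.linearCombination_single] using hsum c
  have hw : ∀ ω, ∑ q ∈ Finset.univ.filter (fun r => Ω r = ω), D.per N q.1.1 =
      ∑ q ∈ Finset.univ.filter (fun r => Ω' r = ω), D'.per N q.1.1 := by
    intro ω
    have := DFunLike.congr_fun hf ω
    rw [Finsupp.finsetSum_apply, Finsupp.finsetSum_apply] at this
    simp only [Finsupp.single_apply] at this
    rw [← Finset.sum_filter, ← Finset.sum_filter] at this
    exact_mod_cast this
  have hfix : ∀ q : D.pairs N, ((t : ZMod N) * q.1.2 = q.1.2 ∧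
      ∃ j : ℕ, (t : ZMod N) * q.1.1 = (D.tau : ZMod N) ^ j * q.1.1) ↔ ∀ c, σ (Ω q c) = Ω q c := by
    intro q
    rw [← D.omega_eq_iff e he q.2 (D.mul_mem_pairs ht q.2), eq_comm]
    simp only [Ω, D.map_omega e he ht σ hσ, DFunLike.ext_iff]
  have hfix' : ∀ q : D'.pairs N, ((t : ZMod N) * q.1.2 = q.1.2 ∧
      ∃ j : ℕ, (t : ZMod N) * q.1.1 = (D'.tau : ZMod N) ^ j * q.1.1) ↔
      ∀ c, σ (Ω' q c) = Ω' q c := by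
    intro q
    rw [← D'.omega_eq_iff e he q.2 (D'.mul_mem_pairs ht q.2), eq_comm]
    simp only [Ω', MonoidHom.comp_apply, D'.map_omega e he ht σ hσ, DFunLike.ext_iff]
    exact ⟨fun h c => h _, fun h c => by obtain ⟨c, rfl⟩ := hψ c; exact h c⟩
  have hcount := card_filter_eq_of_fibers Ω Ω' (fun q => D.per N q.1.1) (fun q => D'.per N q.1.1)
    (fun q => D.card_fiber e he q) (fun q => by simp only [hΩ']; exact D'.card_fiber e he q) hw
    (fun ω => ∀ c, σ (ω c) = ω c) d
  simp only [← hfix, ← hfix'] at hcount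
  rw [ncard_fixedPairs, ncard_fixedPairs]
  exact hcount

end Pres

section Involutions

variable {G H : Type*} [Group G] [Group H] [Fintype G] [Fintype H]

/-- The functions on `G` which satisfy `x g⁻¹ = ε x g`. -/
def symFun (G : Type*) [Group G] (ε : ℚ) : Submodule ℚ (G → ℚ) where
  carrier := {x | ∀ g, x g⁻¹ = ε * x g}
  add_mem' hx hy g := by rw [Pi.add_apply, Pi.add_apply, hx g, hy g, mul_add]
  zero_mem' g := by simp
  smul_mem' c x hx g := by rw [Pi.smul_apply, Pi.smul_apply, hx g, smul_eq_mul, smul_eq_mul]; ring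

lemma trace_funLeft_inv :
    LinearMap.trace ℚ _ (LinearMap.funLeft ℚ ℚ (fun g : G => g⁻¹)) =
      (Finset.univ.filter fun g : G => g * g = 1).card := by
  rw [LinearMap.trace_eq_matrix_trace ℚ (Pi.basisFun ℚ G), Matrix.trace, Finset.card_filter,
    Nat.cast_sum]
  refine Finset.sum_congr rfl fun g _ => ?_
  rw [Matrix.diag_apply, LinearMap.toMatrix_apply]
  simp only [Pi.basisFun_apply, Pi.basisFun_repr, LinearMap.funLeft_apply, Pi.single_apply,
    inv_eq_iff_mul_eq_one, Nat.cast_ite, Nat.cast_one, Nat.cast_zero]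

lemma two_mul_finrank_symFun {ε : ℚ} (hε : ε * ε = 1) :
    (2 * Module.finrank ℚ (symFun G ε) : ℚ) =
      Fintype.card G + ε * (Finset.univ.filter fun g : G => g * g = 1).card := by
  have h : LinearMap.IsProj (symFun G ε) ((2⁻¹ : ℚ) • (LinearMap.id + ε •
      LinearMap.funLeft ℚ ℚ (fun g : G => g⁻¹))) := by
    constructor
    · intro x g
      simp only [LinearMap.smul_apply, LinearMap.add_apply, LinearMap.id_apply, Pi.smul_apply,
        Pi.add_apply, LinearMap.funLeft_apply, smul_eq_mul, inv_inv]
      linear_combination (-2⁻¹ * x g⁻¹) * hε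
    · intro x hx
      funext g
      simp only [LinearMap.smul_apply, LinearMap.add_apply, LinearMap.id_apply, Pi.smul_apply,
        Pi.add_apply, LinearMap.funLeft_apply, smul_eq_mul, hx g]
      linear_combination (2⁻¹ * x g) * hε
  have := h.trace
  rw [map_smul, map_add, map_smul, trace_funLeft_inv, LinearMap.trace_id, Module.finrank_fintype_fun_eq_card,
    smul_eq_mul, smul_eq_mul] at this
  rw [← this]
  ring

lemma card_sq_eq_one_le (T : (G → ℚ) ≃ₗ[ℚ] (H → ℚ))
    (hT : ∀ x, ∑ h, T x h * T x h⁻¹ = ∑ g, x g * x g⁻¹) :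
    (Finset.univ.filter fun g : G => g * g = 1).card ≤
      (Finset.univ.filter fun g : H => g * g = 1).card := by
  have hc : Fintype.card G = Fintype.card H := by simpa using T.finrank_eq
  have hdis : Disjoint ((symFun G 1).map T.toLinearMap) (symFun H (-1)) := by
    rw [Submodule.disjoint_def]
    rintro _ ⟨x, hx, rfl⟩ hy
    have hx' : ∀ g, x g⁻¹ = 1 * x g := hx
    have hy' : ∀ g, T x g⁻¹ = -1 * T x g := hy
    have h := hT x
    simp only [hx', hy'] at h
    have h1 : 0 ≤ ∑ g, T x g * T x g := Finset.sum_nonneg fun g _ => mul_self_nonneg _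
    have h2 : ∑ h, T x h * (-1 * T x h) = - ∑ g, T x g * T x g := by
      rw [← Finset.sum_neg_distrib]
      exact Finset.sum_congr rfl fun g _ => by ring
    have h3 : ∑ g, x g * (1 * x g) = ∑ g, x g * x g :=
      Finset.sum_congr rfl fun g _ => by ring
    have h4 : 0 ≤ ∑ g, x g * x g := Finset.sum_nonneg fun g _ => mul_self_nonneg _
    have h5 : ∑ g, x g * x g = 0 := by linarith
    rw [Finset.sum_eq_zero_iff_of_nonneg fun g _ => mul_self_nonneg _] at h5
    have : x = 0 := by
      funext g
      exact mul_self_eq_zero.1 (h5 g (Finset.mem_univ _))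
    rw [this, map_zero]
  have h := Submodule.finrank_add_finrank_le_of_disjoint hdis
  rw [show Module.finrank ℚ ((symFun G 1).map T.toLinearMap) = Module.finrank ℚ (symFun G 1) from
    LinearEquiv.finrank_map_eq T _, Module.finrank_fintype_fun_eq_card] at h
  have h1 := two_mul_finrank_symFun (G := G) (ε := 1) (by norm_num)
  have h2 := two_mul_finrank_symFun (G := H) (ε := -1) (by norm_num)
  rw [hc] at h1
  have h3 : (Module.finrank ℚ (symFun G 1) : ℚ) + Module.finrank ℚ (symFun H (-1)) ≤
    Fintype.card H := by exact_mod_cast h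
  have : ((Finset.univ.filter fun g : G => g * g = 1).card : ℚ) ≤
      (Finset.univ.filter fun g : H => g * g = 1).card := by linarith
  exact_mod_cast this

lemma coeff_one_mul_self (x : MonoidAlgebra ℚ G) :
    (x * x).coeff 1 = ∑ g, x.coeff g * x.coeff g⁻¹ := by
  rw [MonoidAlgebra.coeff_mul_apply_left, Finsupp.sum_fintype _ _ (by simp)]
  simp

/-- The elements of the rational group algebra as functions. -/
def coeffFun (G : Type*) [Group G] [Fintype G] : MonoidAlgebra ℚ G ≃ₗ[ℚ] (G → ℚ) :=
  (MonoidAlgebra.coeffLinearEquiv ℚ).trans (Finsupp.linearEquivFunOnFinite ℚ ℚ G)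

lemma card_sq_eq_one_le_of_algEquiv (φ : MonoidAlgebra ℚ G ≃ₐ[ℚ] MonoidAlgebra ℚ H) :
    (Finset.univ.filter fun g : G => g * g = 1).card ≤
      (Finset.univ.filter fun g : H => g * g = 1).card := by
  apply card_sq_eq_one_le (((coeffFun G).symm.trans φ.toLinearEquiv).trans (coeffFun H))
  intro x
  obtain ⟨y, rfl⟩ := (coeffFun G).surjective x
  have h1 := coeff_one_mul_self y
  have h2 := coeff_one_mul_self (φ y)
  rw [← map_mul, coeff_one_of_algEquiv, h1] at h2
  simpa [coeffFun] using h2.symm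

/-- The number of solutions of `g ^ 2 = 1` is determined by the rational group algebra. -/
lemma card_sq_eq_one_of_algEquiv (φ : MonoidAlgebra ℚ G ≃ₐ[ℚ] MonoidAlgebra ℚ H) :
    (Finset.univ.filter fun g : G => g * g = 1).card =
      (Finset.univ.filter fun g : H => g * g = 1).card :=
  le_antisymm (card_sq_eq_one_le_of_algEquiv φ) (card_sq_eq_one_le_of_algEquiv φ.symm)

end Involutions

namespace Pres

variable {G : Type*} [Group G] (D : Pres G)

lemma normal_zpowers [Finite G] : (Subgroup.zpowers D.a).Normal := by
  constructor
  rintro _ ⟨k, rfl⟩ g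
  obtain ⟨k', hk'⟩ : ∃ k' : ℕ, D.a ^ k' = D.a ^ k :=
    (mem_powers_iff_mem_zpowers (x := D.a)).2 ⟨k, rfl⟩
  obtain ⟨x, y, rfl⟩ := D.cover g
  refine ⟨(D.tau ^ y * k' : ℕ), ?_⟩
  change D.a ^ ((D.tau ^ y * k' : ℕ) : ℤ) = D.a ^ x * D.b ^ y * D.a ^ k * (D.a ^ x * D.b ^ y)⁻¹
  rw [← hk', mul_assoc (D.a ^ x), D.pow_conj, eq_mul_inv_iff_mul_eq, ← mul_assoc, ← mul_assoc,
    zpow_natCast, ← pow_add, ← pow_add, add_comm]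

/-- The metacyclic factorization of a presentation. -/
def toFact [Finite G] : MetacyclicFact G where
  A := Subgroup.zpowers D.a
  B := Subgroup.zpowers D.b
  normalA := D.normal_zpowers
  cyclicA := inferInstance
  cyclicB := inferInstance
  mul_cover g := by
    obtain ⟨x, y, rfl⟩ := D.cover g
    exact ⟨_, pow_mem (Subgroup.mem_zpowers _) _, _, pow_mem (Subgroup.mem_zpowers _) _, rfl⟩

lemma card_zpowers_a : Nat.card (Subgroup.zpowers D.a) = D.m := by
  rw [Nat.card_zpowers, D.order_a]

lemma index_zpowers_b [Finite G] : (Subgroup.zpowers D.b).index = D.m.gcd D.s := by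
  have h1 : orderOf (D.b ^ D.n) = D.m / D.m.gcd D.s := by
    rw [D.pow_n, orderOf_pow, D.order_a]
  have h2 : D.n ∣ orderOf D.b := D.dvd_of_mem _ (by rw [pow_orderOf_eq_one]; exact one_mem _)
  rw [orderOf_pow_of_dvd D.n_pos.ne' h2] at h1
  have h3 := (Subgroup.zpowers D.b).card_mul_index
  rw [Nat.card_zpowers, D.card_eq] at h3
  obtain ⟨k, hk⟩ := h2
  obtain ⟨l, hl⟩ := D.m.gcd_dvd_left D.s
  have hg : 0 < D.m.gcd D.s := Nat.gcd_pos_of_pos_left _ D.m_pos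
  rw [hk, Nat.mul_div_cancel_left _ D.n_pos] at h1
  have h4 : k = l := h1.trans (Nat.div_eq_of_eq_mul_right hg hl)
  subst h4
  have hk0 : 0 < k := by
    rcases Nat.eq_zero_or_pos k with h | h
    · rw [h, mul_zero] at hl
      exact absurd hl D.m_pos.ne'
    · exact h
  rw [hk] at h3
  conv_rhs at h3 => rw [hl]
  have : D.n * k * (Subgroup.zpowers D.b).index = D.n * k * (D.m.gcd D.s) := by
    rw [h3]; ring
  exact Nat.eq_of_mul_eq_mul_left (Nat.mul_pos D.n_pos hk0) this

/-- Replacing `tau` by a congruent number. -/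
def setTau (τ : ℕ) (h : τ ≡ D.tau [MOD D.m]) : Pres G :=
  { D with
    tau := τ
    conj := by rw [D.conj, D.pow_a_eq_iff.2 h] }

lemma mul_pow_eq (c k : ℕ) : (D.a ^ c * D.b) ^ k =
    D.a ^ (c * ∑ i ∈ Finset.range k, D.tau ^ i) * D.b ^ k := by
  induction k with
  | zero => simp
  | succ k ih =>
    have := D.mul_eq (c * ∑ i ∈ Finset.range k, D.tau ^ i) k c 1
    rw [pow_one] at this
    rw [pow_succ, ih, this, Finset.sum_range_succ]
    congr 2
    ring

/-- Replacing `b` by `a ^ c * b`. -/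
def twist (c : ℕ) : Pres G :=
  { D with
    b := D.a ^ c * D.b
    s := D.s + c * ∑ i ∈ Finset.range D.n, D.tau ^ i
    conj := by
      rw [mul_assoc, D.conj, ← mul_assoc, ← mul_assoc, ← pow_add, ← pow_add, add_comm]
    pow_n := by rw [mul_pow_eq, D.pow_n, ← pow_add, add_comm]
    dvd_of_mem := by
      intro y hy
      rw [mul_pow_eq] at hy
      exact D.dvd_of_mem y ((Subgroup.mul_mem_cancel_left _
        (pow_mem (Subgroup.mem_zpowers _) _)).1 hy)
    cover := by
      intro g
      obtain ⟨x, y, rfl⟩ := D.cover g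
      obtain ⟨j, hj⟩ : ∃ j, x ≡ j + c * ∑ i ∈ Finset.range y, D.tau ^ i [MOD D.m] := by
        refine ⟨x + (D.m - 1) * (c * ∑ i ∈ Finset.range y, D.tau ^ i), ?_⟩
        rw [add_assoc, ← Nat.succ_mul, Nat.succ_eq_add_one, Nat.sub_add_cancel D.m_pos]
        exact (Nat.modEq_iff_dvd' (by omega)).2 (by simp)
      refine ⟨j, y, ?_⟩
      rw [mul_pow_eq, ← mul_assoc, ← pow_add, D.pow_a_eq_iff.2 hj] }

end Pres

lemma exists_pres {G : Type*} [Group G] [Finite G] (f : MetacyclicFact G) :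
    ∃ D : Pres G, Subgroup.zpowers D.a = f.A ∧ D.s = f.B.index ∧ D.s ∣ D.m := by
  have := f.normalA
  have := f.cyclicA
  have := f.cyclicB
  obtain ⟨a₀, ha₀⟩ := (Subgroup.isCyclic_iff_exists_zpowers_eq_top f.A).1 f.cyclicA
  obtain ⟨b, hb⟩ := (Subgroup.isCyclic_iff_exists_zpowers_eq_top f.B).1 f.cyclicB
  set m := orderOf a₀ with hm
  have hm0 : 0 < m := orderOf_pos a₀
  have : NeZero m := ⟨hm0.ne'⟩
  set n := f.A.index with hn
  have hn0 : 0 < n := Nat.pos_of_ne_zero Subgroup.index_ne_zero_of_finite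
  have hmemA : ∀ g ∈ f.A, ∃ k : ℕ, a₀ ^ k = g := fun g hg => by
    rw [← ha₀] at hg
    exact (mem_powers_iff_mem_zpowers (x := a₀)).2 hg
  obtain ⟨k, hk⟩ := hmemA (b ^ n) (Subgroup.pow_index_mem f.A b)
  obtain ⟨d, hd, u, hu, hku⟩ := ZMod.eq_unit_mul_divisor (k : ZMod m)
  have hcop : u.val.Coprime m := by
    rw [← ZMod.isUnit_iff_coprime, ZMod.natCast_zmod_val]
    exact hu
  have hgen : Subgroup.zpowers (a₀ ^ u.val) = f.A := by
    rw [← ha₀]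
    apply le_antisymm
    · rw [Subgroup.zpowers_le]
      exact pow_mem (Subgroup.mem_zpowers _) _
    · rw [Subgroup.zpowers_le]
      obtain ⟨w, hw⟩ := exists_pow_eq_self_of_coprime (x := a₀) (n := u.val) hcop
      have := pow_mem (Subgroup.mem_zpowers (a₀ ^ u.val)) w
      rwa [hw] at this
  have hord : orderOf (a₀ ^ u.val) = m := by
    rw [← Nat.card_zpowers, hgen, ← ha₀, Nat.card_zpowers]
  have hconj : b * a₀ ^ u.val * b⁻¹ ∈ Subgroup.zpowers (a₀ ^ u.val) := by
    rw [hgen]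
    refine f.normalA.conj_mem _ ?_ b
    rw [← hgen]
    exact Subgroup.mem_zpowers _
  obtain ⟨τ, hτ⟩ := (mem_powers_iff_mem_zpowers (x := a₀ ^ u.val)).2 hconj
  have hcov : ∀ g : G, ∃ x y : ℕ, g = (a₀ ^ u.val) ^ x * b ^ y := by
    intro g
    obtain ⟨x, hx, y, hy, rfl⟩ := f.mul_cover g
    rw [← hgen] at hx
    rw [← hb] at hy
    obtain ⟨x', hx'⟩ := (mem_powers_iff_mem_zpowers (x := a₀ ^ u.val)).2 hx
    obtain ⟨y', hy'⟩ := (mem_powers_iff_mem_zpowers (x := b)).2 hy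
    exact ⟨x', y', by rw [← hx', ← hy']⟩
  have hdvd : ∀ y : ℕ, b ^ y ∈ Subgroup.zpowers (a₀ ^ u.val) → n ∣ y := by
    intro y hy
    rw [hgen] at hy
    have h1 : orderOf (b : G ⧸ f.A) = n := by
      rw [hn, Subgroup.index, ← Nat.card_zpowers]
      have : Subgroup.zpowers (b : G ⧸ f.A) = ⊤ := by
        rw [Subgroup.eq_top_iff']
        intro q
        obtain ⟨g, rfl⟩ := QuotientGroup.mk_surjective q
        obtain ⟨x, y, rfl⟩ := hcov g
        have : (((a₀ ^ u.val) ^ x * b ^ y : G) : G ⧸ f.A) = (b : G ⧸ f.A) ^ y := by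
          rw [QuotientGroup.mk_mul, (QuotientGroup.eq_one_iff _).2, one_mul, QuotientGroup.mk_pow]
          rw [← hgen]
          exact pow_mem (Subgroup.mem_zpowers _) _
        rw [this]
        exact pow_mem (Subgroup.mem_zpowers _) _
      rw [this, Subgroup.card_top]
    rw [← h1, orderOf_dvd_iff_pow_eq_one, ← QuotientGroup.mk_pow]
    exact (QuotientGroup.eq_one_iff _).2 hy
  let D : Pres G :=
    { a := a₀ ^ u.val
      b := b
      m := m
      n := n
      s := d
      tau := τ
      m_pos := hm0
      n_pos := hn0
      order_a := hord
      conj := by rw [← mul_inv_eq_iff_eq_mul]; exact hτ.symm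
      pow_n := by
        rw [← hk, ← pow_mul, pow_eq_pow_iff_modEq, ← hm, ← ZMod.natCast_eq_natCast_iff, hku]
        push_cast
        rw [ZMod.natCast_zmod_val]
      dvd_of_mem := hdvd
      cover := hcov
      card_eq := by rw [hm, ← Nat.card_zpowers, ha₀, hn, Subgroup.card_mul_index] }
  refine ⟨D, hgen, ?_, hd⟩
  rw [← hb, show b = D.b from rfl, D.index_zpowers_b]
  exact (Nat.gcd_eq_right hd).symm

section Geom

lemma geom_mul_sub_one {τ : ℕ} (h : 1 < τ) (n : ℕ) :
    (∑ i ∈ Finset.range n, τ ^ i) * (τ - 1) = τ ^ n - 1 := by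
  rw [Nat.geomSum_eq h, Nat.div_mul_cancel]
  simpa using Nat.sub_dvd_pow_sub_pow τ 1 n

lemma geom_ne_zero {τ n : ℕ} (h : 1 < τ) (hn : 0 < n) : ∑ i ∈ Finset.range n, τ ^ i ≠ 0 := by
  intro h0
  have := geom_mul_sub_one h n
  rw [h0, zero_mul] at this
  have := Nat.one_lt_pow hn.ne' h
  omega

lemma not_dvd_of_dvd_sub_one {p τ : ℕ} (hp : p.Prime) (h : 1 < τ) (h1 : p ∣ τ - 1) : ¬ p ∣ τ := by
  intro h2
  have := (Nat.dvd_sub_iff_right h.le h2).1 h1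
  exact hp.one_lt.ne' (Nat.dvd_one.1 this)

lemma not_dvd_geom {p τ : ℕ} (h : 1 < τ) (h1 : p ∣ τ - 1) {k : ℕ} (hk : ¬ p ∣ k) :
    ¬ p ∣ ∑ i ∈ Finset.range k, τ ^ i := by
  have h2 : ((τ : ℕ) : ZMod p) = 1 := by
    have := (ZMod.natCast_eq_zero_iff (τ - 1) p).2 h1
    rw [Nat.cast_sub h.le, Nat.cast_one, sub_eq_zero] at this
    exact this
  rw [← ZMod.natCast_eq_zero_iff] at hk ⊢
  push_cast
  rw [h2]
  simpa using hk

lemma pow_dvd_sub_one_of_pow {p x : ℕ} (hp : p.Prime) (h : 1 < x) (h1 : p ∣ x - 1) {k j : ℕ}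
    (hk : ¬ p ∣ k) (hj : p ^ j ∣ x ^ k - 1) : p ^ j ∣ x - 1 := by
  rw [← geom_mul_sub_one h] at hj
  exact Nat.Coprime.dvd_of_dvd_mul_left
    (Nat.Coprime.pow_left _ ((Nat.Prime.coprime_iff_not_dvd hp).2 (not_dvd_geom h h1 hk))) hj

lemma padicValNat_geom {p τ n : ℕ} [hp : Fact p.Prime] (h : 1 < τ) (hn : 0 < n) (h1 : p ∣ τ - 1)
    (h4 : p = 2 → 4 ∣ τ - 1) :
    padicValNat p (∑ i ∈ Finset.range n, τ ^ i) = padicValNat p n := by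
  have h2 : padicValNat p (τ ^ n - 1) = padicValNat p (τ - 1) + padicValNat p n := by
    have hnd := not_dvd_of_dvd_sub_one hp.out h h1
    have hlt := Nat.one_lt_pow hn.ne' h
    by_cases hp2 : p = 2
    · subst hp2
      have h3 := Int.two_pow_sub_pow' (x := (τ : ℤ)) (y := 1) n (by
        have := h4 rfl
        have : ((4 : ℕ) : ℤ) ∣ ((τ - 1 : ℕ) : ℤ) := Int.natCast_dvd_natCast.2 this
        rw [Nat.cast_sub h.le] at this
        exact_mod_cast this) (by exact_mod_cast hnd)
      have e1 : (τ : ℤ) ^ n - 1 ^ n = ((τ ^ n - 1 : ℕ) : ℤ) := by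
        rw [Nat.cast_sub hlt.le]; simp
      have e2 : (τ : ℤ) - 1 = ((τ - 1 : ℕ) : ℤ) := by
        rw [Nat.cast_sub h.le]; simp
      rw [e1, e2, show (2 : ℤ) = ((2 : ℕ) : ℤ) from rfl, Int.natCast_emultiplicity,
        Int.natCast_emultiplicity, Int.natCast_emultiplicity, ← padicValNat_eq_emultiplicity,
        ← padicValNat_eq_emultiplicity, ← padicValNat_eq_emultiplicity] at h3
      · exact_mod_cast h3
      all_goals omega
    · have := padicValNat.pow_sub_pow (hp.out.odd_of_ne_two hp2) h (by simpa using h1) hnd hn.ne'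
      simpa using this
  rw [← geom_mul_sub_one h, padicValNat.mul (geom_ne_zero h hn) (by omega)] at h2
  omega

lemma padicValNat_two_geom {τ n : ℕ} (h : 1 < τ) (hn : 0 < n) (h4 : 4 ∣ τ + 1) (hev : 2 ∣ n) :
    padicValNat 2 (∑ i ∈ Finset.range n, τ ^ i) + 1 =
      padicValNat 2 (τ + 1) + padicValNat 2 n := by
  have h3 := padicValNat.pow_two_sub_pow (x := τ) (y := 1) h (by omega) (by omega) hn.ne'
    (even_iff_two_dvd.2 hev)
  rw [one_pow, ← geom_mul_sub_one h, padicValNat.mul (geom_ne_zero h hn) (by omega)] at h3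
  omega

end Geom

/-- A presentation coming from a minimal factorization. -/
structure Good {G : Type*} [Group G] (D : Pres G) : Prop where
  s_dvd : D.s ∣ D.m
  one_lt_tau : 1 < D.tau
  mod_four : 2 ∣ D.m → ¬ 4 ∣ D.m → 4 ∣ D.tau - 1
  min_s : ∀ D' : Pres G, D'.a = D.a → D.s ≤ D'.m.gcd D'.s
  min_m : ∀ f : MetacyclicFact G, D.m ≤ Nat.card f.A

lemma Pres.tau_coprime {G : Type*} [Group G] (D : Pres G) : D.tau.Coprime D.m := by
  have h : (D.tau ^ D.n).Coprime D.m := by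
    rw [Nat.Coprime, D.tau_pow_n.gcd_eq, Nat.gcd_one_left]
  exact Nat.Coprime.coprime_dvd_left (dvd_pow_self _ D.n_pos.ne') h

lemma exists_good {G : Type*} [Group G] [Finite G] (f : MetacyclicFact G)
    (hf : IsMinimalFact f) : ∃ D : Pres G, Good D ∧ D.s = sOf f := by
  obtain ⟨D, hA, hs, hd⟩ := exists_pres f
  have hcop := D.tau_coprime
  have hm := D.m_pos
  obtain ⟨τ, hτ, h1, h2⟩ : ∃ τ, τ ≡ D.tau [MOD D.m] ∧ 1 < τ ∧
      (2 ∣ D.m → ¬ 4 ∣ D.m → 4 ∣ τ - 1) := by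
    by_cases h4 : D.tau % 4 = 1
    · refine ⟨D.tau + D.m * 4, by simp [Nat.ModEq], by omega, by omega⟩
    · refine ⟨D.tau + D.m * 5, by simp [Nat.ModEq], by omega, ?_⟩
      intro h5 h6
      have : ¬ 2 ∣ D.tau := fun h => by
        have := Nat.dvd_gcd h h5
        rw [hcop] at this
        omega
      omega
  have hmin : ∀ f' : MetacyclicFact G, f'.A = f.A → f.B.index ≤ f'.B.index := by
    intro f' hf'
    have := hf f'
    simp only [lex3, factTriple, hf'] at this
    omega
  have hmA : D.m = Nat.card f.A := by rw [← hA, D.card_zpowers_a]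
  refine ⟨D.setTau τ hτ, ⟨hd, h1, h2, ?_, ?_⟩, hs⟩
  · intro D' hD'
    change D.s ≤ _
    rw [hs, ← D'.index_zpowers_b]
    refine hmin D'.toFact ?_
    change Subgroup.zpowers D'.a = _
    rw [hD', ← hA]
    rfl
  · intro f'
    have := hf f'
    change D.m ≤ _
    simp only [lex3, factTriple] at this
    omega

namespace Good

variable {G : Type*} [Group G] {D : Pres G}

lemma s_dvd_geom (hD : Good D) : D.s ∣ ∑ i ∈ Finset.range D.n, D.tau ^ i := by
  rw [Nat.dvd_iff_prime_pow_dvd_dvd]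
  intro p k hp hk
  by_contra hnot
  set S := ∑ i ∈ Finset.range D.n, D.tau ^ i with hS
  set c := ordCompl[p] D.m with hc
  have hcp : ∀ j, (p ^ j).Coprime c := fun j =>
    Nat.Coprime.pow_left _ (Nat.coprime_ordCompl hp D.m_pos.ne')
  have hle : D.s ≤ D.m.gcd (D.s + c * S) := hD.min_s (D.twist c) rfl
  have hpk : ¬ p ^ k ∣ D.s + c * S := by
    intro h
    have h1 := (Nat.dvd_add_right hk).1 h
    exact hnot ((hcp k).dvd_of_dvd_mul_left h1)
  have hdvd : D.m.gcd (D.s + c * S) ∣ D.s := by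
    rw [Nat.dvd_iff_prime_pow_dvd_dvd]
    intro q j hq hj
    have hjm : q ^ j ∣ D.m := hj.trans (Nat.gcd_dvd_left _ _)
    have hjs : q ^ j ∣ D.s + c * S := hj.trans (Nat.gcd_dvd_right _ _)
    by_cases hqp : q = p
    · subst hqp
      refine (pow_dvd_pow q ?_).trans hk
      by_contra hlt
      exact hpk ((pow_dvd_pow q (by omega)).trans hjs)
    · have : q ^ j ∣ c := by
        have h1 : (q ^ j).Coprime (ordProj[p] D.m) :=
          Nat.Coprime.pow _ _ ((Nat.coprime_primes hq hp).2 hqp)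
        rw [← Nat.ordProj_mul_ordCompl_eq_self D.m p] at hjm
        exact h1.dvd_of_dvd_mul_left hjm
      exact (Nat.dvd_add_left (this.mul_right S)).1 hjs
  have hs0 : 0 < D.s := Nat.pos_of_dvd_of_pos hD.s_dvd D.m_pos
  have := le_antisymm hle (Nat.le_of_dvd hs0 hdvd)
  exact hpk (hk.trans ((dvd_of_eq this).trans (Nat.gcd_dvd_right _ _)))

lemma s_pos (hD : Good D) : 0 < D.s := Nat.pos_of_dvd_of_pos hD.s_dvd D.m_pos

lemma padicValNat_s_le_geom (hD : Good D) {p : ℕ} [hp : Fact p.Prime] :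
    padicValNat p D.s ≤ padicValNat p (∑ i ∈ Finset.range D.n, D.tau ^ i) := by
  rw [← padicValNat_dvd_iff_le (geom_ne_zero hD.one_lt_tau D.n_pos)]
  exact pow_padicValNat_dvd.trans hD.s_dvd_geom

lemma gam_le_nu (hD : Good D) {p : ℕ} [hp : Fact p.Prime] (h1 : p ∣ D.tau - 1)
    (h4 : p = 2 → 4 ∣ D.tau - 1) : padicValNat p D.s ≤ padicValNat p D.n :=
  hD.padicValNat_s_le_geom.trans_eq (padicValNat_geom hD.one_lt_tau D.n_pos h1 h4)

lemma two_dvd_n {τ n m : ℕ} (h4 : 4 ∣ τ + 1) (hm : 4 ∣ m) (h : τ ^ n ≡ 1 [MOD m]) : 2 ∣ n := by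
  by_contra hn
  have h1 : τ ^ n ≡ 1 [MOD 4] := h.of_dvd hm
  have h2 : τ ≡ 3 [MOD 4] := by unfold Nat.ModEq; omega
  have h3 : τ ^ n ≡ 3 [MOD 4] := by
    obtain ⟨k, rfl⟩ : ∃ k, n = 2 * k + 1 := ⟨n / 2, by omega⟩
    refine (h2.pow _).trans ?_
    have : (3 ^ 2) ^ k ≡ 1 ^ k [MOD 4] := Nat.ModEq.pow _ (by decide)
    have := this.mul_right 3
    rw [one_pow, one_mul, ← pow_mul, ← pow_succ] at this
    exact this
  have := h1.symm.trans h3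
  exact absurd this (by decide)

lemma mu_lt (hD : Good D) (h4 : 4 ∣ D.tau + 1) (h : padicValNat 2 D.s = padicValNat 2 D.m) :
    padicValNat 2 D.m + 1 ≤ padicValNat 2 D.n + padicValNat 2 (D.tau + 1) := by
  have h2 : 2 ≤ padicValNat 2 (D.tau + 1) := by
    rw [← padicValNat_dvd_iff_le (by omega)]; exact h4
  by_cases hm : 4 ∣ D.m
  · have := padicValNat_two_geom hD.one_lt_tau D.n_pos h4 (two_dvd_n h4 hm D.tau_pow_n)
    have := hD.padicValNat_s_le_geom (p := 2)
    omega
  · have : ¬ 2 ≤ padicValNat 2 D.m := by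
      rw [← padicValNat_dvd_iff_le D.m_pos.ne']; exact hm
    omega

end Good

lemma mem_of_pow_mem_of_coprime {G : Type*} [Group G] {K : Subgroup G} {x : G} {i j : ℕ}
    (h : i.Coprime j) (hi : x ^ i ∈ K) (hj : x ^ j ∈ K) : x ∈ K := by
  have h1 : x = (x ^ i) ^ (i.gcdA j) * (x ^ j) ^ (i.gcdB j) := by
    have := Nat.gcd_eq_gcd_ab i j
    rw [← zpow_natCast, ← zpow_natCast, ← zpow_mul, ← zpow_mul, ← zpow_add, ← this, h,
      Nat.cast_one, zpow_one]
  rw [h1]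
  exact mul_mem (zpow_mem hi _) (zpow_mem hj _)

namespace Pres

variable {G : Type*} [Group G] (D : Pres G)

lemma mul_pow_pow_eq (c k j : ℕ) : (D.a ^ c * D.b ^ k) ^ j =
    D.a ^ (c * ∑ i ∈ Finset.range j, (D.tau ^ k) ^ i) * D.b ^ (k * j) := by
  induction j with
  | zero => simp
  | succ j ih =>
    rw [pow_succ, ih, D.mul_eq, Finset.sum_range_succ]
    congr 2
    rw [← pow_mul]
    ring

lemma conj_mem_of_gen {w : G} (ha : D.a * w * D.a⁻¹ ∈ Subgroup.zpowers w)
    (hb : D.b * w * D.b⁻¹ ∈ Subgroup.zpowers w) : (Subgroup.zpowers w).Normal := by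
  have key : ∀ u : G, u * w * u⁻¹ ∈ Subgroup.zpowers w →
      ∀ z ∈ Subgroup.zpowers w, u * z * u⁻¹ ∈ Subgroup.zpowers w := by
    rintro u hu _ ⟨k, rfl⟩
    have := zpow_mem hu k
    rwa [conj_zpow] at this
  have key2 : ∀ u : G, u * w * u⁻¹ ∈ Subgroup.zpowers w → ∀ k : ℕ,
      ∀ z ∈ Subgroup.zpowers w, u ^ k * z * (u ^ k)⁻¹ ∈ Subgroup.zpowers w := by
    intro u hu k
    induction k with
    | zero => intro z hz; simpa using hz
    | succ k ih =>
      intro z hz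
      have := ih _ (key u hu z hz)
      rw [pow_succ, mul_inv_rev]
      simpa only [mul_assoc] using this
  constructor
  intro z hz g
  obtain ⟨x, y, rfl⟩ := D.cover g
  have := key2 _ ha x _ (key2 _ hb y z hz)
  rw [mul_inv_rev]
  simpa only [mul_assoc] using this

/-- A factorization with a smaller kernel. -/
lemma exists_fact_card_lt [Finite G] {p μ ν γ ρ m' n' s' q : ℕ} [hp : Fact p.Prime]
    (hm : D.m = p ^ μ * m') (hn : D.n = p ^ ν * n') (hs : D.s = p ^ γ * s') (hq : m' = s' * q)
    (hm' : ¬ p ∣ m') (hγν : γ ≤ ν) (hγρ : γ < ρ) (hρμ : ρ ≤ μ) (hτ : 1 < D.tau)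
    (hρ : p ^ ρ ∣ D.tau - 1) (h4 : p = 2 → 4 ∣ D.tau - 1)
    (hk : D.tau ^ (n' * p ^ (ν - γ)) ≡ 1 [MOD m']) :
    ∃ f : MetacyclicFact G, Nat.card f.A < D.m := by
  have hp0 := hp.out.pos
  have hn' : 0 < n' := Nat.pos_of_ne_zero (by rintro rfl; exact D.n_pos.ne' (by rw [hn, mul_zero]))
  have hm'0 : 0 < m' := Nat.pos_of_ne_zero (by rintro rfl; exact hm' (dvd_zero _))
  have hq0 : 0 < q := Nat.pos_of_ne_zero (by rintro rfl; exact hm'0.ne' (by rw [hq, mul_zero]))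
  have hcop : ∀ k, (p ^ k).Coprime m' := fun k =>
    Nat.Coprime.pow_left _ ((Nat.Prime.coprime_iff_not_dvd hp.out).2 hm')
  have hpρ : p ∣ p ^ ρ := dvd_pow_self _ (by omega)
  set e := n' * q * p ^ (ν - γ) with he
  have he0 : 0 < e := by positivity
  set T := D.tau ^ e with hT
  have hT1 : 1 < T := Nat.one_lt_pow he0.ne' hτ
  have hτT : D.tau - 1 ∣ T - 1 := by simpa using Nat.sub_dvd_pow_sub_pow D.tau 1 e
  have hTρ : p ^ ρ ∣ T - 1 := hρ.trans hτT
  have hTm' : m' ∣ T - 1 := by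
    have : T ≡ 1 [MOD m'] := by
      have := hk.pow q
      rwa [one_pow, ← pow_mul, show n' * p ^ (ν - γ) * q = e by rw [he]; ring] at this
    exact (Nat.modEq_iff_dvd' hT1.le).1 this.symm
  obtain ⟨l, hl⟩ : m' * p ^ ρ ∣ T - 1 := Nat.Coprime.mul_dvd_of_dvd_of_dvd (hcop ρ).symm hTm' hTρ
  set E := ∑ i ∈ Finset.range (p ^ γ), T ^ i with hE
  have hEv : padicValNat p E = γ := by
    rw [hE, padicValNat_geom hT1 (by positivity) (hpρ.trans hTρ) fun h => (h4 h).trans hτT,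
      padicValNat.prime_pow]
  have hE0 : E ≠ 0 := geom_ne_zero hT1 (by positivity)
  obtain ⟨E₁, hE₁⟩ : p ^ γ ∣ E := by
    rw [padicValNat_dvd_iff_le hE0, hEv]
  have hE₁p : ¬ p ∣ E₁ := by
    rintro ⟨k, rfl⟩
    have : p ^ (γ + 1) ∣ E := ⟨k, by rw [hE₁]; ring⟩
    rw [padicValNat_dvd_iff_le hE0, hEv] at this
    omega
  have : NeZero (p ^ μ) := ⟨pow_ne_zero _ hp0.ne'⟩
  obtain ⟨x, hx⟩ : ∃ x : ℕ, ((x * E₁ + 1 : ℕ) : ZMod (p ^ μ)) = ((p ^ (ρ - γ) : ℕ) : ZMod (p ^ μ)) := by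
    obtain ⟨v, hv⟩ := isUnit_natCast_of_not_dvd (e := μ) hE₁p
    refine ⟨(((p ^ (ρ - γ) : ℕ) - 1 : ZMod (p ^ μ)) * ((v⁻¹ : (ZMod (p ^ μ))ˣ) : ZMod (p ^ μ))).val, ?_⟩
    rw [Nat.cast_add, Nat.cast_mul, ZMod.natCast_zmod_val, ← hv, mul_assoc, Units.inv_mul]
    push_cast
    ring
  have hx' : x * E₁ + 1 ≡ p ^ (ρ - γ) [MOD p ^ μ] := (ZMod.natCast_eq_natCast_iff _ _ _).1 hx
  have hxp : ¬ p ∣ x := by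
    intro h
    have h1 : x * E₁ + 1 ≡ p ^ (ρ - γ) [MOD p] := hx'.of_dvd (dvd_pow_self _ (by omega))
    have h2 : p ∣ x * E₁ + 1 := by
      rw [← Nat.modEq_zero_iff_dvd]
      exact h1.trans ((Nat.modEq_zero_iff_dvd).2 (dvd_pow_self _ (by omega)))
    exact hp.out.one_lt.ne' (Nat.dvd_one.1 ((Nat.dvd_add_right (h.mul_right _)).1 h2))
  set g := D.a ^ (m' * x) * D.b ^ e with hg
  set c := D.a ^ (p ^ μ) with hc
  have hgp : g ^ (p ^ γ) = D.a ^ (m' * p ^ ρ) := by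
    have h1 : e * p ^ γ = D.n * q := by
      rw [hn, he]
      have : p ^ ν = p ^ (ν - γ) * p ^ γ := by rw [← pow_add, Nat.sub_add_cancel hγν]
      rw [this]; ring
    rw [hg, D.mul_pow_pow_eq, h1, pow_mul D.b, D.pow_n, ← pow_mul, ← pow_add, D.pow_a_eq_iff]
    rw [← hT, ← hE, hE₁, hs]
    have h2 : m' * x * (p ^ γ * E₁) + p ^ γ * s' * q = m' * (p ^ γ * (x * E₁ + 1)) := by
      rw [hq]; ring
    have h3 : p ^ ρ = p ^ γ * p ^ (ρ - γ) := by rw [← pow_add, Nat.add_sub_cancel' hγρ.le]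
    rw [h2, h3, hm, mul_comm (p ^ μ)]
    exact Nat.ModEq.mul_left' _ (hx'.mul_left _)
  have hbc : D.b ^ e * c = c * D.b ^ e := by
    rw [hc, D.pow_conj]
    congr 1
    rw [D.pow_a_eq_iff, ← hT, hm]
    refine (Nat.modEq_iff_dvd' (Nat.le_mul_of_pos_left _ (by omega))).2 ?_ |>.symm
    obtain ⟨r, hr⟩ := hTm'
    refine ⟨r, ?_⟩
    have : T * p ^ μ - p ^ μ = (T - 1) * p ^ μ := by rw [Nat.sub_mul, one_mul]
    rw [this, hr]; ring
  have hcomm : Commute g c := by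
    change g * c = c * g
    rw [hg, mul_assoc, hbc, ← mul_assoc, ← mul_assoc, hc, ← pow_add, ← pow_add, add_comm]
  have hgP : g ^ (p ^ (γ + (μ - ρ))) = 1 := by
    rw [pow_add, pow_mul, hgp, ← pow_mul, mul_assoc, ← pow_add, Nat.add_sub_cancel' hρμ, mul_comm,
      ← hm, ← D.order_a, pow_orderOf_eq_one]
  have hcm : c ^ m' = 1 := by
    rw [hc, ← pow_mul, ← hm, ← D.order_a, pow_orderOf_eq_one]
  set A := Subgroup.zpowers (g * c) with hA
  have hgA : g ∈ A := by
    apply mem_of_pow_mem_of_coprime (hcop (γ + (μ - ρ))).symm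
    · have : g ^ m' = (g * c) ^ m' := by rw [hcomm.mul_pow, hcm, mul_one]
      rw [this]
      exact pow_mem (Subgroup.mem_zpowers _) _
    · rw [hgP]; exact one_mem _
  have hcA : c ∈ A := (Subgroup.mul_mem_cancel_left _ hgA).1 (Subgroup.mem_zpowers _)
  have hpow : ∀ k, m' * p ^ ρ ∣ k → D.a ^ k ∈ A := by
    rintro _ ⟨k, rfl⟩
    rw [pow_mul, ← hgp]
    exact pow_mem (pow_mem hgA _) _
  have hag : D.a * g * D.a⁻¹ ∈ A := by
    have h1 : D.a * g * D.a⁻¹ = (D.a ^ (T - 1))⁻¹ * g := by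
      rw [mul_inv_eq_iff_eq_mul, mul_assoc, eq_inv_mul_iff_mul_eq, hg]
      have h2 := D.pow_conj 1 e
      rw [mul_one, pow_one, ← hT] at h2
      rw [mul_assoc (D.a ^ (m' * x)), h2, ← mul_assoc, ← mul_assoc, ← mul_assoc, ← pow_succ,
        ← pow_add, ← pow_add]
      congr 2
      omega
    rw [h1]
    exact mul_mem (inv_mem (hpow _ ⟨l, hl⟩)) hgA
  have hbg : D.b * g * D.b⁻¹ ∈ A := by
    have h1 : D.b * g * D.b⁻¹ = D.a ^ ((D.tau - 1) * (m' * x)) * g := by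
      rw [mul_inv_eq_iff_eq_mul, hg]
      have h2 := D.pow_conj (m' * x) 1
      rw [pow_one, pow_one] at h2
      have h3 : D.tau * (m' * x) = (D.tau - 1) * (m' * x) + m' * x := by
        obtain ⟨t, ht⟩ : ∃ t, D.tau = t + 1 := ⟨D.tau - 1, by omega⟩
        rw [ht, Nat.add_sub_cancel]
        ring
      rw [← mul_assoc, h2, h3, pow_add]
      simp only [mul_assoc, ← pow_succ, ← pow_succ']
    rw [h1]
    refine mul_mem (hpow _ ?_) hgA
    obtain ⟨r, hr⟩ := hρ
    exact ⟨r * x, by rw [hr]; ring⟩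
  have hac : D.a * c * D.a⁻¹ ∈ A := by
    have : D.a * c * D.a⁻¹ = c := by
      rw [mul_inv_eq_iff_eq_mul, hc, ← pow_succ, ← pow_succ']
    rwa [this]
  have hbc' : D.b * c * D.b⁻¹ ∈ A := by
    have : D.b * c * D.b⁻¹ = c ^ D.tau := by
      have h2 := D.pow_conj (p ^ μ) 1
      rw [pow_one, pow_one] at h2
      rw [mul_inv_eq_iff_eq_mul, hc, h2, ← pow_mul, mul_comm]
    rw [this]
    exact pow_mem hcA _
  have hnorm : A.Normal := by
    apply D.conj_mem_of_gen
    · have := mul_mem hag hac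
      have e : D.a * g * D.a⁻¹ * (D.a * c * D.a⁻¹) = D.a * (g * c) * D.a⁻¹ := by group
      rwa [e] at this
    · have := mul_mem hbg hbc'
      have e : D.b * g * D.b⁻¹ * (D.b * c * D.b⁻¹) = D.b * (g * c) * D.b⁻¹ := by group
      rwa [e] at this
  have hsup : A ⊔ Subgroup.zpowers D.b = ⊤ := by
    have hbK : D.b ∈ A ⊔ Subgroup.zpowers D.b :=
      Subgroup.mem_sup_right (Subgroup.mem_zpowers _)
    have h1 : (D.a ^ m') ^ x ∈ A ⊔ Subgroup.zpowers D.b := by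
      have h2 : g ∈ A ⊔ Subgroup.zpowers D.b := Subgroup.mem_sup_left hgA
      rw [hg, pow_mul] at h2
      exact (Subgroup.mul_mem_cancel_right _ (pow_mem hbK _)).1 h2
    have h2 : D.a ^ m' ∈ A ⊔ Subgroup.zpowers D.b := by
      apply mem_of_pow_mem_of_coprime (i := x) (j := p ^ μ) _ h1
      · rw [← pow_mul, mul_comm, ← hm, ← D.order_a, pow_orderOf_eq_one]
        exact one_mem _
      · exact (Nat.Coprime.pow_left _ ((Nat.Prime.coprime_iff_not_dvd hp.out).2 hxp)).symm
    have h3 : D.a ∈ A ⊔ Subgroup.zpowers D.b :=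
      mem_of_pow_mem_of_coprime (hcop μ).symm h2 (Subgroup.mem_sup_left hcA)
    rw [Subgroup.eq_top_iff']
    intro u
    obtain ⟨i, j, rfl⟩ := D.cover u
    exact mul_mem (pow_mem h3 _) (pow_mem hbK _)
  refine ⟨⟨A, Subgroup.zpowers D.b, hnorm, inferInstance, inferInstance, ?_⟩, ?_⟩
  · intro u
    have hu : u ∈ A ⊔ Subgroup.zpowers D.b := hsup ▸ Subgroup.mem_top u
    obtain ⟨y, hy, z, hz, rfl⟩ := Subgroup.mem_sup_of_normal_left.1 hu
    exact ⟨y, hy, z, hz, rfl⟩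
  · change Nat.card A < _
    rw [hA, Nat.card_zpowers]
    have h1 : (g * c) ^ (p ^ (γ + (μ - ρ)) * m') = 1 := by
      rw [hcomm.mul_pow, pow_mul, hgP, one_pow, one_mul, mul_comm, pow_mul, hcm, one_pow]
    have h2 := Nat.le_of_dvd (by positivity) (orderOf_dvd_of_pow_eq_one h1)
    refine h2.trans_lt ?_
    rw [hm]
    exact Nat.mul_lt_mul_of_pos_right (Nat.pow_lt_pow_right hp.out.one_lt (by omega)) hm'0

end Pres

lemma Good.rho_or {G : Type*} [Group G] [Finite G] {D : Pres G} (hD : Good D) {p : ℕ}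
    [hp : Fact p.Prime] (h4 : p = 2 → 4 ∣ D.tau - 1) :
    min (padicValNat p (D.tau - 1)) (padicValNat p D.m) ≤ padicValNat p D.s ∨
      padicValNat p D.n < padicValNat p D.s +
        padicValNat p (orderOf (D.tau : ZMod (ordCompl[p] D.m))) := by
  by_contra! hcon
  obtain ⟨c1, c2⟩ := hcon
  have hprod : ∀ k : ℕ, k = p ^ padicValNat p k * ordCompl[p] k := fun k => by
    rw [← Nat.factorization_def _ hp.out, Nat.ordProj_mul_ordCompl_eq_self]
  have hτ0 : D.tau - 1 ≠ 0 := by have := hD.one_lt_tau; omega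
  set o := orderOf (D.tau : ZMod (ordCompl[p] D.m)) with ho
  have hon : o ∣ D.n := by
    rw [ho, orderOf_dvd_iff_pow_eq_one, ← Nat.cast_pow, ← Nat.cast_one,
      ZMod.natCast_eq_natCast_iff]
    exact D.tau_pow_n.of_dvd (Nat.ordCompl_dvd _ _)
  have ho0 : o ≠ 0 := fun h => D.n_pos.ne' (Nat.eq_zero_of_zero_dvd (h ▸ hon))
  obtain ⟨q, hq⟩ : ordCompl[p] D.s ∣ ordCompl[p] D.m := Nat.ordCompl_dvd_ordCompl_of_dvd hD.s_dvd p
  obtain ⟨f, hf⟩ := D.exists_fact_card_lt (hprod D.m) (hprod D.n) (hprod D.s) hq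
    (Nat.not_dvd_ordCompl hp.out D.m_pos.ne') (by omega) c1 (min_le_right _ _) hD.one_lt_tau
    ((padicValNat_dvd_iff_le hτ0).2 (min_le_left _ _)) h4 (by
      rw [← ZMod.natCast_eq_natCast_iff, Nat.cast_pow, Nat.cast_one, ← orderOf_dvd_iff_pow_eq_one,
        ← ho, hprod o, mul_comm]
      exact mul_dvd_mul (Nat.ordCompl_dvd_ordCompl_of_dvd hon p) (pow_dvd_pow _ (by omega)))
  exact absurd (hD.min_m f) (by omega)

section Counting

lemma ncard_eq_sum_mul {α β γ : Type*} [Finite α] [Finite β] [Finite γ] (Φ : α ≃ β × γ) (S : Set α)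
    (A : ℕ → Set β) (B : ℕ → Set γ) (I : Finset ℕ)
    (hB : ∀ i j y, y ∈ B i → y ∈ B j → i = j)
    (h : ∀ x, x ∈ S ↔ ∃ i ∈ I, (Φ x).1 ∈ A i ∧ (Φ x).2 ∈ B i) :
    S.ncard = ∑ i ∈ I, (B i).ncard * (A i).ncard := by
  have := Fintype.ofFinite β
  have := Fintype.ofFinite γ
  have h1 : Φ '' S = ((I.biUnion fun i => (A i).toFinset ×ˢ (B i).toFinset : Finset (β × γ)) :
      Set (β × γ)) := by
    ext y
    obtain ⟨x, rfl⟩ := Φ.surjective y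
    rw [Φ.injective.mem_set_image, h]
    simp only [Finset.coe_biUnion, Finset.coe_product, Set.coe_toFinset, Set.mem_iUnion,
      Set.mem_prod, Finset.mem_coe, exists_prop]
  rw [← Set.ncard_image_of_injective S Φ.injective, h1, Set.ncard_coe_finset, Finset.card_biUnion]
  · refine Finset.sum_congr rfl fun i _ => ?_
    rw [Finset.card_product, Set.ncard_eq_toFinset_card', Set.ncard_eq_toFinset_card', mul_comm]
  · intro i _ j _ hij
    rw [Function.onFun, Finset.disjoint_left]
    intro y hy hy'
    simp only [Finset.mem_product, Set.mem_toFinset] at hy hy'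
    exact hij (hB i j _ hy.2 hy'.2)

end Counting

namespace Pres

variable {G : Type*} [Group G] (D : Pres G)

section CRT

variable {P Q : ℕ} (hPQ : P.Coprime Q)

lemma crt_ext {x y : ZMod (P * Q)} : x = y ↔
    (ZMod.chineseRemainder hPQ x).1 = (ZMod.chineseRemainder hPQ y).1 ∧
      (ZMod.chineseRemainder hPQ x).2 = (ZMod.chineseRemainder hPQ y).2 := by
  rw [← Prod.ext_iff, (ZMod.chineseRemainder hPQ).injective.eq_iff]

lemma crt_mul_fst (k : ℕ) (x : ZMod (P * Q)) :
    (ZMod.chineseRemainder hPQ (k * x)).1 = k * (ZMod.chineseRemainder hPQ x).1 := by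
  rw [map_mul, map_natCast, Prod.fst_mul, Prod.fst_natCast]

lemma crt_mul_snd (k : ℕ) (x : ZMod (P * Q)) :
    (ZMod.chineseRemainder hPQ (k * x)).2 = k * (ZMod.chineseRemainder hPQ x).2 := by
  rw [map_mul, map_natCast, Prod.snd_mul, Prod.snd_natCast]

lemma crt_mul_eq_mul {k l : ℕ} {x y : ZMod (P * Q)} : (k : ZMod (P * Q)) * x = l * y ↔
    ((k : ZMod P) * (ZMod.chineseRemainder hPQ x).1 = l * (ZMod.chineseRemainder hPQ y).1 ∧
      (k : ZMod Q) * (ZMod.chineseRemainder hPQ x).2 = l * (ZMod.chineseRemainder hPQ y).2) := by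
  rw [crt_ext hPQ, crt_mul_fst, crt_mul_fst, crt_mul_snd, crt_mul_snd]

lemma crt_mul_eq {k : ℕ} {x y : ZMod (P * Q)} : (k : ZMod (P * Q)) * x = y ↔
    ((k : ZMod P) * (ZMod.chineseRemainder hPQ x).1 = (ZMod.chineseRemainder hPQ y).1 ∧
      (k : ZMod Q) * (ZMod.chineseRemainder hPQ x).2 = (ZMod.chineseRemainder hPQ y).2) := by
  rw [crt_ext hPQ, crt_mul_fst, crt_mul_snd]

lemma crt_mul_eq_zero {k : ℕ} {x : ZMod (P * Q)} : (k : ZMod (P * Q)) * x = 0 ↔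
    ((k : ZMod P) * (ZMod.chineseRemainder hPQ x).1 = 0 ∧
      (k : ZMod Q) * (ZMod.chineseRemainder hPQ x).2 = 0) := by
  rw [crt_mul_eq hPQ, map_zero, Prod.fst_zero, Prod.snd_zero]

lemma per_crt (x : ZMod (P * Q)) : D.per (P * Q) x =
    (D.per P (ZMod.chineseRemainder hPQ x).1).lcm (D.per Q (ZMod.chineseRemainder hPQ x).2) := by
  have key : ∀ k, D.per (P * Q) x ∣ k ↔
      (D.per P (ZMod.chineseRemainder hPQ x).1).lcm
        (D.per Q (ZMod.chineseRemainder hPQ x).2) ∣ k := by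
    intro k
    rw [Nat.lcm_dvd_iff, per_dvd_iff, per_dvd_iff, per_dvd_iff, ← Nat.cast_pow, crt_mul_eq hPQ]
    push_cast
    rfl
  exact Nat.dvd_antisymm ((key _).2 dvd_rfl) ((key _).1 dvd_rfl)

lemma mem_fixedPairs_crt {d t : ℕ} (z w : ZMod (P * Q)) {z₁ w₁ : ZMod P} {z₂ w₂ : ZMod Q}
    (hz₁ : (ZMod.chineseRemainder hPQ z).1 = z₁) (hz₂ : (ZMod.chineseRemainder hPQ z).2 = z₂)
    (hw₁ : (ZMod.chineseRemainder hPQ w).1 = w₁) (hw₂ : (ZMod.chineseRemainder hPQ w).2 = w₂) :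
    (z, w) ∈ D.fixedPairs (P * Q) d t ↔
      (((D.m : ZMod P) * z₁ = 0 ∧ (D.m : ZMod Q) * z₂ = 0) ∧
        ((D.n / d : ℕ) : ZMod P) * w₁ = (D.s : ZMod P) * z₁ ∧
        ((D.n / d : ℕ) : ZMod Q) * w₂ = (D.s : ZMod Q) * z₂) ∧
      (D.per P z₁).lcm (D.per Q z₂) = d ∧
      ((t : ZMod P) * w₁ = w₁ ∧ (t : ZMod Q) * w₂ = w₂) ∧
      ∃ j : ℕ, (t : ZMod P) * z₁ = (D.tau : ZMod P) ^ j * z₁ ∧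
        (t : ZMod Q) * z₂ = (D.tau : ZMod Q) ^ j * z₂ := by
  subst hz₁ hz₂ hw₁ hw₂
  simp only [fixedPairs, pairs, Set.mem_ofPred_eq, crt_mul_eq_zero hPQ, crt_mul_eq_mul hPQ,
    crt_mul_eq hPQ, per_crt D hPQ, ← Nat.cast_pow]
  constructor
  · rintro ⟨⟨h1, h2⟩, h3, h4⟩
    exact ⟨⟨h1, by rwa [h3] at h2⟩, h3, h4⟩
  · rintro ⟨⟨h1, h2⟩, h3, h4⟩
    exact ⟨⟨h1, by rwa [h3]⟩, h3, h4⟩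

/-- The coordinates on pairs coming from a coprime factorization, rescaled by units. -/
def crtEquiv (v : (ZMod P)ˣ) (v' : (ZMod Q)ˣ) :
    ZMod (P * Q) × ZMod (P * Q) ≃ (ZMod P × ZMod P) × (ZMod Q × ZMod Q) :=
  ((Equiv.prodCongr (ZMod.chineseRemainder hPQ).toEquiv
    (ZMod.chineseRemainder hPQ).toEquiv).trans (Equiv.prodProdProdComm _ _ _ _)).trans
    (Equiv.prodCongr (Equiv.prodCongr (Equiv.refl _) (Units.mulLeft v))
      (Equiv.prodCongr (Equiv.refl _) (Units.mulLeft v')))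

lemma crtEquiv_apply (v : (ZMod P)ˣ) (v' : (ZMod Q)ˣ) (z w : ZMod (P * Q)) :
    crtEquiv hPQ v v' (z, w) =
      (((ZMod.chineseRemainder hPQ z).1, v * (ZMod.chineseRemainder hPQ w).1),
        ((ZMod.chineseRemainder hPQ z).2, v' * (ZMod.chineseRemainder hPQ w).2)) := rfl

end CRT

section Local

variable {p e Q μ ν γ m' n' s' : ℕ} [hp : Fact p.Prime]

/-- The pairs away from `p` for linear characters. -/
def linAway (Q : ℕ) : Set (ZMod Q × ZMod Q) :=
  {q | (D.m : ZMod Q) * q.1 = 0 ∧ (D.tau : ZMod Q) * q.1 = q.1 ∧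
    (D.n : ZMod Q) * q.2 = (D.s : ZMod Q) * q.1}

/-- The pairs away from `p` for characters whose orbit has length `d * p ^ i`. -/
def away (n' Q p d i : ℕ) : Set (ZMod Q × ZMod Q) :=
  {q | d ∣ n' ∧ (D.m : ZMod Q) * q.1 = 0 ∧ D.per Q q.1 = d * p ^ i ∧
    ((n' / d : ℕ) : ZMod Q) * q.2 = (D.s : ZMod Q) * q.1}

lemma exists_unit {k : ℕ} (hk : ¬ p ∣ k) : ∃ v : (ZMod (p ^ e))ˣ, (v : ZMod (p ^ e)) = k :=
  isUnit_natCast_of_not_dvd hk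

lemma exists_unit' (hpQ : p.Coprime Q) (k : ℕ) : ∃ v : (ZMod Q)ˣ, (v : ZMod Q) = p ^ k := by
  have : IsUnit ((p : ZMod Q) ^ k) := ((ZMod.isUnit_iff_coprime p Q).2 hpQ).pow k
  exact this

lemma mul_pow_eq_zero_iff (hm : D.m = p ^ μ * m') (hm' : ¬ p ∣ m') (z : ZMod (p ^ e)) :
    (D.m : ZMod (p ^ e)) * z = 0 ↔ (p : ZMod (p ^ e)) ^ μ * z = 0 := by
  obtain ⟨v, hv⟩ := exists_unit (e := e) hm'
  rw [hm, Nat.cast_mul, ← hv, Nat.cast_pow, mul_comm _ (v : ZMod (p ^ e)), mul_assoc,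
    Units.mul_right_eq_zero]

lemma scaled_iff {k u s' γ : ℕ} {U S : (ZMod (p ^ e))ˣ} (hU : (U : ZMod (p ^ e)) = u)
    (hS : (S : ZMod (p ^ e)) = s') (z w : ZMod (p ^ e)) :
    ((p ^ k * u : ℕ) : ZMod (p ^ e)) * w = ((p ^ γ * s' : ℕ) : ZMod (p ^ e)) * z ↔
      (p : ZMod (p ^ e)) ^ k * (((S⁻¹ * U : (ZMod (p ^ e))ˣ) : ZMod (p ^ e)) * w) =
        (p : ZMod (p ^ e)) ^ γ * z := by
  conv_rhs => rw [← Units.mul_right_inj S]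
  push_cast
  rw [← hU, ← hS]
  have h1 : (S : ZMod (p ^ e)) * ((p : ZMod (p ^ e)) ^ k *
      (((S⁻¹ : (ZMod (p ^ e))ˣ) : ZMod (p ^ e)) * U * w)) = p ^ k * U * w := by
    linear_combination ((p : ZMod (p ^ e)) ^ k * U * w) * (S.mul_inv)
  have h2 : (S : ZMod (p ^ e)) * ((p : ZMod (p ^ e)) ^ γ * z) = p ^ γ * S * z := by ring
  rw [h1, h2]

lemma unit_fixed_iff {P : ℕ} (v : (ZMod P)ˣ) (t w : ZMod P) : t * (v * w) = v * w ↔ t * w = w := by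
  rw [mul_left_comm, Units.mul_right_inj]

lemma ncard_fixedPairs_one [NeZero Q] (hpQ : p.Coprime Q) (hm : D.m = p ^ μ * m')
    (hm' : ¬ p ∣ m') (hn : D.n = p ^ ν * n') (hn' : ¬ p ∣ n') (hs : D.s = p ^ γ * s')
    (hs' : ¬ p ∣ s') {t t₁ : ℕ} (ht : t ≡ t₁ [MOD p ^ e]) (ht' : t ≡ 1 [MOD Q]) :
    (D.fixedPairs (p ^ e * Q) 1 t).ncard =
      (D.linAway Q).ncard * (linSet p e μ ν γ D.tau t₁).ncard := by
  have : NeZero (p ^ e) := ⟨pow_ne_zero _ hp.out.ne_zero⟩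
  have hPQ : (p ^ e).Coprime Q := Nat.Coprime.pow_left _ hpQ
  obtain ⟨U, hU⟩ := exists_unit (e := e) hn'
  obtain ⟨S, hS⟩ := exists_unit (e := e) hs'
  have htP := (ZMod.natCast_eq_natCast_iff t t₁ (p ^ e)).2 ht
  have htQ := (ZMod.natCast_eq_natCast_iff t 1 Q).2 ht'
  rw [ncard_eq_sum_mul (crtEquiv hPQ (S⁻¹ * U) 1) _ (fun _ => linSet p e μ ν γ D.tau t₁)
    (fun i => {q | i = 0 ∧ q ∈ D.linAway Q}) {0}, Finset.sum_singleton]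
  · simp
  · rintro i j y ⟨rfl, -⟩ ⟨rfl, -⟩
    rfl
  · rintro ⟨z, w⟩
    rw [D.mem_fixedPairs_crt hPQ z w rfl rfl rfl rfl, crtEquiv_apply]
    generalize (ZMod.chineseRemainder hPQ z).1 = z₁
    generalize (ZMod.chineseRemainder hPQ z).2 = z₂
    generalize (ZMod.chineseRemainder hPQ w).1 = w₁
    generalize (ZMod.chineseRemainder hPQ w).2 = w₂
    have hper : (D.per (p ^ e) z₁).lcm (D.per Q z₂) = 1 ↔
        (D.tau : ZMod (p ^ e)) * z₁ = z₁ ∧ (D.tau : ZMod Q) * z₂ = z₂ := by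
      rw [← Nat.dvd_one, Nat.lcm_dvd_iff, per_dvd_iff, per_dvd_iff, pow_one, pow_one]
    simp only [Finset.mem_singleton, exists_eq_left, linSet, linAway, Set.mem_ofPred_eq, true_and]
    rw [hper, Nat.div_one, mul_pow_eq_zero_iff D hm hm', htP, htQ, Nat.cast_one, one_mul,
      unit_fixed_iff]
    have h1 : (D.n : ZMod (p ^ e)) * w₁ = (D.s : ZMod (p ^ e)) * z₁ ↔
        (p : ZMod (p ^ e)) ^ ν * (((S⁻¹ * U : (ZMod (p ^ e))ˣ) : ZMod (p ^ e)) * w₁) =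
          (p : ZMod (p ^ e)) ^ γ * z₁ := by
      rw [hn, hs]
      exact scaled_iff hU hS z₁ w₁
    rw [h1]
    simp only [Units.val_one, one_mul]
    constructor
    · rintro ⟨⟨⟨a1, a2⟩, a3, a4⟩, ⟨a5, a6⟩, ⟨a7, -⟩, j, a8, -⟩
      have : ∀ j, (D.tau : ZMod (p ^ e)) ^ j * z₁ = z₁ := fun j =>
        D.per_dvd_iff.1 ((D.per_dvd_iff (k := 1)).2 (by rwa [pow_one]) |>.trans (one_dvd _))
      rw [this] at a8
      exact ⟨⟨a1, a5, a3, a7, a8⟩, a2, a6, a4⟩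
    · rintro ⟨⟨a1, a5, a3, a7, a8⟩, a2, a6, a4⟩
      exact ⟨⟨⟨a1, a2⟩, a3, a4⟩, ⟨a5, a6⟩, ⟨a7, trivial⟩, 0, by simpa using a8, by simp⟩

lemma per_pow (hm : D.m = p ^ μ * m') (hm' : ¬ p ∣ m') (hτ : 1 < D.tau)
    (hpow : p ^ μ ∣ D.tau ^ (p ^ ν) - 1) {z : ZMod (p ^ e)} (hz : (D.m : ZMod (p ^ e)) * z = 0) :
    D.per (p ^ e) z ∣ p ^ ν := by
  rw [per_dvd_iff]
  rw [mul_pow_eq_zero_iff D hm hm'] at hz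
  obtain ⟨k, hk⟩ := hpow
  have h1 : D.tau ^ p ^ ν = 1 + p ^ μ * k := by
    have := Nat.one_le_pow (p ^ ν) D.tau (by omega)
    omega
  rw [← Nat.cast_pow, h1]
  push_cast
  linear_combination (k : ZMod (p ^ e)) * hz

lemma lcm_eq_iff {g i f d d₀ : ℕ} (hd : p.Coprime d) (hd₀ : p.Coprime d₀) (h0 : 0 < d)
    (h0' : 0 < d₀) :
    (p ^ g).lcm (d * p ^ i) = d₀ * p ^ f ↔ d = d₀ ∧ max g i = f := by
  have h1 : (p ^ g).lcm (d * p ^ i) = d * p ^ (max g i) := by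
    apply Nat.dvd_antisymm
    · apply Nat.lcm_dvd
      · exact (pow_dvd_pow p (le_max_left g i)).mul_left d
      · exact mul_dvd_mul_left _ (pow_dvd_pow p (le_max_right g i))
    · apply Nat.Coprime.mul_dvd_of_dvd_of_dvd (Nat.Coprime.pow_right _ hd.symm)
      · exact (Dvd.intro _ rfl : d ∣ d * p ^ i).trans (Nat.dvd_lcm_right _ _)
      · rcases max_choice g i with h | h <;> rw [h]
        · exact Nat.dvd_lcm_left _ _
        · exact (Dvd.intro_left _ rfl : p ^ i ∣ d * p ^ i).trans (Nat.dvd_lcm_right _ _)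
  rw [h1]
  constructor
  · intro h
    have e1 : d = d₀ := by
      apply Nat.dvd_antisymm
      · exact (Nat.Coprime.pow_right f hd.symm).dvd_of_dvd_mul_right (h ▸ Dvd.intro _ rfl)
      · exact (Nat.Coprime.pow_right _ hd₀.symm).dvd_of_dvd_mul_right
          ((Dvd.intro _ rfl : d₀ ∣ d₀ * p ^ f).trans (dvd_of_eq h.symm))
    subst e1
    exact ⟨rfl, Nat.pow_right_injective hp.out.two_le (Nat.eq_of_mul_eq_mul_left h0 h)⟩
  · rintro ⟨rfl, rfl⟩
    rfl

lemma exists_pow_mul_iff {i d₀ t₁ : ℕ} (hd₀ : p.Coprime d₀) {z : ZMod (p ^ e)}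
    (hz : D.per (p ^ e) z ∣ p ^ ν) :
    (∃ j : ℕ, d₀ * p ^ i ∣ j ∧ (t₁ : ZMod (p ^ e)) * z = (D.tau : ZMod (p ^ e)) ^ j * z) ↔
      ∃ k : ℕ, (t₁ : ZMod (p ^ e)) * z = (D.tau : ZMod (p ^ e)) ^ (p ^ i * k) * z := by
  constructor
  · rintro ⟨_, ⟨k, rfl⟩, h⟩
    exact ⟨d₀ * k, by rw [h]; congr 2; ring⟩
  · rintro ⟨k, h⟩
    have hper : (D.tau : ZMod (p ^ e)) ^ (p ^ ν) * z = z := D.per_dvd_iff.1 hz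
    have hper' : ∀ l : ℕ, (D.tau : ZMod (p ^ e)) ^ (p ^ ν * l) * z = z := fun l =>
      D.per_dvd_iff.1 (hz.trans (Dvd.intro _ rfl))
    obtain ⟨c, hc⟩ : ∃ c : ℕ, d₀ * c ≡ 1 [MOD p ^ ν] := by
      obtain ⟨c, hc⟩ := Nat.exists_mul_mod_eq_of_coprime (k := p ^ ν) 1
        (Nat.Coprime.pow_right ν hd₀.symm) (pow_ne_zero _ hp.out.ne_zero)
      exact ⟨c, hc.2⟩
    refine ⟨d₀ * p ^ i * (c * k), Dvd.intro _ rfl, ?_⟩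
    rw [h]
    have h2 : p ^ i * k ≡ d₀ * p ^ i * (c * k) [MOD p ^ ν] := by
      have := (hc.mul_right (p ^ i * k)).symm
      rw [one_mul] at this
      convert this using 1
      ring
    have key : ∀ x y : ℕ, x ≤ y → x ≡ y [MOD p ^ ν] →
        (D.tau : ZMod (p ^ e)) ^ x * z = (D.tau : ZMod (p ^ e)) ^ y * z := by
      intro x y hxy hm
      obtain ⟨l, hl⟩ := (Nat.modEq_iff_dvd' hxy).1 hm
      obtain rfl : y = x + p ^ ν * l := by omega
      rw [pow_add, mul_assoc, hper']
    rcases le_total (p ^ i * k) (d₀ * p ^ i * (c * k)) with hle | hle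
    · exact key _ _ hle h2
    · exact (key _ _ hle h2.symm).symm

lemma level_iff {g f i : ℕ} {z : ZMod (p ^ e)} (hz : D.per (p ^ e) z = p ^ g) :
    max g i = f ↔ i ≤ f ∧ (D.tau : ZMod (p ^ e)) ^ (p ^ f) * z = z ∧
      (i = f ∨ (D.tau : ZMod (p ^ e)) ^ (p ^ (f - 1)) * z ≠ z) := by
  have h : ∀ k, (D.tau : ZMod (p ^ e)) ^ (p ^ k) * z = z ↔ g ≤ k := fun k => by
    rw [← per_dvd_iff, hz, Nat.pow_dvd_pow_iff_le_right hp.out.one_lt]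
  rw [Ne, h, h]
  omega

lemma ncard_fixedPairs_pow [NeZero Q] (hpQ : p.Coprime Q) (hm : D.m = p ^ μ * m')
    (hm' : ¬ p ∣ m') (hn : D.n = p ^ ν * n') (hn' : ¬ p ∣ n') (hs : D.s = p ^ γ * s')
    (hs' : ¬ p ∣ s') (hτ : 1 < D.tau) (hpow : p ^ μ ∣ D.tau ^ (p ^ ν) - 1)
    {t t₁ : ℕ} (ht : t ≡ t₁ [MOD p ^ e]) (ht' : t ≡ 1 [MOD Q]) {d₀ f : ℕ} (hd₀ : p.Coprime d₀) :
    (D.fixedPairs (p ^ e * Q) (d₀ * p ^ f) t).ncard =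
      ∑ i ∈ Finset.range (f + 1), (D.away n' Q p d₀ i).ncard *
        (locSet p e μ ν γ D.tau i f t₁).ncard := by
  have : NeZero (p ^ e) := ⟨pow_ne_zero _ hp.out.ne_zero⟩
  have hPQ : (p ^ e).Coprime Q := Nat.Coprime.pow_left _ hpQ
  by_cases hdf : d₀ ∣ n' ∧ f ≤ ν
  swap
  · have h1 : D.fixedPairs (p ^ e * Q) (d₀ * p ^ f) t = ∅ := by
      rw [Set.eq_empty_iff_forall_notMem]
      rintro ⟨z, w⟩ ⟨⟨h1, -⟩, h2, -⟩
      have h3 := D.per_dvd_n h1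
      rw [h2, hn] at h3
      refine hdf ⟨?_, ?_⟩
      · exact (Nat.Coprime.pow_right ν hd₀.symm).dvd_of_dvd_mul_left
          ((Dvd.intro _ rfl : d₀ ∣ d₀ * p ^ f).trans h3)
      · rw [← Nat.pow_dvd_pow_iff_le_right hp.out.one_lt]
        exact (Nat.Coprime.pow_left f ((hp.out.coprime_iff_not_dvd).2 hn')).dvd_of_dvd_mul_right
          ((Dvd.intro_left _ rfl : p ^ f ∣ d₀ * p ^ f).trans h3)
    rw [h1, Set.ncard_empty, eq_comm]
    refine Finset.sum_eq_zero fun i _ => ?_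
    rcases not_and_or.1 hdf with h | h
    · have : D.away n' Q p d₀ i = ∅ := by
        rw [Set.eq_empty_iff_forall_notMem]
        exact fun q hq => h hq.1
      rw [this, Set.ncard_empty, zero_mul]
    · have : locSet p e μ ν γ D.tau i f t₁ = ∅ := by
        rw [Set.eq_empty_iff_forall_notMem]
        exact fun q hq => h hq.1
      rw [this, Set.ncard_empty, mul_zero]
  obtain ⟨⟨n₁, hn₁⟩, hf⟩ := hdf
  have hd0 : 0 < d₀ := by
    rcases Nat.eq_zero_or_pos d₀ with rfl | h
    · rw [Nat.coprime_zero_right] at hd₀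
      exact absurd hd₀ hp.out.one_lt.ne'
    · exact h
  have hdiv : D.n / (d₀ * p ^ f) = p ^ (ν - f) * n₁ := by
    apply Nat.div_eq_of_eq_mul_right (Nat.mul_pos hd0 (pow_pos hp.out.pos _))
    rw [hn, hn₁, ← Nat.sub_add_cancel hf, pow_add, Nat.add_sub_cancel]
    ring
  have hdiv' : n' / d₀ = n₁ := Nat.div_eq_of_eq_mul_right hd0 hn₁
  have hn₁' : ¬ p ∣ n₁ := fun h => hn' (hn₁ ▸ h.mul_left _)
  obtain ⟨U, hU⟩ := exists_unit (e := e) hn₁'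
  obtain ⟨S, hS⟩ := exists_unit (e := e) hs'
  obtain ⟨V, hV⟩ := exists_unit' hpQ (ν - f)
  have htP := (ZMod.natCast_eq_natCast_iff t t₁ (p ^ e)).2 ht
  have htQ := (ZMod.natCast_eq_natCast_iff t 1 Q).2 ht'
  refine ncard_eq_sum_mul (crtEquiv hPQ (S⁻¹ * U) V) _
    (fun i => locSet p e μ ν γ D.tau i f t₁) (fun i => D.away n' Q p d₀ i) _ ?_ ?_
  · rintro i j y ⟨-, -, h1, -⟩ ⟨-, -, h2, -⟩
    exact Nat.pow_right_injective hp.out.two_le (Nat.eq_of_mul_eq_mul_left hd0 (h1.symm.trans h2))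
  · rintro ⟨z, w⟩
    rw [D.mem_fixedPairs_crt hPQ z w rfl rfl rfl rfl, crtEquiv_apply]
    generalize (ZMod.chineseRemainder hPQ z).1 = z₁
    generalize (ZMod.chineseRemainder hPQ z).2 = z₂
    generalize (ZMod.chineseRemainder hPQ w).1 = w₁
    generalize (ZMod.chineseRemainder hPQ w).2 = w₂
    simp only [locSet, away, Set.mem_ofPred_eq]
    rw [unit_fixed_iff, htP, htQ, hdiv, hdiv', Nat.cast_one, one_mul, one_mul]
    have h1 : ((p ^ (ν - f) * n₁ : ℕ) : ZMod (p ^ e)) * w₁ = (D.s : ZMod (p ^ e)) * z₁ ↔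
        (p : ZMod (p ^ e)) ^ (ν - f) * (((S⁻¹ * U : (ZMod (p ^ e))ˣ) : ZMod (p ^ e)) * w₁) =
          (p : ZMod (p ^ e)) ^ γ * z₁ := by
      rw [hs]
      exact scaled_iff hU hS z₁ w₁
    have h2 : ((p ^ (ν - f) * n₁ : ℕ) : ZMod Q) * w₂ = (n₁ : ZMod Q) * (V * w₂) := by
      rw [hV]
      push_cast
      ring
    rw [h1, h2]
    have hj : ∀ j : ℕ, z₂ = (D.tau : ZMod Q) ^ j * z₂ ↔ D.per Q z₂ ∣ j := fun j => by
      rw [per_dvd_iff, eq_comm]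
    simp only [hj]
    by_cases hz₁ : (D.m : ZMod (p ^ e)) * z₁ = 0
    swap
    · have hz₁' := hz₁
      rw [mul_pow_eq_zero_iff D hm hm'] at hz₁'
      simp only [hz₁, hz₁', false_and, and_false, exists_false]
    have hz₁' := (mul_pow_eq_zero_iff D hm hm' z₁).1 hz₁
    have hper := D.per_pow hm hm' hτ hpow hz₁
    obtain ⟨g, hg, hgz⟩ := (Nat.dvd_prime_pow hp.out).1 hper
    constructor
    · rintro ⟨⟨⟨-, a2⟩, a3, a4⟩, a5, ⟨a6, -⟩, j, a7, a8⟩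
      have hpos := D.per_pos a2
      obtain ⟨i, d, hd, hid⟩ := Nat.exists_eq_pow_mul_and_not_dvd hpos.ne' p hp.out.ne_one
      rw [mul_comm] at hid
      have hd' := (hp.out.coprime_iff_not_dvd).2 hd
      rw [hgz, hid, lcm_eq_iff hd' hd₀ (Nat.pos_of_ne_zero (by rintro rfl; simp at hd)) hd0,
        D.level_iff hgz] at a5
      obtain ⟨rfl, b1, b2, b3⟩ := a5
      rw [hid] at a8
      exact ⟨i, Finset.mem_range.2 (by omega), ⟨hf, b1, hz₁', b2, b3, a3, a6,
        (D.exists_pow_mul_iff hd₀ hper).1 ⟨j, a8, a7⟩⟩, ⟨n₁, hn₁⟩, a2, hid, a4⟩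
    · rintro ⟨i, -, ⟨-, b1, -, b2, b3, a3, a6, b4⟩, -, a2, hid, a4⟩
      obtain ⟨j, a8, a7⟩ := (D.exists_pow_mul_iff hd₀ hper).2 b4
      refine ⟨⟨⟨hz₁, a2⟩, a3, a4⟩, ?_, ⟨a6, trivial⟩, j, a7, hid ▸ a8⟩
      rw [hgz, hid, lcm_eq_iff hd₀ hd₀ hd0 hd0, D.level_iff hgz]
      exact ⟨rfl, b1, b2, b3⟩

end Local

end Pres

namespace Pres

section Dimension

variable (D : Pres G) {p Q : ℕ} [hp : Fact p.Prime]

lemma away_order_pos (hQ : Q = ordCompl[p] D.m * ordCompl[p] D.n) [NeZero Q] :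
    0 < (D.away (ordCompl[p] D.n) Q p (ordCompl[p] (orderOf (D.tau : ZMod (ordCompl[p] D.m))))
      (padicValNat p (orderOf (D.tau : ZMod (ordCompl[p] D.m))))).ncard := by
  have hn0 : ordCompl[p] D.n ≠ 0 := (Nat.ordCompl_pos p D.n_pos.ne').ne'
  have hpow : (D.tau : ZMod (ordCompl[p] D.m)) ^ D.n = 1 := by
    have := (D.tau_pow_n.of_dvd (Nat.ordCompl_dvd D.m p))
    rw [← ZMod.natCast_eq_natCast_iff] at this
    exact_mod_cast this
  have ho : orderOf (D.tau : ZMod (ordCompl[p] D.m)) ∣ D.n := orderOf_dvd_of_pow_eq_one hpow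
  set o := orderOf (D.tau : ZMod (ordCompl[p] D.m)) with hodef
  have hd : ordCompl[p] o ∣ ordCompl[p] D.n := Nat.ordCompl_dvd_ordCompl_of_dvd ho p
  rw [Set.ncard_pos]
  refine ⟨((ordCompl[p] D.n : ℕ), (D.s * ordCompl[p] o : ℕ)), hd, ?_, ?_, ?_⟩
  · rw [← Nat.cast_mul, ZMod.natCast_eq_zero_iff, hQ]
    exact mul_dvd_mul_right (Nat.ordCompl_dvd D.m p) _
  · have h1 : ∀ k, D.per Q ((ordCompl[p] D.n : ℕ) : ZMod Q) ∣ k ↔ o ∣ k := by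
      intro k
      rw [per_dvd_iff, hodef, orderOf_dvd_iff_pow_eq_one, ← Nat.cast_pow, ← Nat.cast_mul,
        ZMod.natCast_eq_natCast_iff, hQ, ← Nat.cast_pow]
      nth_rewrite 3 [← one_mul (ordCompl[p] D.n)]
      rw [Nat.ModEq.mul_right_cancel_iff' hn0, ← ZMod.natCast_eq_natCast_iff, Nat.cast_one]
    have h2 : D.per Q ((ordCompl[p] D.n : ℕ) : ZMod Q) = o :=
      Nat.dvd_antisymm ((h1 _).2 dvd_rfl) ((h1 _).1 dvd_rfl)
    rw [h2, ← Nat.factorization_def o hp.out, mul_comm, Nat.ordProj_mul_ordCompl_eq_self]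
  · rw [← Nat.cast_mul, ← Nat.cast_mul]
    congr 1
    rw [mul_comm D.s, ← mul_assoc, Nat.div_mul_cancel hd, mul_comm]

lemma le_of_mem_away (hpQ : p.Coprime Q) {n' d i : ℕ} {q : ZMod Q × ZMod Q}
    (hq : q ∈ D.away n' Q p d i) :
    i ≤ padicValNat p (orderOf (D.tau : ZMod (ordCompl[p] D.m))) := by
  obtain ⟨-, h1, h2, -⟩ := hq
  have hpow : (D.tau : ZMod (ordCompl[p] D.m)) ^ D.n = 1 := by
    have := (D.tau_pow_n.of_dvd (Nat.ordCompl_dvd D.m p))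
    rw [← ZMod.natCast_eq_natCast_iff] at this
    exact_mod_cast this
  have ho : orderOf (D.tau : ZMod (ordCompl[p] D.m)) ∣ D.n := orderOf_dvd_of_pow_eq_one hpow
  have ho0 : orderOf (D.tau : ZMod (ordCompl[p] D.m)) ≠ 0 := by
    intro h
    rw [h, zero_dvd_iff] at ho
    exact D.n_pos.ne' ho
  obtain ⟨V, hV⟩ := exists_unit' hpQ (D.m.factorization p)
  have h3 : ((ordCompl[p] D.m : ℕ) : ZMod Q) * q.1 = 0 := by
    rw [← Nat.ordProj_mul_ordCompl_eq_self D.m p, Nat.cast_mul, Nat.cast_pow, ← hV, mul_assoc,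
      Units.mul_right_eq_zero] at h1
    exact h1
  have h4 : D.per Q q.1 ∣ orderOf (D.tau : ZMod (ordCompl[p] D.m)) := by
    rw [per_dvd_iff]
    have h5 := pow_orderOf_eq_one (D.tau : ZMod (ordCompl[p] D.m))
    have h6 : D.tau ^ orderOf (D.tau : ZMod (ordCompl[p] D.m)) ≡ 1 [MOD ordCompl[p] D.m] := by
      rw [← ZMod.natCast_eq_natCast_iff]
      exact_mod_cast h5
    obtain ⟨k, hk⟩ := (Nat.modEq_iff_dvd).1 h6.symm
    have h7 : ((D.tau : ZMod Q) ^ orderOf (D.tau : ZMod (ordCompl[p] D.m)) - 1) =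
        ((ordCompl[p] D.m : ℕ) : ZMod Q) * (k : ZMod Q) := by
      have := congrArg (Int.cast : ℤ → ZMod Q) hk
      rw [Int.cast_mul, Int.cast_natCast, Int.cast_sub, Int.cast_natCast, Int.cast_natCast,
        Nat.cast_pow, Nat.cast_one] at this
      exact this
    linear_combination q.1 * h7 + k * h3
  rw [h2] at h4
  exact (padicValNat_dvd_iff_le ho0).1 ((Dvd.intro_left _ rfl : p ^ i ∣ d * p ^ i).trans h4)

lemma coprime_ncard_linAway [NeZero Q] (hpQ : p.Coprime Q) : p.Coprime (D.linAway Q).ncard := by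
  let K : AddSubgroup (ZMod Q × ZMod Q) :=
    { carrier := D.linAway Q
      zero_mem' := by simp [linAway]
      add_mem' := by
        rintro ⟨z, w⟩ ⟨z', w'⟩ ⟨h1, h2, h3⟩ ⟨h1', h2', h3'⟩
        simp only [] at h1 h2 h3 h1' h2' h3'
        simp only [linAway, Set.mem_ofPred_eq, Prod.mk_add_mk, mul_add, h1, h2, h3, h1', h2', h3']
        simp
      neg_mem' := by
        rintro ⟨z, w⟩ ⟨h1, h2, h3⟩
        simp only [] at h1 h2 h3
        simp only [linAway, Set.mem_ofPred_eq, Prod.neg_mk, mul_neg, h1, h2, h3]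
        simp }
  have h := K.card_addSubgroup_dvd_card
  rw [Nat.card_prod, Nat.card_zmod] at h
  exact Nat.Coprime.coprime_dvd_right h (hpQ.mul_right hpQ)

lemma ncard_linSet_dvd (p e μ ν γ τ : ℕ) :
    (linSet p e μ ν γ τ 1).ncard ∣ p ^ e * p ^ e := by
  let K : AddSubgroup (ZMod (p ^ e) × ZMod (p ^ e)) :=
    { carrier := linSet p e μ ν γ τ 1
      zero_mem' := by simp [linSet]
      add_mem' := by
        rintro ⟨z, w⟩ ⟨z', w'⟩ ⟨h1, h2, h3, -⟩ ⟨h1', h2', h3', -⟩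
        simp only [] at h1 h2 h3 h1' h2' h3'
        simp only [linSet, Set.mem_ofPred_eq, Prod.mk_add_mk, mul_add, h1, h2, h3, h1', h2', h3']
        simp
      neg_mem' := by
        rintro ⟨z, w⟩ ⟨h1, h2, h3, -⟩
        simp only [] at h1 h2 h3
        simp only [linSet, Set.mem_ofPred_eq, Prod.neg_mk, mul_neg, h1, h2, h3]
        simp }
  have h := K.card_addSubgroup_dvd_card
  rwa [Nat.card_prod, Nat.card_zmod] at h

end Dimension

end Pres

section Local

variable [Finite G] {D : Pres G} (p : ℕ) [hp : Fact p.Prime]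

lemma Pres.coprime_ordCompl (D : Pres G) : p.Coprime (ordCompl[p] D.m * ordCompl[p] D.n) :=
  (Nat.coprime_ordCompl hp.out D.m_pos.ne').mul_right (Nat.coprime_ordCompl hp.out D.n_pos.ne')

lemma Pres.neZero_ordCompl (D : Pres G) : NeZero (ordCompl[p] D.m * ordCompl[p] D.n) :=
  ⟨mul_ne_zero (Nat.ordCompl_pos p D.m_pos.ne').ne' (Nat.ordCompl_pos p D.n_pos.ne').ne'⟩

lemma Pres.eq_pow_mul (k : ℕ) : k = p ^ padicValNat p k * ordCompl[p] k := by
  rw [← Nat.factorization_def k hp.out, Nat.ordProj_mul_ordCompl_eq_self]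

/-- The numerical data at `p` of a reduced presentation. -/
def Good.localData (hD : Good D) : LocalData p where
  mu := padicValNat p D.m
  nu := padicValNat p D.n
  gam := padicValNat p D.s
  kap := padicValNat p (orderOf (D.tau : ZMod (ordCompl[p] D.m)))
  tau := D.tau
  W d i := (D.away (ordCompl[p] D.n) (ordCompl[p] D.m * ordCompl[p] D.n) p d i).ncard
  gam_le := (padicValNat_dvd_iff_le D.m_pos.ne').1 (pow_padicValNat_dvd.trans hD.s_dvd)
  one_lt_tau := hD.one_lt_tau
  stable := by
    have h1 := (Nat.modEq_iff_dvd' (Nat.le_mul_of_pos_left D.s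
      (by have := hD.one_lt_tau; omega))).1 D.s_tau.symm
    have h2 : p ^ padicValNat p D.m ∣ ordCompl[p] D.s * (p ^ padicValNat p D.s * (D.tau - 1)) := by
      refine (pow_padicValNat_dvd.trans h1).trans (dvd_of_eq ?_)
      rw [← mul_assoc, mul_comm (ordCompl[p] D.s), ← Pres.eq_pow_mul p D.s, Nat.mul_sub, mul_one,
        mul_comm]
    exact (Nat.Coprime.pow_left _ (Nat.coprime_ordCompl hp.out hD.s_pos.ne')).dvd_of_dvd_mul_left h2
  tau_pow h := by
    have hτ := hD.one_lt_tau
    refine pow_dvd_sub_one_of_pow hp.out (Nat.one_lt_pow (pow_pos hp.out.pos _).ne' hτ)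
      (h.trans (by simpa using Nat.sub_dvd_pow_sub_pow D.tau 1 (p ^ padicValNat p D.n)))
      (Nat.not_dvd_ordCompl hp.out D.n_pos.ne') ?_
    rw [← pow_mul, ← Pres.eq_pow_mul p D.n]
    exact pow_padicValNat_dvd.trans
      ((Nat.modEq_iff_dvd' (Nat.one_le_pow _ _ (by omega))).1 D.tau_pow_n.symm)
  mod_four h h' := by
    subst h
    refine hD.mod_four ?_ ?_
    · simpa using (padicValNat_dvd_iff_le (p := 2) (n := 1) D.m_pos.ne').2 (by omega)
    · intro h4
      have := (padicValNat_dvd_iff_le (p := 2) (n := 2) D.m_pos.ne').1 (by simpa using h4)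
      omega
  not_dvd h h' := by
    have h1 : p ∣ D.m := by
      simpa using (padicValNat_dvd_iff_le (p := p) (n := 1) D.m_pos.ne').2 (by omega)
    exact Nat.not_coprime_of_dvd_of_dvd hp.out.one_lt h' h1 D.tau_coprime
  kap_le := by
    refine (padicValNat_dvd_iff_le D.n_pos.ne').1 (pow_padicValNat_dvd.trans ?_)
    apply orderOf_dvd_of_pow_eq_one
    have := (D.tau_pow_n.of_dvd (Nat.ordCompl_dvd D.m p))
    rw [← ZMod.natCast_eq_natCast_iff] at this
    exact_mod_cast this
  W_zero := by
    have := D.neZero_ordCompl p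
    rw [Set.ncard_pos]
    refine ⟨0, one_dvd _, by simp, ?_, by simp⟩
    rw [pow_zero, mul_one, ← Nat.dvd_one, Pres.per_dvd_iff]
    simp
  W_kap := by
    have := D.neZero_ordCompl p
    refine ⟨ordCompl[p] (orderOf (D.tau : ZMod (ordCompl[p] D.m))),
      Nat.coprime_ordCompl hp.out ?_, D.away_order_pos rfl⟩
    intro h
    have h2 : orderOf (D.tau : ZMod (ordCompl[p] D.m)) ∣ D.n := by
      apply orderOf_dvd_of_pow_eq_one
      have := (D.tau_pow_n.of_dvd (Nat.ordCompl_dvd D.m p))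
      rw [← ZMod.natCast_eq_natCast_iff] at this
      exact_mod_cast this
    rw [h, zero_dvd_iff] at h2
    exact D.n_pos.ne' h2
  W_le d i h := by
    obtain ⟨q, hq⟩ := Set.nonempty_of_ncard_ne_zero h
    exact D.le_of_mem_away (D.coprime_ordCompl p) hq
  gam_le_nu _ h1 h4 := hD.gam_le_nu h1 h4
  rho_or _ _ h4 := hD.rho_or h4
  mu_lt h h4 h' := by
    subst h
    exact hD.mu_lt h4 h'

end Local

section Congruence

variable {m : ℕ} [NeZero m]

lemma mul_eq_zero_iff_gcd (c : ℕ) (x : ZMod m) :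
    (c : ZMod m) * x = 0 ↔ ((m.gcd c : ℕ) : ZMod m) * x = 0 := by
  constructor
  · intro h
    have h1 := congrArg (Int.cast : ℤ → ZMod m) (Nat.gcd_eq_gcd_ab m c)
    push_cast at h1
    rw [ZMod.natCast_self, zero_mul, zero_add] at h1
    rw [h1]
    linear_combination (Nat.gcdB m c : ZMod m) * h
  · intro h
    obtain ⟨k, hk⟩ := Nat.gcd_dvd_right m c
    rw [hk, Nat.cast_mul]
    linear_combination (k : ZMod m) * h

lemma ncard_mul_add_eq_zero (c s : ℕ) :
    (m.gcd c ∣ s ∧ {x : ZMod m | (c : ZMod m) * x + s = 0}.ncard = m.gcd c) ∨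
      (¬ m.gcd c ∣ s ∧ {x : ZMod m | (c : ZMod m) * x + s = 0}.ncard = 0) := by
  by_cases h : m.gcd c ∣ s
  · refine Or.inl ⟨h, ?_⟩
    obtain ⟨k, hk⟩ := h
    obtain ⟨x₀, hx₀⟩ : ∃ x₀ : ZMod m, (c : ZMod m) * x₀ = -s := by
      have h1 := congrArg (Int.cast : ℤ → ZMod m) (Nat.gcd_eq_gcd_ab m c)
      push_cast at h1
      rw [ZMod.natCast_self, zero_mul, zero_add] at h1
      refine ⟨-(Nat.gcdB m c * k), ?_⟩
      rw [hk, Nat.cast_mul, h1]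
      ring
    have h2 : {x : ZMod m | (c : ZMod m) * x + s = 0} =
        (fun x => x₀ + x) '' {x : ZMod m | ((m.gcd c : ℕ) : ZMod m) * x = 0} := by
      ext x
      simp only [Set.mem_ofPred_eq, Set.mem_image, ← mul_eq_zero_iff_gcd]
      constructor
      · intro hx
        exact ⟨x - x₀, by linear_combination hx - hx₀, by ring⟩
      · rintro ⟨y, hy, rfl⟩
        linear_combination hy + hx₀
    obtain ⟨l, hl⟩ := Nat.gcd_dvd_left m c
    rw [h2, Set.ncard_image_of_injective _ (add_right_injective x₀),
      ncard_mul_eq_zero hl (NeZero.ne m)]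
  · refine Or.inr ⟨h, ?_⟩
    rw [Set.ncard_eq_zero, Set.eq_empty_iff_forall_notMem]
    intro x hx
    apply h
    have hx' : (c : ZMod m) * x + s = 0 := hx
    rw [← ZMod.natCast_zmod_val x, ← Nat.cast_mul, ← Nat.cast_add, ZMod.natCast_eq_zero_iff] at hx'
    exact (Nat.dvd_add_right ((Nat.gcd_dvd_right m c).mul_right _)).1
      ((Nat.gcd_dvd_left m c).trans hx')

end Congruence

section Involutions

variable {G : Type*} [Group G] (D : Pres G)

namespace Pres

lemma exists_reduced [NeZero D.m] (g : G) : ∃ x : ZMod D.m, ∃ y, y < D.n ∧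
    g = D.a ^ x.val * D.b ^ y := by
  obtain ⟨x, y, rfl⟩ := D.cover g
  refine ⟨((x + D.s * (y / D.n) : ℕ) : ZMod D.m), y % D.n, Nat.mod_lt _ D.n_pos, ?_⟩
  have h1 : D.a ^ ((x + D.s * (y / D.n) : ℕ) : ZMod D.m).val = D.a ^ (x + D.s * (y / D.n)) := by
    rw [pow_a_eq_iff, ZMod.val_natCast]
    exact Nat.mod_modEq _ _
  rw [h1, pow_add, pow_mul, ← D.pow_n, mul_assoc, ← pow_mul, ← pow_add, Nat.div_add_mod]

lemma reduced_inj [NeZero D.m] {x x' : ZMod D.m} {y y' : ℕ} (hy : y < D.n) (hy' : y' < D.n)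
    (h : D.a ^ x.val * D.b ^ y = D.a ^ x'.val * D.b ^ y') : x = x' ∧ y = y' := by
  have key : ∀ {x x' : ZMod D.m} {y y' : ℕ}, y ≤ y' → y' < D.n →
      D.a ^ x.val * D.b ^ y = D.a ^ x'.val * D.b ^ y' → x = x' ∧ y = y' := by
    intro x x' y y' hle hlt h
    obtain ⟨k, h1, h2⟩ := D.rep_eq h hle
    have hk : k = 0 := by
      by_contra hk
      have := Nat.le_mul_of_pos_right D.n (Nat.pos_of_ne_zero hk)
      omega
    subst hk
    rw [mul_zero, add_zero, ← ZMod.natCast_eq_natCast_iff, ZMod.natCast_zmod_val,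
      ZMod.natCast_zmod_val] at h2
    exact ⟨h2, by omega⟩
  rcases le_total y y' with hle | hle
  · exact key hle hy' h
  · exact (key hle hy h.symm).imp Eq.symm Eq.symm

lemma sq_eq_one_iff {h : ℕ} (hn : D.n = 2 * h) [NeZero D.m] (x : ZMod D.m) {y : ℕ}
    (hy : y < D.n) : D.a ^ x.val * D.b ^ y * (D.a ^ x.val * D.b ^ y) = 1 ↔
      (y = 0 ∧ ((2 : ℕ) : ZMod D.m) * x + (0 : ℕ) = 0) ∨
        (y = h ∧ ((D.tau ^ h + 1 : ℕ) : ZMod D.m) * x + D.s = 0) := by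
  have ha : ∀ k : ℕ, D.a ^ k = 1 ↔ (k : ZMod D.m) = 0 := fun k => by
    rw [← pow_zero D.a, pow_a_eq_iff, ← ZMod.natCast_eq_natCast_iff, Nat.cast_zero]
  have hh : h ≠ 0 := by
    rintro rfl
    have := D.n_pos
    omega
  rw [D.mul_eq]
  by_cases h0 : y = 0
  · subst h0
    rw [pow_zero, one_mul, add_zero, pow_zero, mul_one, ha]
    simp only [true_and, hh.symm, false_and, or_false]
    push_cast
    rw [ZMod.natCast_zmod_val, two_mul, add_zero]
  by_cases h1 : y = h
  · subst h1
    rw [← two_mul, ← hn, D.pow_n, ← pow_add, ha]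
    simp only [h0, true_and, false_and, false_or]
    push_cast
    rw [ZMod.natCast_zmod_val]
    ring_nf
  · simp only [h0, h1, false_and, or_false, iff_false]
    intro h2
    have h3 : D.b ^ (y + y) ∈ Subgroup.zpowers D.a := by
      rw [eq_inv_of_mul_eq_one_right h2]
      exact inv_mem (pow_mem (Subgroup.mem_zpowers _) _)
    obtain ⟨k, hk⟩ := D.dvd_of_mem _ h3
    have hk2 : k < 2 := by
      by_contra hk2
      have := Nat.mul_le_mul_left D.n (Nat.le_of_not_lt hk2)
      omega
    interval_cases k <;> omega

lemma ncard_sq_eq_one {h : ℕ} (hn : D.n = 2 * h) (hm : 2 ∣ D.m) :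
    (D.m.gcd (D.tau ^ h + 1) ∣ D.s ∧
      {g : G | g * g = 1}.ncard = 2 + D.m.gcd (D.tau ^ h + 1)) ∨
    (¬ D.m.gcd (D.tau ^ h + 1) ∣ D.s ∧ {g : G | g * g = 1}.ncard = 2) := by
  have : NeZero D.m := ⟨D.m_pos.ne'⟩
  have hh : 0 < h := by
    have := D.n_pos
    omega
  have h1 : {g : G | g * g = 1} =
      (fun x : ZMod D.m => D.a ^ x.val * D.b ^ 0) ''
        {x | ((2 : ℕ) : ZMod D.m) * x + (0 : ℕ) = 0} ∪
      (fun x : ZMod D.m => D.a ^ x.val * D.b ^ h) ''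
        {x | ((D.tau ^ h + 1 : ℕ) : ZMod D.m) * x + D.s = 0} := by
    ext g
    constructor
    · intro hg
      obtain ⟨x, y, hy, rfl⟩ := D.exists_reduced g
      rcases (D.sq_eq_one_iff hn x hy).1 hg with ⟨rfl, h⟩ | ⟨rfl, h⟩
      · exact Or.inl ⟨x, h, rfl⟩
      · exact Or.inr ⟨x, h, rfl⟩
    · rintro (⟨x, hx, rfl⟩ | ⟨x, hx, rfl⟩)
      · exact (D.sq_eq_one_iff hn x D.n_pos).2 (Or.inl ⟨rfl, hx⟩)
      · exact (D.sq_eq_one_iff hn x (by omega)).2 (Or.inr ⟨rfl, hx⟩)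
  have h2 : {g : G | g * g = 1}.ncard = 2 +
      {x : ZMod D.m | ((D.tau ^ h + 1 : ℕ) : ZMod D.m) * x + D.s = 0}.ncard := by
    rw [h1, Set.ncard_union_eq, Set.ncard_image_of_injective, Set.ncard_image_of_injective]
    · congr 1
      rcases ncard_mul_add_eq_zero (m := D.m) 2 0 with h | h
      · rw [h.2, Nat.gcd_eq_right hm]
      · exact absurd (dvd_zero _) h.1
    · intro x x' hx
      exact (D.reduced_inj (by omega) (by omega) hx).1
    · intro x x' hx
      exact (D.reduced_inj D.n_pos D.n_pos hx).1
    · rw [Set.disjoint_left]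
      rintro _ ⟨x, -, rfl⟩ ⟨x', -, hx'⟩
      have := (D.reduced_inj (by omega) D.n_pos hx').2
      omega
  rw [h2]
  rcases ncard_mul_add_eq_zero (m := D.m) (D.tau ^ h + 1) D.s with h | h
  · exact Or.inl ⟨h.1, by rw [h.2]⟩
  · exact Or.inr ⟨h.1, by rw [h.2]⟩

end Pres

end Involutions

namespace Good

variable {G : Type*} [Group G] {D : Pres G}

lemma dvd_s_mul (hD : Good D) : D.m ∣ D.s * (D.tau - 1) := by
  have h1 := (Nat.modEq_iff_dvd' (Nat.le_mul_of_pos_left D.s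
    (by have := hD.one_lt_tau; omega))).1 D.s_tau.symm
  rwa [show D.tau * D.s - D.s = D.s * (D.tau - 1) by rw [Nat.mul_sub, mul_one, mul_comm]] at h1

lemma gcd_dvd_s (hD : Good D) (h2 : padicValNat 2 D.s = padicValNat 2 D.m) (h : ℕ) :
    D.m.gcd (D.tau ^ h + 1) ∣ D.s := by
  rw [Nat.dvd_iff_prime_pow_dvd_dvd]
  intro q k hq hk
  have hm := hk.trans (Nat.gcd_dvd_left _ _)
  by_cases hq2 : q = 2
  · subst hq2
    have : Fact (Nat.Prime 2) := ⟨hq⟩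
    rw [padicValNat_dvd_iff_le D.m_pos.ne'] at hm
    rw [padicValNat_dvd_iff_le hD.s_pos.ne']
    omega
  rcases Nat.eq_zero_or_pos k with rfl | hk0
  · rw [pow_zero]
    exact one_dvd _
  have h1 : ¬ q ∣ D.tau - 1 := by
    intro h1
    have h3 : q ∣ D.tau ^ h - 1 := h1.trans (by simpa using Nat.sub_dvd_pow_sub_pow D.tau 1 h)
    have h4 : q ∣ D.tau ^ h + 1 :=
      ((dvd_pow_self q hk0.ne').trans hk).trans (Nat.gcd_dvd_right _ _)
    have h5 : q ∣ 2 := by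
      have := Nat.dvd_sub h4 h3
      have h6 := Nat.one_le_pow h D.tau (by have := hD.one_lt_tau; omega)
      rwa [show D.tau ^ h + 1 - (D.tau ^ h - 1) = 2 by omega] at this
    exact hq2 ((Nat.prime_dvd_prime_iff_eq hq Nat.prime_two).1 h5)
  exact (Nat.Coprime.pow_left k ((hq.coprime_iff_not_dvd).2 h1)).dvd_of_dvd_mul_right
    (hm.trans hD.dvd_s_mul)

lemma ncard_sq_eq_one (hD : Good D) (hm : 2 ∣ D.m) (h4 : 4 ∣ D.tau + 1)
    (hn : padicValNat 2 D.n = 1) (hs : padicValNat 2 D.s = padicValNat 2 D.m) :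
    ∃ g, 0 < g ∧ 2 ^ padicValNat 2 D.m ∣ g ∧ {g : G | g * g = 1}.ncard = 2 + g := by
  obtain ⟨h, hh⟩ : 2 ∣ D.n := by
    simpa using (padicValNat_dvd_iff_le (p := 2) (n := 1) D.n_pos.ne').2 hn.ge
  have hodd : Odd h := by
    rw [← Nat.not_even_iff_odd]
    rintro ⟨k, rfl⟩
    have := (padicValNat_dvd_iff_le (p := 2) (n := 2) D.n_pos.ne').1 ⟨k, by omega⟩
    omega
  rcases D.ncard_sq_eq_one hh hm with h1 | h1
  · refine ⟨_, Nat.gcd_pos_of_pos_left _ D.m_pos, Nat.dvd_gcd pow_padicValNat_dvd ?_, h1.2⟩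
    have h2 := hD.mu_lt h4 hs
    have h3 : D.tau + 1 ∣ D.tau ^ h + 1 := by simpa using hodd.nat_add_dvd_pow_add_pow D.tau 1
    refine Dvd.dvd.trans ?_ h3
    rw [padicValNat_dvd_iff_le (by omega)]
    omega
  · exact absurd (hD.gcd_dvd_s hs h) h1.1

variable {H : Type*} [Group H] {D' : Pres H}

lemma padicValNat_s_eq (hD : Good D) (hD' : Good D')
    (hcard : {g : G | g * g = 1}.ncard = {g : H | g * g = 1}.ncard)
    (hm : 2 ∣ D.m) (h4 : 4 ∣ D.tau + 1)
    (hn : padicValNat 2 D.n = 1) (hn' : padicValNat 2 D'.n = 1)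
    (hmm : padicValNat 2 D.m = padicValNat 2 D'.m)
    (hs : padicValNat 2 D.s = padicValNat 2 D.m) :
    padicValNat 2 D'.s = padicValNat 2 D'.m := by
  obtain ⟨g, hg0, hg, hc⟩ := hD.ncard_sq_eq_one hm h4 hn hs
  have hm' : 2 ∣ D'.m := by
    have : 1 ≤ padicValNat 2 D'.m := by
      rw [← hmm, ← padicValNat_dvd_iff_le D.m_pos.ne']
      simpa using hm
    simpa using (padicValNat_dvd_iff_le (p := 2) (n := 1) D'.m_pos.ne').2 this
  obtain ⟨h, hh⟩ : 2 ∣ D'.n := by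
    simpa using (padicValNat_dvd_iff_le (p := 2) (n := 1) D'.n_pos.ne').2 hn'.ge
  rw [hcard] at hc
  rcases D'.ncard_sq_eq_one hh hm' with h1 | h1
  · have h2 : D'.m.gcd (D'.tau ^ h + 1) = g := by omega
    have h3 := hg.trans (h2 ▸ h1.1)
    rw [hmm, padicValNat_dvd_iff_le hD'.s_pos.ne'] at h3
    exact le_antisymm ((padicValNat_dvd_iff_le D'.m_pos.ne').1
      (pow_padicValNat_dvd.trans hD'.s_dvd)) h3
  · omega

end Good

section Local

variable {G : Type*} [Group G] [Finite G] {D : Pres G} {p : ℕ} [hp : Fact p.Prime]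

namespace LocalData

lemma gam_eq_mu_of_free {L : LocalData p} (h : L.Free) : L.gam = L.mu := by
  refine le_antisymm L.gam_le ?_
  rcases h with h | h
  · omega
  · have := (Nat.Coprime.pow_left L.mu ((hp.out.coprime_iff_not_dvd).2 h)).dvd_of_dvd_mul_right
      L.stable
    rwa [Nat.pow_dvd_pow_iff_le_right hp.out.one_lt] at this

lemma mu_le_gam_add_one {L : LocalData p} (h : L.Dih) : L.mu ≤ L.gam + 1 := by
  obtain ⟨rfl, -, h3⟩ := h
  have h1 := L.stable
  obtain ⟨k, hk⟩ : ∃ k, L.tau - 1 = 2 * k := ⟨L.tau / 2, by omega⟩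
  have hk' : ¬ 2 ∣ k := by omega
  rw [hk, ← mul_assoc, ← pow_succ] at h1
  have := (Nat.Coprime.pow_left L.mu
    ((hp.out.coprime_iff_not_dvd).2 hk')).dvd_of_dvd_mul_right h1
  rwa [Nat.pow_dvd_pow_iff_le_right (by norm_num)] at this

end LocalData

lemma Pres.mul_eq_pow_mul (D : Pres G) (p : ℕ) [hp : Fact p.Prime] : D.m * D.n =
    p ^ (padicValNat p D.m + padicValNat p D.n) * (ordCompl[p] D.m * ordCompl[p] D.n) := by
  conv_lhs => rw [Pres.eq_pow_mul p D.m, Pres.eq_pow_mul p D.n]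
  rw [pow_add]
  ring

lemma not_dvd_ordCompl (k : ℕ) (hk : k ≠ 0) : ¬ p ∣ ordCompl[p] k :=
  Nat.not_dvd_ordCompl hp.out hk

variable {e Q t t₁ : ℕ}

lemma Good.ncard_fixedPairs_one (hD : Good D) (hQ : Q = ordCompl[p] D.m * ordCompl[p] D.n)
    (ht : t ≡ t₁ [MOD p ^ e]) (ht' : t ≡ 1 [MOD Q]) :
    (D.fixedPairs (p ^ e * Q) 1 t).ncard =
      (D.linAway Q).ncard * ((hD.localData p).lin e t₁).ncard := by
  have : NeZero Q := hQ ▸ D.neZero_ordCompl p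
  exact D.ncard_fixedPairs_one (hQ ▸ D.coprime_ordCompl p) (Pres.eq_pow_mul p D.m)
    (not_dvd_ordCompl _ D.m_pos.ne') (Pres.eq_pow_mul p D.n) (not_dvd_ordCompl _ D.n_pos.ne')
    (Pres.eq_pow_mul p D.s) (not_dvd_ordCompl _ hD.s_pos.ne') ht ht'

lemma Good.ncard_fixedPairs_pow (hD : Good D) (hQ : Q = ordCompl[p] D.m * ordCompl[p] D.n)
    (hF : ¬ (hD.localData p).Free) (ht : t ≡ t₁ [MOD p ^ e]) (ht' : t ≡ 1 [MOD Q]) {d f : ℕ}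
    (hd : p.Coprime d) :
    (D.fixedPairs (p ^ e * Q) (d * p ^ f) t).ncard =
      ∑ i ∈ Finset.range (f + 1), (hD.localData p).W d i *
        ((hD.localData p).X e i f t₁).ncard := by
  have : NeZero Q := hQ ▸ D.neZero_ordCompl p
  subst hQ
  have h1 : p ∣ D.tau - 1 := by
    by_contra h
    exact hF (Or.inr h)
  exact D.ncard_fixedPairs_pow (D.coprime_ordCompl p) (Pres.eq_pow_mul p D.m)
    (not_dvd_ordCompl _ D.m_pos.ne') (Pres.eq_pow_mul p D.n) (not_dvd_ordCompl _ D.n_pos.ne')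
    (Pres.eq_pow_mul p D.s) (not_dvd_ordCompl _ hD.s_pos.ne') hD.one_lt_tau
    ((hD.localData p).tau_pow h1) ht ht' hd

lemma eq_of_mul_eq_mul_of_coprime {a a' x x' E : ℕ} (ha : p.Coprime a) (ha' : p.Coprime a')
    (hx : x ∣ p ^ E) (hx' : x' ∣ p ^ E) (h : a * x = a' * x') : a = a' := by
  have key : ∀ {a a' x x' : ℕ}, p.Coprime a → x' ∣ p ^ E → a * x = a' * x' → a ∣ a' := by
    intro a a' x x' ha hx' h
    exact (Nat.Coprime.coprime_dvd_right hx' (Nat.Coprime.pow_right E ha.symm)).dvd_of_dvd_mul_right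
      ((Dvd.intro _ rfl : a ∣ a * x).trans (dvd_of_eq h))
  exact Nat.dvd_antisymm (key ha hx' h) (key ha' hx h.symm)

variable {H : Type*} [Group H] [Finite H] {D' : Pres H}

/-- The primary parts of `s` are determined by the rational group algebra. -/
theorem padicValNat_s_eq_of_algEquiv (φ : MonoidAlgebra ℚ G ≃ₐ[ℚ] MonoidAlgebra ℚ H)
    (hD : Good D) (hD' : Good D') (p : ℕ) [hp : Fact p.Prime] :
    padicValNat p D.s = padicValNat p D'.s := by
  have := Fintype.ofFinite G
  have := Fintype.ofFinite H
  have hcard : D.m * D.n = D'.m * D'.n := by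
    rw [← D.card_eq, ← D'.card_eq, Nat.card_eq_fintype_card, Nat.card_eq_fintype_card,
      card_eq_of_algEquiv φ]
  obtain ⟨Q, hQ⟩ : ∃ Q, Q = ordCompl[p] D.m * ordCompl[p] D.n := ⟨_, rfl⟩
  obtain ⟨e, he⟩ : ∃ e, e = padicValNat p D.m + padicValNat p D.n := ⟨_, rfl⟩
  have he' : e = padicValNat p D'.m + padicValNat p D'.n := by
    rw [he, ← padicValNat.mul D.m_pos.ne' D.n_pos.ne', hcard,
      padicValNat.mul D'.m_pos.ne' D'.n_pos.ne']
  have hQ' : Q = ordCompl[p] D'.m * ordCompl[p] D'.n := by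
    have h1 := hcard
    rw [D.mul_eq_pow_mul p, D'.mul_eq_pow_mul p, ← he, ← he'] at h1
    rw [hQ]
    exact Nat.eq_of_mul_eq_mul_left (pow_pos hp.out.pos _) h1
  have hN : p ^ e * Q = D.m * D.n := by rw [D.mul_eq_pow_mul p, he, hQ]
  have hpQ : p.Coprime Q := hQ ▸ D.coprime_ordCompl p
  have hQ0 : NeZero Q := hQ ▸ D.neZero_ordCompl p
  have hN0 : NeZero (p ^ e * Q) := ⟨mul_ne_zero (pow_ne_zero _ hp.out.ne_zero) (NeZero.ne Q)⟩
  have ht : ∀ t₁, ¬ p ∣ t₁ → ∃ t, (p ^ e * Q).Coprime t ∧ t ≡ t₁ [MOD p ^ e] ∧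
      t ≡ 1 [MOD Q] := by
    intro t₁ h1
    obtain ⟨t, h2, h3⟩ := Nat.chineseRemainder (Nat.Coprime.pow_left e hpQ) t₁ 1
    refine ⟨t, Nat.Coprime.mul_left ?_ ?_, h2, h3⟩
    · rw [Nat.coprime_comm, Nat.Coprime, h2.gcd_eq]
      exact Nat.Coprime.pow_right e ((hp.out.coprime_iff_not_dvd).2 h1).symm
    · rw [Nat.coprime_comm, Nat.Coprime, h3.gcd_eq, Nat.gcd_one_left]
  have hfix : ∀ d {t}, (p ^ e * Q).Coprime t →
      (D.fixedPairs (p ^ e * Q) d t).ncard = (D'.fixedPairs (p ^ e * Q) d t).ncard :=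
    fun d t ht => D.ncard_fixedPairs_eq D' φ hN (hN.trans hcard) d ht
  have hlin : ∀ t, ¬ p ∣ t → (D.linAway Q).ncard * ((hD.localData p).lin e t).ncard =
      (D'.linAway Q).ncard * ((hD'.localData p).lin e t).ncard := by
    intro t₁ h1
    obtain ⟨t, h2, h3, h4⟩ := ht t₁ h1
    rw [← hD.ncard_fixedPairs_one hQ h3 h4, ← hD'.ncard_fixedPairs_one hQ' h3 h4, hfix 1 h2]
  have haway : (D.linAway Q).ncard = (D'.linAway Q).ncard := by
    refine eq_of_mul_eq_mul_of_coprime (p := p) (E := e + e) (D.coprime_ncard_linAway hpQ)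
      (D'.coprime_ncard_linAway hpQ) ?_ ?_ (hlin 1 hp.out.not_dvd_one)
    all_goals
      rw [pow_add]
      exact Pres.ncard_linSet_dvd _ _ _ _ _ _
  have hsq : {g : G | g * g = 1}.ncard = {g : H | g * g = 1}.ncard := by
    have := card_sq_eq_one_of_algEquiv φ
    rwa [← Set.ncard_coe_finset, ← Set.ncard_coe_finset, Finset.coe_filter_univ,
      Finset.coe_filter_univ] at this
  refine LocalData.gam_eq (D := hD.localData p) (D' := hD'.localData p) he he' ?_ ?_ ?_
    LocalData.gam_eq_mu_of_free LocalData.gam_eq_mu_of_free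
  · intro t h1
    have h2 := hlin t h1
    rw [haway] at h2
    refine Nat.eq_of_mul_eq_mul_left ?_ h2
    refine Nat.pos_of_ne_zero fun h0 => ?_
    have := D'.coprime_ncard_linAway hpQ
    rw [h0, Nat.coprime_zero_right] at this
    exact hp.out.one_lt.ne' this
  · intro h1 h2 d hd f t₁ h3
    obtain ⟨t, h4, h5, h6⟩ := ht t₁ h3
    rw [← hD.ncard_fixedPairs_pow hQ h1 h5 h6 hd, ← hD'.ncard_fixedPairs_pow hQ' h2 h5 h6 hd,
      hfix _ h4]
  · intro h1 h2 hn hn' hm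
    have b1 := LocalData.mu_le_gam_add_one h1
    have b2 := LocalData.mu_le_gam_add_one h2
    have b3 := (hD.localData p).gam_le
    have b4 := (hD'.localData p).gam_le
    obtain ⟨rfl, c1, c2⟩ := h1
    obtain ⟨-, c1', c2'⟩ := h2
    change padicValNat 2 D.s = padicValNat 2 D'.s
    change padicValNat 2 D.m = padicValNat 2 D'.m at hm
    change padicValNat 2 D.n = 1 at hn
    change padicValNat 2 D'.n = 1 at hn'
    change padicValNat 2 D.m ≤ padicValNat 2 D.s + 1 at b1
    change padicValNat 2 D'.m ≤ padicValNat 2 D'.s + 1 at b2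
    change padicValNat 2 D.s ≤ padicValNat 2 D.m at b3
    change padicValNat 2 D'.s ≤ padicValNat 2 D'.m at b4
    change 2 ≤ padicValNat 2 D.m at c1
    change 2 ≤ padicValNat 2 D'.m at c1'
    change D.tau % 4 = 3 at c2
    change D'.tau % 4 = 3 at c2'
    have e1 : 2 ∣ D.m := by
      simpa using (padicValNat_dvd_iff_le (p := 2) (n := 1) D.m_pos.ne').2 (by omega)
    have e2 : 2 ∣ D'.m := by
      simpa using (padicValNat_dvd_iff_le (p := 2) (n := 1) D'.m_pos.ne').2 (by omega)
    have k1 := hD.padicValNat_s_eq hD' hsq e1 (by omega) hn hn' hm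
    have k2 := hD'.padicValNat_s_eq hD hsq.symm e2 (by omega) hn' hn hm.symm
    omega

end Local

/-- If `ℚG ≅ ℚH` for finite metacyclic `G, H`, then `s^G = s^H`. -/
theorem s_eq_of_qalgebra_iso {G H : Type*} [Group G] [Group H] [Finite G] [Finite H]
    (fG : MetacyclicFact G) (hfG : IsMinimalFact fG)
    (fH : MetacyclicFact H) (hfH : IsMinimalFact fH)
    (h : Nonempty (MonoidAlgebra ℚ G ≃ₐ[ℚ] MonoidAlgebra ℚ H)) :
    sOf fG = sOf fH := by
  obtain ⟨φ⟩ := h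
  obtain ⟨D, hD, hs⟩ := exists_good fG hfG
  obtain ⟨D', hD', hs'⟩ := exists_good fH hfH
  rw [← hs, ← hs']
  refine Nat.eq_of_factorization_eq hD.s_pos.ne' hD'.s_pos.ne' fun p => ?_
  by_cases hp : p.Prime
  · have : Fact p.Prime := ⟨hp⟩
    rw [Nat.factorization_def _ hp, Nat.factorization_def _ hp]
    exact padicValNat_s_eq_of_algEquiv φ hD hD' p
  · rw [Nat.factorization_eq_zero_of_not_prime _ hp, Nat.factorization_eq_zero_of_not_prime _ hp]

end ArXiv230800432
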